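/- Let m ∈ ℕ and let χ be a quadratic Dirichlet character modulo q, not necessarily primitive, whose conductor does not divide m. Then for every ε > 0 there is a constant C depending only on m and ε such that there exists a prime p with p ≡ 1 (mod m), χ(p) = −1, and p ≤ C · q^{φ(m)/(4√e)+ε}, where φ is Euler's totient function and e is Euler's number. -/

import Mathlib

section Stepanov

open Polynomial

variable {F : Type*} [Field F]

/-- The operator `u ↦ n f' u + f u'`, so that `(f ^ n u)' = f ^ (n - 1) * stepOp f n u`. -/
noncomputable def stepOp (f : F[X]) (n : ℕ) : F[X] →ₗ[F] F[X] :=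
  LinearMap.mulLeft F ((n : F[X]) * derivative f) + LinearMap.mulLeft F f ∘ₗ derivative

/-- The iterates of `stepOp`, so that the `k`-th derivative of `f ^ n u` is
`f ^ (n - k) * stepIter f n k u`. -/
noncomputable def stepIter (f : F[X]) (n : ℕ) : ℕ → F[X] →ₗ[F] F[X]
  | 0 => LinearMap.id
  | k + 1 => stepOp f (n - k) ∘ₗ stepIter f n k

lemma stepOp_apply (f : F[X]) (n : ℕ) (u : F[X]) :
    stepOp f n u = n * derivative f * u + f * derivative u := by
  simp [stepOp, mul_assoc]

lemma iterate_derivative_pow_mul (f u : F[X]) (n k : ℕ) (hk : k ≤ n) :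
    derivative^[k] (f ^ n * u) = f ^ (n - k) * stepIter f n k u := by
  induction k with
  | zero => simp [stepIter]
  | succ k ih =>
    rw [Function.iterate_succ_apply', ih (by omega)]
    obtain ⟨j, hj⟩ : ∃ j, n - k = j + 1 := ⟨n - k - 1, by omega⟩
    rw [show n - (k + 1) = j by omega]
    simp only [stepIter, LinearMap.comp_apply, stepOp_apply, hj, derivative_mul, derivative_pow]
    simp
    ring

lemma stepIter_mul_of_derivative_eq_zero (f u v : F[X]) (hv : derivative v = 0) (n k : ℕ) :
    stepIter f n k (u * v) = stepIter f n k u * v := by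
  induction k with
  | zero => simp [stepIter]
  | succ k ih =>
    simp only [stepIter, LinearMap.comp_apply, stepOp_apply, ih, derivative_mul, hv]
    ring

lemma natDegree_stepIter_le (f u : F[X]) (n k : ℕ) :
    (stepIter f n k u).natDegree ≤ u.natDegree + k * f.natDegree := by
  induction k with
  | zero => simp [stepIter]
  | succ k ih =>
    simp only [stepIter, LinearMap.comp_apply, stepOp_apply]
    refine (natDegree_add_le _ _).trans (max_le ?_ ?_)
    · refine natDegree_mul_le.trans ?_
      have h1 : (((n - k : ℕ) : F[X]) * derivative f).natDegree ≤ f.natDegree := by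
        refine natDegree_mul_le.trans ?_
        have := natDegree_derivative_le f
        simp only [natDegree_natCast]
        omega
      rw [Nat.succ_mul]; omega
    · refine natDegree_mul_le.trans ?_
      have := natDegree_derivative_le (stepIter f n k u)
      rw [Nat.succ_mul]; omega

/-- If `X ^ p` divides `r + f ^ ((p - 1) / 2) * s` for polynomials `r`, `s` of small degree and a
polynomial `f` with a simple root, then `r = s = 0`. -/
lemma eq_zero_of_X_pow_dvd {p : ℕ} [Fact p.Prime] [CharP F p] (hp : p ≠ 2) {f r s : F[X]}
    (f0 : f.eval 0 ≠ 0) {a : F} (ha : f.rootMultiplicity a = 1) {K : ℕ}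
    (hK : 2 * K + f.natDegree < p) (hr : r.natDegree ≤ K) (hs : s.natDegree ≤ K)
    (h : X ^ p ∣ r + f ^ ((p - 1) / 2) * s) (hc : (f.eval 0) ^ p = f.eval 0) : r = 0 ∧ s = 0 := by
  have hp' : p.Prime := Fact.out
  have hodd : 2 * ((p - 1) / 2) + 1 = p := by
    have := hp'.eq_two_or_odd
    omega
  set g := f ^ ((p - 1) / 2) with hg
  have hfg : f * g ^ 2 = f ^ p := by
    rw [hg, ← pow_mul, ← pow_succ']
    congr 1
    omega
  have hf0 : f ≠ 0 := by rintro rfl; simp at f0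
  have h1 : X ^ p ∣ f ^ p - C (f.eval 0) := by
    have : X ∣ f - C (f.eval 0) := by
      rw [X_dvd_iff]; simp [coeff_zero_eq_eval_zero]
    have h2 := pow_dvd_pow_of_dvd this p
    rwa [sub_pow_char, ← C_pow, hc] at h2
  have h3 : X ^ p ∣ r ^ 2 * f - C (f.eval 0) * s ^ 2 := by
    have e : r ^ 2 * f - C (f.eval 0) * s ^ 2 =
        (r + g * s) * ((r - g * s) * f) + (f ^ p - C (f.eval 0)) * s ^ 2 := by
      rw [← hfg]; ring
    rw [e]
    exact dvd_add (Dvd.dvd.mul_right h _) (Dvd.dvd.mul_right h1 _)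
  have h4 : r ^ 2 * f - C (f.eval 0) * s ^ 2 = 0 := by
    refine eq_zero_of_dvd_of_natDegree_lt h3 ?_
    rw [natDegree_X_pow]
    refine (natDegree_sub_le _ _).trans_lt (max_lt ?_ ?_)
    · have := natDegree_mul_le (p := r ^ 2) (q := f)
      have := natDegree_pow_le (p := r) (n := 2)
      omega
    · have := natDegree_C_mul_le (f.eval 0) (s ^ 2)
      have := natDegree_pow_le (p := s) (n := 2)
      omega
  rw [sub_eq_zero] at h4
  by_cases hr0 : r = 0
  · refine ⟨hr0, ?_⟩
    rw [hr0] at h4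
    simpa [f0] using h4.symm
  · exfalso
    have hs0 : s ≠ 0 := by
      rintro rfl
      simp [hr0, hf0] at h4
    have hC : C (f.eval 0) ≠ 0 := by simpa using f0
    have := congrArg (rootMultiplicity a) h4
    rw [rootMultiplicity_mul (mul_ne_zero (pow_ne_zero _ hr0) hf0),
      rootMultiplicity_mul (mul_ne_zero hC (pow_ne_zero _ hs0)), pow_two, pow_two,
      rootMultiplicity_mul (mul_ne_zero hr0 hr0), rootMultiplicity_mul (mul_ne_zero hs0 hs0),
      rootMultiplicity_C, ha] at this
    omega

end Stepanov

section StepanovCount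

open Polynomial

/-- The existence of Stepanov's auxiliary polynomial. -/
lemma exists_stepanov_coeffs {F : Type*} [Field F] (f : F[X]) (e : F) {n₁ n₂ l J K : ℕ}
    (h : l * (K + l * f.natDegree + J) < 2 * (J * K)) :
    ∃ r s : Fin J → F[X], (∀ j, (r j).degree < K) ∧ (∀ j, (s j).degree < K) ∧
      (∃ j, r j ≠ 0 ∨ s j ≠ 0) ∧
      ∀ k < l, ∑ j, (stepIter f n₁ k (r j) + e • stepIter f n₂ k (s j)) * X ^ (j : ℕ) = 0 := by
  let toPoly : (Fin K → F) →ₗ[F] F[X] :=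
    (degreeLT F K).subtype ∘ₗ (degreeLTEquiv F K).symm.toLinearMap
  have hinj : Function.Injective toPoly :=
    (Submodule.injective_subtype _).comp (degreeLTEquiv F K).symm.injective
  have hdeg : ∀ v, (toPoly v).degree < K := fun v ↦
    mem_degreeLT.mp ((degreeLTEquiv F K).symm v).2
  let V := Fin J → Fin K → F
  let σ : ℕ → (V × V) →ₗ[F] F[X] := fun k ↦
    ∑ j : Fin J, LinearMap.mulRight F (X ^ (j : ℕ)) ∘ₗ
      ((stepIter f n₁ k) ∘ₗ toPoly ∘ₗ (LinearMap.proj j) ∘ₗ (LinearMap.fst F V V) +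
        e • ((stepIter f n₂ k) ∘ₗ toPoly ∘ₗ (LinearMap.proj j) ∘ₗ (LinearMap.snd F V V)))
  have hσ : ∀ k v, σ k v = ∑ j, (stepIter f n₁ k (toPoly (v.1 j)) +
      e • stepIter f n₂ k (toPoly (v.2 j))) * X ^ (j : ℕ) := by
    intro k v
    simp only [σ, LinearMap.sum_apply]
    rfl
  set L := K + l * f.natDegree + J with hL
  let Φ : (V × V) →ₗ[F] (Fin l → Fin L → F) :=
    LinearMap.pi fun k ↦ LinearMap.pi fun i ↦ (lcoeff F i) ∘ₗ σ k
  have hker : LinearMap.ker Φ ≠ ⊥ := by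
    apply LinearMap.ker_ne_bot_of_finrank_lt
    simp only [V, Module.finrank_prod, Module.finrank_pi_fintype, Module.finrank_self,
      Finset.sum_const, Finset.card_univ, Fintype.card_fin, smul_eq_mul, mul_one]
    omega
  obtain ⟨v, hv, hv0⟩ := (Submodule.ne_bot_iff _).mp hker
  refine ⟨fun j ↦ toPoly (v.1 j), fun j ↦ toPoly (v.2 j), fun j ↦ hdeg _, fun j ↦ hdeg _, ?_, ?_⟩
  · by_contra! hcon
    apply hv0
    refine Prod.ext (funext fun j ↦ hinj ?_) (funext fun j ↦ hinj ?_)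
    · exact (hcon j).1.trans (map_zero _).symm
    · exact (hcon j).2.trans (map_zero _).symm
  · intro k hk
    rw [← hσ]
    have hK : 0 < K := by
      rcases Nat.eq_zero_or_pos K with h0 | h0
      · subst h0; simp at h
      · exact h0
    have hnd : ∀ w, (toPoly w).natDegree ≤ K - 1 := fun w ↦ by
      have := hdeg w
      by_cases hw : toPoly w = 0
      · simp [hw]
      · rw [degree_eq_natDegree hw] at this
        have : (toPoly w).natDegree < K := by exact_mod_cast this
        omega
    have hkl : k * f.natDegree ≤ l * f.natDegree := Nat.mul_le_mul_right _ hk.le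
    have hlt : (σ k v).natDegree < L := by
      rw [hσ]
      refine Nat.lt_of_le_pred (by omega) (natDegree_sum_le_of_forall_le _ _ fun j _ ↦ ?_)
      have hj := j.2
      refine natDegree_mul_le.trans ?_
      rw [natDegree_X_pow]
      have : (stepIter f n₁ k (toPoly (v.1 j)) + e • stepIter f n₂ k (toPoly (v.2 j))).natDegree ≤
          K - 1 + k * f.natDegree := by
        refine (natDegree_add_le _ _).trans (max_le ?_ ((natDegree_smul_le _ _).trans ?_))
        · exact (natDegree_stepIter_le f _ n₁ k).trans (by have := hnd (v.1 j); omega)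
        · exact (natDegree_stepIter_le f _ n₂ k).trans (by have := hnd (v.2 j); omega)
      rw [Nat.pred_eq_sub_one]
      omega
    ext i
    by_cases hi : i < L
    · have := congrFun (congrFun (LinearMap.mem_ker.mp hv) ⟨k, hk⟩) ⟨i, hi⟩
      simpa [Φ] using this
    · rw [coeff_eq_zero_of_natDegree_lt (by omega), coeff_zero]

/-- A nonzero polynomial whose first `l ≤ p` derivatives vanish on a set `S` has degree at least
`l * #S`. -/
lemma card_mul_le_natDegree {p : ℕ} [Fact p.Prime] {P : (ZMod p)[X]} (hP : P ≠ 0) {l : ℕ}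
    (hl : l ≤ p) (S : Finset (ZMod p))
    (h : ∀ k < l, ∀ x ∈ S, (derivative^[k] P).eval x = 0) : S.card * l ≤ P.natDegree := by
  rcases Nat.eq_zero_or_pos l with rfl | hl0
  · simp
  have hmult : ∀ x ∈ S, l ≤ P.roots.count x := by
    intro x hx
    rw [count_roots]
    have h1 := lt_rootMultiplicity_of_isRoot_iterate_derivative_of_mem_nonZeroDivisors
      (p := P) (t := x) (n := l - 1) hP (fun k hk ↦ h k (by omega) x hx) (by
        apply mem_nonZeroDivisors_of_ne_zero
        rw [Ne, ZMod.natCast_eq_zero_iff, (Fact.out : p.Prime).dvd_factorial]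
        omega)
    omega
  calc S.card * l = ∑ x ∈ S, l := by simp
    _ ≤ ∑ x ∈ S, P.roots.count x := Finset.sum_le_sum hmult
    _ ≤ P.roots.card := by
      classical
      have : ∑ x ∈ S, P.roots.count x ≤ ∑ x ∈ S ∪ P.roots.toFinset, P.roots.count x :=
        Finset.sum_le_sum_of_subset Finset.subset_union_left
      rwa [Multiset.sum_count_eq_card fun a ha ↦
        Finset.mem_union_right _ (Multiset.mem_toFinset.mpr ha)] at this
    _ ≤ P.natDegree := P.card_roots'

lemma derivative_X_pow_mul_prime {F : Type*} [Field F] (p : ℕ) [CharP F p] (j : ℕ) :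
    derivative (X ^ (j * p) : F[X]) = 0 := by
  rw [derivative_X_pow]; simp

lemma eval_stepIter_mul_X_pow {p : ℕ} [Fact p.Prime] (f u : (ZMod p)[X]) (n k j : ℕ)
    (x : ZMod p) :
    (stepIter f n k (u * X ^ (j * p))).eval x = (stepIter f n k u).eval x * x ^ j := by
  rw [stepIter_mul_of_derivative_eq_zero _ _ _ (derivative_X_pow_mul_prime p j), eval_mul, eval_pow,
    eval_X, mul_comm j p, pow_mul, ZMod.pow_card]

/-- Stepanov's bound for the number of `x` at which `f x` has prescribed quadratic character. -/
theorem stepanov_card_le {p : ℕ} [Fact p.Prime] (hp : p ≠ 2) {f : (ZMod p)[X]} {a : ZMod p}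
    (f0 : f.eval 0 ≠ 0) (ha : f.rootMultiplicity a = 1) (e : ZMod p) {l J K : ℕ}
    (hK : 2 * K + f.natDegree < p) (hl : l ≤ p)
    (h : l * (K + l * f.natDegree + J) < 2 * (J * K)) (S : Finset (ZMod p))
    (hS : ∀ x ∈ S, f.eval x ≠ 0 ∧ f.eval x ^ ((p - 1) / 2) = e) :
    S.card * l ≤ (l + (p - 1) / 2) * f.natDegree + K + J * p := by
  classical
  obtain ⟨r, s, hr, hs, ⟨j₁, hj₁⟩, hrs⟩ :=
    exists_stepanov_coeffs f e (n₁ := l) (n₂ := l + (p - 1) / 2) h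
  set g := f ^ ((p - 1) / 2) with hg
  have hf : f ≠ 0 := by rintro rfl; simp at f0
  have hnd : ∀ {u : (ZMod p)[X]}, u.degree < K → u.natDegree ≤ K := fun {u} hu ↦
    natDegree_le_of_degree_le hu.le
  set U : (ZMod p)[X] := ∑ j, r j * X ^ ((j : ℕ) * p) with hU
  set W : (ZMod p)[X] := ∑ j, s j * X ^ ((j : ℕ) * p) with hW
  set P := f ^ l * U + f ^ (l + (p - 1) / 2) * W with hPdef
  have hP' : P = f ^ l * ∑ j, (r j + g * s j) * X ^ ((j : ℕ) * p) := by
    rw [hPdef, hU, hW, pow_add, mul_assoc, ← mul_add, Finset.mul_sum, ← Finset.sum_add_distrib]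
    congr 1
    exact Finset.sum_congr rfl fun j _ ↦ by ring
  have hP : P ≠ 0 := by
    rw [hP']
    refine mul_ne_zero (pow_ne_zero _ hf) fun hzero ↦ ?_
    set B := Finset.univ.filter fun j ↦ r j ≠ 0 ∨ s j ≠ 0
    have hB : B.Nonempty := ⟨j₁, by simp [B, hj₁]⟩
    set j₀ := B.min' hB
    have hj₀ : r j₀ ≠ 0 ∨ s j₀ ≠ 0 := by simpa [B] using B.min'_mem hB
    have hlow : ∀ j < j₀, r j = 0 ∧ s j = 0 := by
      intro j hj
      by_contra hcon
      have : j ∈ B := by simp [B]; tauto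
      exact absurd (B.min'_le j this) (not_le.mpr hj)
    have hdvd : X ^ ((j₀ : ℕ) * p) * X ^ p ∣ X ^ ((j₀ : ℕ) * p) * (r j₀ + g * s j₀) := by
      rw [← Finset.add_sum_erase _ _ (Finset.mem_univ j₀)] at hzero
      rw [mul_comm _ (r j₀ + g * s j₀), eq_neg_of_add_eq_zero_left hzero, dvd_neg]
      refine Finset.dvd_sum fun j hj ↦ ?_
      rcases lt_trichotomy j j₀ with hlt | heq | hgt
      · simp [hlow j hlt]
      · exact absurd heq (Finset.ne_of_mem_erase hj)
      · refine Dvd.dvd.mul_left ?_ _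
        rw [← pow_add, ← Nat.succ_mul]
        exact pow_dvd_pow _ (Nat.mul_le_mul_right _ (by exact_mod_cast hgt))
    have := eq_zero_of_X_pow_dvd hp f0 ha hK (hnd (hr j₀)) (hnd (hs j₀))
      ((mul_dvd_mul_iff_left (pow_ne_zero _ X_ne_zero)).mp hdvd) (ZMod.pow_card _)
    tauto
  have hder : ∀ k < l, ∀ x ∈ S, (derivative^[k] P).eval x = 0 := by
    intro k hk x hx
    obtain ⟨hx0, hxe⟩ := hS x hx
    rw [hPdef, iterate_map_add, iterate_derivative_pow_mul _ _ _ _ hk.le,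
      iterate_derivative_pow_mul _ _ _ _ (by omega),
      show l + (p - 1) / 2 - k = (l - k) + (p - 1) / 2 by omega, pow_add, mul_assoc, ← mul_add,
      eval_mul]
    refine mul_eq_zero_of_right _ ?_
    have h1 := congrArg (eval x) (hrs k hk)
    rw [eval_finsetSum, eval_zero] at h1
    rw [hU, hW, map_sum, map_sum, eval_add, eval_mul, eval_pow, hxe, eval_finsetSum,
      eval_finsetSum, Finset.mul_sum, ← Finset.sum_add_distrib, ← h1]
    refine Finset.sum_congr rfl fun j _ ↦ ?_
    rw [eval_stepIter_mul_X_pow, eval_stepIter_mul_X_pow, eval_mul, eval_add, eval_pow, eval_X,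
      eval_smul, smul_eq_mul]
    ring
  refine (card_mul_le_natDegree hP hl S hder).trans ?_
  have hXdeg : ∀ (u : Fin J → (ZMod p)[X]), (∀ j, (u j).degree < K) →
      (∑ j, u j * X ^ ((j : ℕ) * p)).natDegree ≤ K + J * p := by
    intro u hu
    refine natDegree_sum_le_of_forall_le _ _ fun j _ ↦ natDegree_mul_le.trans ?_
    rw [natDegree_X_pow]
    exact add_le_add (hnd (hu j)) (Nat.mul_le_mul_right _ j.2.le)
  refine (natDegree_add_le _ _).trans (max_le ?_ ?_)
  · refine natDegree_mul_le.trans ?_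
    have h1 := natDegree_pow_le (p := f) (n := l)
    have h2 : U.natDegree ≤ K + J * p := hXdeg r hr
    have h3 : l * f.natDegree ≤ (l + (p - 1) / 2) * f.natDegree :=
      Nat.mul_le_mul_right _ (by omega)
    omega
  · refine natDegree_mul_le.trans ?_
    have h1 := natDegree_pow_le (p := f) (n := l + (p - 1) / 2)
    have h2 : W.natDegree ≤ K + J * p := hXdeg s hs
    omega

end StepanovCount

section Weil

open Polynomial

set_option maxHeartbeats 1000000 in
lemma card_quadratic_fiber_le {p : ℕ} [Fact p.Prime] (hp : p ≠ 2) {S : Finset (ZMod p)}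
    (hS : S.Nonempty) (h0 : (0 : ZMod p) ∉ S) (hlarge : 100 * ((S.card : ℝ) + 1) ≤ √p)
    (e : ZMod p) (T : Finset (ZMod p))
    (hT : ∀ x ∈ T, ∏ a ∈ S, (x - a) ≠ 0 ∧ (∏ a ∈ S, (x - a)) ^ ((p - 1) / 2) = e) :
    (T.card : ℝ) ≤ p / 2 + 6 * (S.card + 1) * √p := by
  set f : (ZMod p)[X] := ∏ a ∈ S, (X - C a) with hf
  have heval : ∀ x, f.eval x = ∏ a ∈ S, (x - a) := fun x ↦ by simp [hf, eval_prod]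
  have hdeg : f.natDegree = S.card := by simp [hf]
  obtain ⟨a, ha⟩ := hS
  have hmult : f.rootMultiplicity a = 1 := by
    rw [← count_roots, hf, roots_prod_X_sub_C]
    exact Multiset.count_eq_one_of_mem S.nodup ha
  have f0 : f.eval 0 ≠ 0 := by
    rw [heval, Finset.prod_ne_zero_iff]
    intro b hb hb0
    rw [zero_sub, neg_eq_zero] at hb0
    exact h0 (hb0 ▸ hb)
  set D := S.card with hD
  set s := √(p : ℝ) with hs
  have hss : s * s = p := Real.mul_self_sqrt (Nat.cast_nonneg _)
  have hD0 : (0 : ℝ) ≤ D := Nat.cast_nonneg _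
  have hs100 : 100 ≤ s := by linarith
  set l := Nat.sqrt p with hl
  have hl1 : (l : ℝ) ≤ s := Real.nat_sqrt_le_real_sqrt
  have hl2 : s < l + 1 := by
    have := Real.real_sqrt_lt_nat_sqrt_succ (a := p)
    exact_mod_cast this
  set K := (p - D - 1) / 2 with hK
  set J := l / 2 + 3 * D + 4 with hJ
  have hDp : (D : ℝ) + 2 ≤ p / 5000 := by nlinarith
  have hDp' : D + 2 ≤ p := by
    have : ((D + 2 : ℕ) : ℝ) ≤ p := by push_cast; linarith
    exact_mod_cast this
  have hK1 : 2 * K + D < p := by omega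
  have hK2 : (p : ℝ) ≤ 2 * K + D + 2 := by
    have : p ≤ 2 * K + D + 2 := by omega
    exact_mod_cast this
  have hK3 : 2 * (K : ℝ) ≤ p := by
    have : 2 * K ≤ p := by omega
    exact_mod_cast this
  have hJ1 : (l : ℝ) + 6 * D + 7 ≤ 2 * J := by
    have : l + 6 * D + 7 ≤ 2 * J := by omega
    exact_mod_cast this
  have hJ2 : 2 * (J : ℝ) ≤ l + 6 * D + 8 := by
    have : 2 * J ≤ l + 6 * D + 8 := by omega
    exact_mod_cast this
  have hl0 : (0 : ℝ) ≤ l := Nat.cast_nonneg _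
  have hll : (l : ℝ) * l ≤ p := by nlinarith
  have hlJ : (l : ℝ) * J ≤ 0.54 * p := by nlinarith
  have hKp : 0.49 * (p : ℝ) ≤ K := by linarith
  have hlp : l ≤ p := Nat.sqrt_le_self p
  have hcond : l * (K + l * f.natDegree + J) < 2 * (J * K) := by
    rw [hdeg]
    have h1 : (l : ℝ) * l * D ≤ p * D := mul_le_mul_of_nonneg_right hll hD0
    have h2 : (6 * (D : ℝ) + 7) * (0.49 * p) ≤ (2 * J - l) * K :=
      mul_le_mul (by linarith) hKp (by positivity) (by linarith)
    have h3 : 0 ≤ (p : ℝ) * D := by positivity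
    have : (l : ℝ) * (K + l * D + J) < 2 * (J * K) := by nlinarith
    exact_mod_cast this
  have key := stepanov_card_le hp f0 hmult e (by rwa [hdeg]) hlp hcond T
    (fun x hx ↦ by rw [heval]; exact hT x hx)
  rw [hdeg] at key
  have hhalf : (((p - 1) / 2 : ℕ) : ℝ) ≤ p / 2 := by
    refine Nat.cast_div_le.trans ?_
    have : ((p - 1 : ℕ) : ℝ) ≤ p := by exact_mod_cast Nat.sub_le _ _
    push_cast
    linarith
  have key' : (T.card : ℝ) * l ≤ (l + ((p - 1) / 2 : ℕ)) * D + K + J * p := by exact_mod_cast key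
  have hp0 : (0 : ℝ) ≤ p := Nat.cast_nonneg _
  have h1 : (T.card : ℝ) * l ≤ p / 2 * l + 5 * (D + 1) * p := by
    have e1 : (l + (((p - 1) / 2 : ℕ) : ℝ)) * D ≤ (s + p / 2) * D :=
      mul_le_mul_of_nonneg_right (add_le_add hl1 hhalf) hD0
    have e2 : 2 * (J : ℝ) * p ≤ (l + 6 * D + 8) * p := mul_le_mul_of_nonneg_right hJ2 hp0
    have e3 : s * D ≤ p * D := mul_le_mul_of_nonneg_right (by nlinarith) hD0
    have e4 : 0 ≤ (p : ℝ) * D := mul_nonneg hp0 hD0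
    linarith
  have hlpos : (0 : ℝ) < l := by linarith
  have h2 : 5 * ((D : ℝ) + 1) * p ≤ 6 * (D + 1) * s * l := by
    have hsl : s * (s - 1) ≤ s * l := mul_le_mul_of_nonneg_left (by linarith) (by linarith)
    have hs6 : 0 ≤ s * (s - 6) := mul_nonneg (by linarith) (by linarith)
    have : 5 * (p : ℝ) ≤ 6 * (s * l) := by linarith
    have := mul_le_mul_of_nonneg_left this (by linarith : 0 ≤ (D : ℝ) + 1)
    linarith
  refine le_of_mul_le_mul_right ?_ hlpos
  linarith

/-- The Weil bound for quadratic character sums of squarefree split polynomials. -/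
theorem abs_sum_quadraticChar_prod_le {p : ℕ} [Fact p.Prime] (hp : p ≠ 2) {S : Finset (ZMod p)}
    (hS : S.Nonempty) :
    |∑ x, (quadraticChar (ZMod p) (∏ a ∈ S, (x - a)) : ℝ)| ≤ 100 * (S.card + 1) * √p := by
  classical
  have hle1 : ∀ a : ZMod p, |(quadraticChar (ZMod p) a : ℝ)| ≤ 1 := by
    intro a
    by_cases ha : a = 0
    · simp [ha]
    · rcases quadraticChar_dichotomy ha with h | h <;> simp [h]
  have hss : √(p : ℝ) * √(p : ℝ) = p := Real.mul_self_sqrt (Nat.cast_nonneg _)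
  rcases lt_or_ge (√(p : ℝ)) (100 * ((S.card : ℝ) + 1)) with hsmall | hlarge
  · calc |∑ x, (quadraticChar (ZMod p) (∏ a ∈ S, (x - a)) : ℝ)|
        ≤ ∑ x : ZMod p, (1 : ℝ) :=
          (Finset.abs_sum_le_sum_abs _ _).trans (Finset.sum_le_sum fun x _ ↦ hle1 _)
      _ = √p * √p := by simp [ZMod.card]
      _ ≤ _ := mul_le_mul_of_nonneg_right hsmall.le (Real.sqrt_nonneg _)
  have hcard : S.card < Fintype.card (ZMod p) := by
    rw [ZMod.card]
    have : (S.card : ℝ) < p := by nlinarith [Nat.cast_nonneg (α := ℝ) S.card]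
    exact_mod_cast this
  obtain ⟨c, hc⟩ : ∃ c, c ∉ S := by
    by_contra! hcon
    rw [Finset.eq_univ_of_forall hcon, Finset.card_univ] at hcard
    exact lt_irrefl _ hcard
  set S' := S.image (· - c) with hS'
  have hinj : Function.Injective fun a : ZMod p ↦ a - c := sub_left_injective
  have hcard' : S'.card = S.card := Finset.card_image_of_injective _ hinj
  have hshift : ∑ x, (quadraticChar (ZMod p) (∏ a ∈ S, (x - a)) : ℝ) =
      ∑ x, (quadraticChar (ZMod p) (∏ a ∈ S', (x - a)) : ℝ) := by
    rw [← Equiv.sum_comp (Equiv.addRight c) fun x ↦ (quadraticChar (ZMod p) (∏ a ∈ S, (x - a)) : ℝ)]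
    refine Finset.sum_congr rfl fun x _ ↦ ?_
    rw [hS', Finset.prod_image fun _ _ _ _ h ↦ hinj h]
    congr 2
    refine Finset.prod_congr rfl fun a _ ↦ ?_
    simp only [Equiv.coe_addRight]
    ring
  have h0 : (0 : ZMod p) ∉ S' := by
    simp only [hS', Finset.mem_image, not_exists, not_and]
    intro a ha hac
    exact hc ((sub_eq_zero.mp hac) ▸ ha)
  have hodd : Fintype.card (ZMod p) / 2 = (p - 1) / 2 := by
    rw [ZMod.card]
    have := (Fact.out : p.Prime).eq_two_or_odd
    omega
  have hchar : ringChar (ZMod p) ≠ 2 := by rwa [ZMod.ringChar_zmod_n]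
  set P : ZMod p → ZMod p := fun x ↦ ∏ a ∈ S', (x - a) with hP
  have hbound : ∀ e : ℤ, e ≠ 0 →
      ((Finset.univ.filter fun x ↦ quadraticChar (ZMod p) (P x) = e).card : ℝ) ≤
        p / 2 + 6 * (S.card + 1) * √p := by
    intro e he
    rw [← hcard']
    refine card_quadratic_fiber_le hp (hS.image _) h0 (by rwa [hcard']) e _ fun x hx ↦ ?_
    rw [Finset.mem_filter] at hx
    refine ⟨fun hz ↦ he ?_, ?_⟩
    · have hz' : P x = 0 := hz
      rw [← hx.2, hz', MulChar.map_zero]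
    · rw [← hx.2, quadraticChar_eq_pow_of_char_ne_two' hchar, hodd]
  have hz : ((Finset.univ.filter fun x ↦ P x = 0).card : ℝ) ≤ S.card := by
    rw [← hcard']
    refine Nat.cast_le.mpr (Finset.card_le_card fun x hx ↦ ?_)
    rw [Finset.mem_filter, hP, Finset.prod_eq_zero_iff] at hx
    obtain ⟨-, a, ha, hxa⟩ := hx
    rwa [sub_eq_zero.mp hxa]
  have hpoint : ∀ x, ((quadraticChar (ZMod p) (P x) : ℤ) : ℝ) =
      (if quadraticChar (ZMod p) (P x) = 1 then 1 else 0) -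
        (if quadraticChar (ZMod p) (P x) = -1 then 1 else 0) ∧
      (1 : ℝ) = (if quadraticChar (ZMod p) (P x) = 1 then 1 else 0) +
        (if quadraticChar (ZMod p) (P x) = -1 then 1 else 0) + if P x = 0 then 1 else 0 := by
    intro x
    by_cases hx : P x = 0
    · simp [hx]
    · rcases quadraticChar_dichotomy hx with h | h <;> simp [h, hx]
  have hsum : ∑ x, (quadraticChar (ZMod p) (P x) : ℝ) =
      (Finset.univ.filter fun x ↦ quadraticChar (ZMod p) (P x) = 1).card -
        (Finset.univ.filter fun x ↦ quadraticChar (ZMod p) (P x) = -1).card := by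
    rw [Finset.sum_congr rfl fun x _ ↦ (hpoint x).1, Finset.sum_sub_distrib, Finset.sum_boole,
      Finset.sum_boole]
  have htot : (p : ℝ) = (Finset.univ.filter fun x ↦ quadraticChar (ZMod p) (P x) = 1).card +
        (Finset.univ.filter fun x ↦ quadraticChar (ZMod p) (P x) = -1).card +
        (Finset.univ.filter fun x ↦ P x = 0).card := by
    have : (p : ℝ) = ∑ x : ZMod p, (1 : ℝ) := by simp [ZMod.card]
    rw [this, Finset.sum_congr rfl fun x _ ↦ (hpoint x).2, Finset.sum_add_distrib,
      Finset.sum_add_distrib, Finset.sum_boole, Finset.sum_boole, Finset.sum_boole]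
  have h1 := hbound 1 one_ne_zero
  have h2 := hbound (-1) (by decide)
  have hS0 : (0 : ℝ) ≤ S.card := Nat.cast_nonneg _
  have h3 : (S.card : ℝ) ≤ (S.card + 1) * √p := by nlinarith
  rw [hshift, hsum, abs_le]
  constructor <;> linarith

end Weil

section CompleteSums

open NumberTheorySymbols

/-- A complete Legendre symbol sum over a product of shifts exhibits square root cancellation as
soon as some residue class occurs with odd multiplicity among the shifts. -/
lemma abs_sum_quadraticChar_shifts_le {p : ℕ} [Fact p.Prime] (hp : p ≠ 2) {n : ℕ}
    (b : Fin n → ZMod p) {c : ZMod p} (hc : Odd (Finset.univ.filter fun i ↦ b i = c).card) :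
    |∑ x, (quadraticChar (ZMod p) (∏ i, (x + b i)) : ℝ)| ≤ 200 * (n + 1) * √p := by
  classical
  set mult : ZMod p → ℕ := fun a ↦ (Finset.univ.filter fun i ↦ b i = a).card with hmult
  set R := Finset.univ.image b with hR
  set S := R.filter fun a ↦ Odd (mult a) with hS
  have hcS : c ∈ S := by
    obtain ⟨i, hi⟩ := Finset.card_pos.mp hc.pos
    rw [Finset.mem_filter] at hi
    exact Finset.mem_filter.mpr ⟨hi.2 ▸ Finset.mem_image_of_mem b (Finset.mem_univ i), hc⟩
  have hRn : R.card ≤ n := Finset.card_image_le.trans (by simp)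
  set S' := S.image fun a ↦ -a with hS'
  have hS'card : S'.card = S.card := Finset.card_image_of_injective _ neg_injective
  have hSn : S'.card ≤ n := hS'card ▸ (Finset.card_filter_le _ _).trans hRn
  have hweil := abs_sum_quadraticChar_prod_le hp (S := S') ⟨-c, Finset.mem_image_of_mem _ hcS⟩
  have hprod : ∀ x, ∏ a ∈ S', (x - a) = ∏ a ∈ S, (x + a) := fun x ↦ by
    rw [hS', Finset.prod_image fun _ _ _ _ h ↦ neg_injective h]
    simp
  have hprod' : ∀ x, ∏ i, (x + b i) = ∏ a ∈ R, (x + a) ^ mult a := fun x ↦ by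
    rw [hR, Finset.prod_comp (fun a ↦ x + a) b]
  have hle1 : ∀ a : ZMod p, |(quadraticChar (ZMod p) a : ℝ)| ≤ 1 := by
    intro a
    by_cases ha : a = 0
    · simp [ha]
    · rcases quadraticChar_dichotomy ha with h | h <;> simp [h]
  have hdiff : ∀ x, |(quadraticChar (ZMod p) (∏ i, (x + b i)) : ℝ) -
      quadraticChar (ZMod p) (∏ a ∈ S', (x - a))| ≤ if x ∈ R.image (fun a ↦ -a) then 1 else 0 := by
    intro x
    split_ifs with hx
    · obtain ⟨a, ha, rfl⟩ := Finset.mem_image.mp hx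
      obtain ⟨i, -, rfl⟩ := Finset.mem_image.mp ha
      rw [Finset.prod_eq_zero (Finset.mem_univ i) (by simp), MulChar.map_zero,
        Int.cast_zero, zero_sub, abs_neg]
      exact hle1 _
    · have hne : ∀ a ∈ R, x + a ≠ 0 := fun a ha h0 ↦
        hx (Finset.mem_image.mpr ⟨a, ha, by rw [eq_neg_of_add_eq_zero_left h0]⟩)
      rw [hprod, hprod', map_prod, map_prod, hS, Finset.prod_filter]
      refine le_of_eq ?_
      rw [abs_eq_zero, sub_eq_zero]
      congr 1
      refine Finset.prod_congr rfl fun a ha ↦ ?_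
      rw [map_pow]
      have hsq := quadraticChar_sq_one (hne a ha)
      split_ifs with hodd
      · obtain ⟨k, hk⟩ := hodd
        rw [hk, pow_succ, pow_mul, hsq, one_pow, one_mul]
      · obtain ⟨k, hk⟩ := Nat.not_odd_iff_even.mp hodd
        rw [hk, ← two_mul, pow_mul, hsq, one_pow]
  have herr : |∑ x, (quadraticChar (ZMod p) (∏ i, (x + b i)) : ℝ) -
      ∑ x, (quadraticChar (ZMod p) (∏ a ∈ S', (x - a)) : ℝ)| ≤ n := by
    rw [← Finset.sum_sub_distrib]
    refine (Finset.abs_sum_le_sum_abs _ _).trans ((Finset.sum_le_sum fun x _ ↦ hdiff x).trans ?_)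
    rw [Finset.sum_boole]
    refine Nat.cast_le.mpr (le_trans (Finset.card_le_card fun x hx ↦
      (Finset.mem_filter.mp hx).2) (Finset.card_image_le.trans hRn))
  have hp1 : 1 ≤ √(p : ℝ) := by
    rw [Real.one_le_sqrt]
    exact_mod_cast (Fact.out : p.Prime).one_lt.le
  have hSn' : (S'.card : ℝ) ≤ n := Nat.cast_le.mpr hSn
  have hn0 : (0 : ℝ) ≤ n := Nat.cast_nonneg _
  have h1 : 100 * ((S'.card : ℝ) + 1) * √p ≤ 100 * (n + 1) * √p := by gcongr
  have h2 : (n : ℝ) ≤ 100 * (n + 1) * √p := by nlinarith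
  have := abs_sub_abs_le_abs_sub (∑ x, (quadraticChar (ZMod p) (∏ i, (x + b i)) : ℝ))
    (∑ x, (quadraticChar (ZMod p) (∏ a ∈ S', (x - a)) : ℝ))
  linarith

/-- The sum of Jacobi symbols `J(∏ (x + b i) | N)` over a complete residue system modulo `N`. -/
def completeSum {n : ℕ} (b : Fin n → ℤ) (N : ℕ) : ℤ :=
  ∑ x ∈ Finset.range N, J(∏ i, ((x : ℤ) + b i) | N)

lemma jacobiSym_abs_le_one (a : ℤ) (N : ℕ) : |J(a | N)| ≤ 1 := by
  rcases jacobiSym.trichotomy a N with h | h | h <;> simp [h]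

lemma jacobiSym_congr {a b : ℤ} {N : ℕ} (h : a ≡ b [ZMOD N]) : J(a | N) = J(b | N) := by
  rw [jacobiSym.mod_left a, jacobiSym.mod_left b, h]

lemma prod_add_congr {n : ℕ} (b : Fin n → ℤ) {x y : ℤ} {N : ℤ} (h : x ≡ y [ZMOD N]) :
    ∏ i, (x + b i) ≡ ∏ i, (y + b i) [ZMOD N] := by
  induction n with
  | zero => simp
  | succ n ih => rw [Fin.prod_univ_succ, Fin.prod_univ_succ]; exact (h.add_right _).mul (ih _)

/-- A sum over residues modulo a product of coprime moduli factors. -/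
lemma sum_range_mul_of_coprime {R : Type*} [CommSemiring R] {a b : ℕ} (hab : a.Coprime b)
    (ha : a ≠ 0) (hb : b ≠ 0) {f g : ℕ → R} (hf : ∀ x, f (x % a) = f x)
    (hg : ∀ x, g (x % b) = g x) :
    ∑ x ∈ Finset.range (a * b), f x * g x =
      (∑ x ∈ Finset.range a, f x) * ∑ y ∈ Finset.range b, g y := by
  rw [Finset.sum_mul_sum, ← Finset.sum_product']
  refine Finset.sum_bij (fun x _ ↦ (x % a, x % b)) ?_ ?_ ?_ ?_
  · intro x _
    simp [Nat.mod_lt _ (Nat.pos_of_ne_zero ha), Nat.mod_lt _ (Nat.pos_of_ne_zero hb)]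
  · intro x hx y hy hxy
    simp only [Prod.mk.injEq] at hxy
    have := (Nat.modEq_and_modEq_iff_modEq_mul hab).mp hxy
    exact Nat.ModEq.eq_of_lt_of_lt this (Finset.mem_range.mp hx) (Finset.mem_range.mp hy)
  · rintro ⟨u, v⟩ huv
    simp only [Finset.mem_product, Finset.mem_range] at huv
    refine ⟨Nat.chineseRemainder hab u v, Finset.mem_range.mpr
      (Nat.chineseRemainder_lt_mul hab u v ha hb), ?_⟩
    obtain ⟨h1, h2⟩ := (Nat.chineseRemainder hab u v).2
    simp only [Prod.mk.injEq]
    exact ⟨Eq.trans h1 (Nat.mod_eq_of_lt huv.1), Eq.trans h2 (Nat.mod_eq_of_lt huv.2)⟩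
  · intro x _
    rw [hf, hg]

lemma completeSum_mul {n : ℕ} (b : Fin n → ℤ) {M N : ℕ} (h : M.Coprime N) (hM : M ≠ 0)
    (hN : N ≠ 0) : completeSum b (M * N) = completeSum b M * completeSum b N := by
  have : NeZero M := ⟨hM⟩
  have : NeZero N := ⟨hN⟩
  rw [completeSum, completeSum, completeSum, ← sum_range_mul_of_coprime h hM hN]
  · exact Finset.sum_congr rfl fun x _ ↦ jacobiSym.mul_right _ _ _
  all_goals
    intro x
    refine jacobiSym_congr (prod_add_congr b ?_)
    push_cast
    exact Int.mod_modEq _ _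

lemma completeSum_prime {n : ℕ} (b : Fin n → ℤ) {p : ℕ} [Fact p.Prime] :
    completeSum b p = ∑ x, quadraticChar (ZMod p) (∏ i, (x + (b i : ZMod p))) := by
  rw [completeSum]
  refine Finset.sum_bij (fun x _ ↦ (x : ZMod p)) (fun _ _ ↦ Finset.mem_univ _) ?_ ?_ ?_
  · intro x hx y hy hxy
    exact Nat.ModEq.eq_of_lt_of_lt ((ZMod.natCast_eq_natCast_iff _ _ _).mp hxy)
      (Finset.mem_range.mp hx) (Finset.mem_range.mp hy)
  · intro y _
    exact ⟨y.val, Finset.mem_range.mpr (ZMod.val_lt y), ZMod.natCast_zmod_val y⟩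
  · intro x _
    rw [← jacobiSym.legendreSym.to_jacobiSym, legendreSym]
    push_cast
    rfl

lemma abs_completeSum_le {n : ℕ} (b : Fin n → ℤ) (N : ℕ) : |completeSum b N| ≤ N := by
  refine (Finset.abs_sum_le_sum_abs _ _).trans
    ((Finset.sum_le_sum fun x _ ↦ jacobiSym_abs_le_one _ _).trans ?_)
  simp

end CompleteSums

section CompleteSums

open NumberTheorySymbols

lemma completeSum_prod_primes {n : ℕ} (b : Fin n → ℤ) (s : Finset ℕ) (hs : ∀ p ∈ s, p.Prime) :
    completeSum b (∏ p ∈ s, p) = ∏ p ∈ s, completeSum b p := by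
  induction s using Finset.induction_on with
  | empty => simp [completeSum]
  | insert p s hp ih =>
    have hs' := fun q hq ↦ hs q (Finset.mem_insert_of_mem hq)
    rw [Finset.prod_insert hp, Finset.prod_insert hp, completeSum_mul b, ih hs']
    · refine Nat.Coprime.prod_right fun q hq ↦ ?_
      refine (Nat.coprime_primes (hs p (Finset.mem_insert_self _ _)) (hs' q hq)).mpr ?_
      rintro rfl
      exact hp hq
    · exact (hs p (Finset.mem_insert_self _ _)).ne_zero
    · exact Finset.prod_ne_zero_iff.mpr fun q hq ↦ (hs' q hq).ne_zero

/-- The greatest common divisor with `N`, renormalized to `1` at zero. -/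
def gcdOrOne (N : ℕ) (t : ℤ) : ℕ := if t = 0 then 1 else Int.gcd N t

lemma gcdOrOne_pos {N : ℕ} (hN : N ≠ 0) (t : ℤ) : 0 < gcdOrOne N t := by
  rw [gcdOrOne]
  split_ifs
  · exact one_pos
  · exact Int.gcd_pos_of_ne_zero_left _ (by exact_mod_cast hN)

lemma abs_completeSum_le_prod_gcdOrOne {N : ℕ} (hN : Squarefree N) (hodd : Odd N) {n : ℕ}
    (b : Fin n → ℤ) {i : Fin n} (hi : Odd (Finset.univ.filter fun j ↦ b j = b i).card) :
    (|completeSum b N| : ℝ) ≤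
      (200 * (n + 1)) ^ N.primeFactors.card * √N * ∏ j, (gcdOrOne N (b j - b i) : ℝ) := by
  classical
  have hN0 : N ≠ 0 := hN.ne_zero
  set P := N.primeFactors with hP
  have hNP : ∏ p ∈ P, p = N := Nat.prod_primeFactors_of_squarefree hN
  set bad := P.filter fun p : ℕ ↦ Even (Finset.univ.filter fun j ↦ ((p : ℤ) ∣ b j - b i)).card
    with hbad
  have hlocal : ∀ p ∈ P, (|completeSum b p| : ℝ) ≤
      (200 * (n + 1) * √p) * if p ∈ bad then (p : ℝ) else 1 := by
    intro p hp
    have hpp := Nat.prime_of_mem_primeFactors hp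
    have : Fact p.Prime := ⟨hpp⟩
    have hp1 : (1 : ℝ) ≤ √p := by
      rw [Real.one_le_sqrt]
      exact_mod_cast hpp.one_lt.le
    split_ifs with hpb
    · have h1 : (|completeSum b p| : ℝ) ≤ p := by exact_mod_cast abs_completeSum_le b p
      have h2 : (1 : ℝ) ≤ 200 * (n + 1) * √p := by nlinarith [Nat.cast_nonneg (α := ℝ) n]
      have h3 : (0 : ℝ) ≤ p := Nat.cast_nonneg _
      nlinarith
    · rw [mul_one, completeSum_prime]
      have hp2 : p ≠ 2 := by
        rintro rfl
        have h2 := Nat.dvd_of_mem_primeFactors hp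
        obtain ⟨k, hk⟩ := hodd
        omega
      have hodd' : Odd (Finset.univ.filter fun j ↦ (b j : ZMod p) = (b i : ZMod p)).card := by
        rw [← Nat.not_even_iff_odd]
        intro hev
        refine hpb (Finset.mem_filter.mpr ⟨hp, ?_⟩)
        convert hev using 5 with j
        rw [← ZMod.intCast_zmod_eq_zero_iff_dvd, Int.cast_sub, sub_eq_zero]
      exact_mod_cast abs_sum_quadraticChar_shifts_le hp2 (fun j ↦ (b j : ZMod p)) hodd'
  have hsqrt : ∏ p ∈ P, √(p : ℝ) = √N := by
    rw [← Real.sqrt_prod _ fun p _ ↦ Nat.cast_nonneg p]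
    rw [← Nat.cast_prod, hNP]
  have hdvd : ∏ p ∈ bad, p ∣ ∏ j, gcdOrOne N (b j - b i) := by
    refine Finset.prod_primes_dvd _ (fun p hp ↦ ?_) fun p hp ↦ ?_
    · exact (Nat.prime_of_mem_primeFactors (Finset.mem_filter.mp hp).1).prime
    · obtain ⟨hpP, hev⟩ := Finset.mem_filter.mp hp
      obtain ⟨j, hj1, hj2⟩ : ∃ j, (p : ℤ) ∣ b j - b i ∧ b j ≠ b i := by
        by_contra! hcon
        refine Nat.not_even_iff_odd.mpr hi ?_
        convert hev using 5 with j
        exact ⟨fun h ↦ by simp [h], fun h ↦ hcon j h⟩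
      refine dvd_trans ?_ (Finset.dvd_prod_of_mem _ (Finset.mem_univ j))
      rw [gcdOrOne, if_neg (sub_ne_zero.mpr hj2)]
      exact Int.dvd_gcd (by exact_mod_cast Nat.dvd_of_mem_primeFactors hpP) hj1
  have hle : ∏ p ∈ bad, p ≤ ∏ j, gcdOrOne N (b j - b i) :=
    Nat.le_of_dvd (Finset.prod_pos fun j _ ↦ gcdOrOne_pos hN0 _) hdvd
  calc (|completeSum b N| : ℝ) = ∏ p ∈ P, (|completeSum b p| : ℝ) := by
        conv_lhs => rw [← hNP]
        rw [completeSum_prod_primes b P fun p ↦ Nat.prime_of_mem_primeFactors,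
          Int.cast_prod, Finset.abs_prod]
    _ ≤ ∏ p ∈ P, ((200 * (n + 1) * √p) * if p ∈ bad then (p : ℝ) else 1) :=
        Finset.prod_le_prod (fun _ _ ↦ abs_nonneg _) hlocal
    _ = (200 * (n + 1)) ^ P.card * √N * ∏ p ∈ bad, (p : ℝ) := by
        rw [Finset.prod_mul_distrib, Finset.prod_mul_distrib, Finset.prod_const, hsqrt, hbad,
          Finset.prod_filter]
        congr 1
        refine Finset.prod_congr rfl fun p hp ↦ ?_
        simp [hp]
    _ ≤ _ := by
        refine mul_le_mul_of_nonneg_left ?_ (by positivity)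
        rw [← Nat.cast_prod, ← Nat.cast_prod]
        exact Nat.cast_le.mpr hle

lemma sum_gcd_le (N H : ℕ) (hN : N ≠ 0) :
    ∑ t ∈ Finset.Icc 1 H, N.gcd t ≤ H * N.divisors.card := by
  calc ∑ t ∈ Finset.Icc 1 H, N.gcd t
      ≤ ∑ t ∈ Finset.Icc 1 H, ∑ d ∈ N.divisors, if d ∣ t then d else 0 := by
        refine Finset.sum_le_sum fun t _ ↦ ?_
        refine le_trans (le_of_eq ?_) (Finset.single_le_sum (f := fun d ↦ if d ∣ t then d else 0)
          (fun _ _ ↦ Nat.zero_le _) (Nat.mem_divisors.mpr ⟨Nat.gcd_dvd_left N t, hN⟩))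
        rw [if_pos (Nat.gcd_dvd_right N t)]
    _ = ∑ d ∈ N.divisors, d * (H / d) := by
        rw [Finset.sum_comm]
        refine Finset.sum_congr rfl fun d _ ↦ ?_
        rw [← Finset.sum_filter, Finset.sum_const, smul_eq_mul, mul_comm]
        congr 1
        rw [← Nat.Ioc_filter_dvd_card_eq_div]
        rfl
    _ ≤ ∑ d ∈ N.divisors, H := Finset.sum_le_sum fun d _ ↦ Nat.mul_div_le H d
    _ = _ := by rw [Finset.sum_const, smul_eq_mul, mul_comm]

lemma sum_gcdOrOne_le {N H : ℕ} (hN : N ≠ 0) {c : ℕ} (hc : c ∈ Finset.Icc 1 H) :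
    ∑ h ∈ Finset.Icc 1 H, gcdOrOne N ((h : ℤ) - c) ≤ 3 * H * N.divisors.card := by
  rw [Finset.mem_Icc] at hc
  have hdis : ∀ h ∈ Finset.Icc 1 H, gcdOrOne N ((h : ℤ) - c) ≤
      (if h = c then 1 else 0) + (if h < c then N.gcd (c - h) else 0) +
        if c < h then N.gcd (h - c) else 0 := by
    intro h _
    rcases lt_trichotomy h c with hh | hh | hh
    · rw [gcdOrOne, if_neg (by omega), if_neg hh.ne, if_pos hh, if_neg (by omega), Int.gcd]
      rw [show ((h : ℤ) - c).natAbs = c - h by omega]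
      simp
    · simp [gcdOrOne, hh]
    · rw [gcdOrOne, if_neg (by omega), if_neg hh.ne', if_neg (by omega), if_pos hh, Int.gcd]
      rw [show ((h : ℤ) - c).natAbs = h - c by omega]
      simp
  have h1 : ∑ h ∈ Finset.Icc 1 H, (if h < c then N.gcd (c - h) else 0) ≤
      ∑ t ∈ Finset.Icc 1 H, N.gcd t := by
    rw [← Finset.sum_filter, ← Finset.sum_image (f := fun t ↦ N.gcd t) (g := fun h ↦ c - h)]
    · refine Finset.sum_le_sum_of_subset fun t ht ↦ ?_
      simp only [Finset.mem_image, Finset.mem_filter, Finset.mem_Icc] at ht ⊢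
      omega
    · intro x hx y hy
      simp only [Finset.coe_filter, Set.mem_ofPred_eq] at hx hy
      dsimp only
      omega
  have h2 : ∑ h ∈ Finset.Icc 1 H, (if c < h then N.gcd (h - c) else 0) ≤
      ∑ t ∈ Finset.Icc 1 H, N.gcd t := by
    rw [← Finset.sum_filter, ← Finset.sum_image (f := fun t ↦ N.gcd t) (g := fun h ↦ h - c)]
    · refine Finset.sum_le_sum_of_subset fun t ht ↦ ?_
      simp only [Finset.mem_image, Finset.mem_filter, Finset.mem_Icc] at ht ⊢
      omega
    · intro x hx y hy
      simp only [Finset.coe_filter, Set.mem_ofPred_eq] at hx hy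
      dsimp only
      omega
  have h3 := sum_gcd_le N H hN
  have h4 : 1 ≤ N.divisors.card := Finset.card_pos.mpr ⟨1, Nat.one_mem_divisors.mpr hN⟩
  have h5 : 1 ≤ H * N.divisors.card := Nat.mul_pos (by omega) h4
  refine (Finset.sum_le_sum hdis).trans ?_
  rw [Finset.sum_add_distrib, Finset.sum_add_distrib, Finset.sum_ite_eq', if_pos (by simp; omega)]
  linarith

end CompleteSums

section Moments

open NumberTheorySymbols

lemma jacobiSym_prod_left {ι : Type*} (s : Finset ι) (a : ι → ℤ) (N : ℕ) :
    J(∏ i ∈ s, a i | N) = ∏ i ∈ s, J(a i | N) := by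
  classical
  induction s using Finset.induction_on with
  | empty => simp
  | insert i s hi ih => rw [Finset.prod_insert hi, Finset.prod_insert hi, jacobiSym.mul_left, ih]

lemma sum_pow_eq_sum_completeSum (N H n : ℕ) :
    ∑ x ∈ Finset.range N, (∑ h ∈ Finset.Icc 1 H, J((x : ℤ) + (h : ℕ) | N)) ^ n =
      ∑ b ∈ Fintype.piFinset fun _ : Fin n ↦ Finset.Icc 1 H, completeSum (fun i ↦ (b i : ℤ)) N := by
  simp only [completeSum]
  rw [Finset.sum_comm]
  refine Finset.sum_congr rfl fun x _ ↦ ?_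
  have := Finset.prod_univ_sum (fun _ : Fin n ↦ Finset.Icc 1 H)
    (fun _ h ↦ J((x : ℤ) + (h : ℕ) | N))
  rw [Finset.prod_const, Finset.card_univ, Fintype.card_fin] at this
  rw [this]
  exact Finset.sum_congr rfl fun b _ ↦ (jacobiSym_prod_left _ _ _).symm

/-- Tuples of length `2 r` all of whose values occur with even multiplicity are rare. -/
lemma card_even_tuples_le (s : Finset ℕ) {r : ℕ} (hr : 0 < r) :
    ((Fintype.piFinset fun _ : Fin (2 * r) ↦ s).filter fun b ↦
      ∀ i, Even (Finset.univ.filter fun j ↦ b j = b i).card).card ≤ r ^ (2 * r) * s.card ^ r := by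
  classical
  have hcard : r ^ (2 * r) * s.card ^ r =
      ((Finset.univ : Finset (Fin (2 * r) → Fin r)) ×ˢ
        (Fintype.piFinset fun _ : Fin r ↦ s)).card := by
    simp [Finset.card_product, Fintype.card_piFinset]
  rw [hcard]
  refine le_trans (Finset.card_le_card fun b hb ↦ ?_)
    (Finset.card_image_le (f := fun fg : (Fin (2 * r) → Fin r) × (Fin r → ℕ) ↦ fg.2 ∘ fg.1))
  obtain ⟨hb1, hb2⟩ := Finset.mem_filter.mp hb
  rw [Fintype.mem_piFinset] at hb1
  set V := Finset.univ.image b with hV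
  have hVr : V.card ≤ r := by
    have h1 : ∑ v ∈ V, 2 ≤ ∑ v ∈ V, (Finset.univ.filter fun j ↦ b j = v).card := by
      refine Finset.sum_le_sum fun v hv ↦ ?_
      obtain ⟨i, -, rfl⟩ := Finset.mem_image.mp hv
      have hpos : 0 < (Finset.univ.filter fun j ↦ b j = b i).card :=
        Finset.card_pos.mpr ⟨i, by simp⟩
      obtain ⟨k, hk⟩ := hb2 i
      omega
    rw [← Finset.card_eq_sum_card_image, Finset.card_univ, Fintype.card_fin, Finset.sum_const,
      smul_eq_mul] at h1
    omega
  have hmem : ∀ i, b i ∈ V := fun i ↦ Finset.mem_image_of_mem b (Finset.mem_univ i)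
  let i₀ : Fin (2 * r) := ⟨0, by omega⟩
  refine Finset.mem_image.mpr ⟨(fun i ↦ Fin.castLE hVr (V.equivFin ⟨b i, hmem i⟩),
    fun k ↦ if h : (k : ℕ) < V.card then (V.equivFin.symm ⟨k, h⟩ : ℕ) else b i₀), ?_, ?_⟩
  · rw [Finset.mem_product]
    refine ⟨Finset.mem_univ _, Fintype.mem_piFinset.mpr fun k ↦ ?_⟩
    dsimp only
    split_ifs with h
    · obtain ⟨i, -, hi⟩ := Finset.mem_image.mp (V.equivFin.symm ⟨k, h⟩).2
      rw [← hi]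
      exact hb1 i
    · exact hb1 i₀
  · ext i
    simp

theorem sum_jacobiSym_pow_le {N : ℕ} (hN : Squarefree N) (hodd : Odd N) (H : ℕ) {r : ℕ}
    (hr : 0 < r) :
    ∑ x ∈ Finset.range N, (∑ h ∈ Finset.Icc 1 H, (J((x : ℤ) + (h : ℕ) | N) : ℝ)) ^ (2 * r) ≤
      r ^ (2 * r) * H ^ r * N + (200 * (2 * r + 1)) ^ N.primeFactors.card * √N *
        (H * (3 * H * N.divisors.card) ^ (2 * r)) := by
  classical
  have hN0 : N ≠ 0 := hN.ne_zero
  set T := Fintype.piFinset fun _ : Fin (2 * r) ↦ Finset.Icc 1 H with hT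
  set E : (Fin (2 * r) → ℕ) → Prop := fun b ↦
    ∀ i, Even (Finset.univ.filter fun j ↦ b j = b i).card with hE
  set A : ℝ := (200 * (2 * r + 1)) ^ N.primeFactors.card * √N with hA
  have hA0 : 0 ≤ A := by positivity
  have hsum : ∑ x ∈ Finset.range N,
      (∑ h ∈ Finset.Icc 1 H, (J((x : ℤ) + (h : ℕ) | N) : ℝ)) ^ (2 * r) =
      ∑ b ∈ T, (completeSum (fun i ↦ (b i : ℤ)) N : ℝ) := by
    exact_mod_cast sum_pow_eq_sum_completeSum N H (2 * r)
  rw [hsum, ← Finset.sum_filter_add_sum_filter_not T E]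
  refine add_le_add ?_ ?_
  · calc ∑ b ∈ T.filter E, (completeSum (fun i ↦ (b i : ℤ)) N : ℝ)
        ≤ ∑ b ∈ T.filter E, (N : ℝ) := Finset.sum_le_sum fun b _ ↦ by
          exact_mod_cast (le_abs_self _).trans (abs_completeSum_le _ N)
      _ = (T.filter E).card * (N : ℝ) := by rw [Finset.sum_const, nsmul_eq_mul]
      _ ≤ _ := by
        refine mul_le_mul_of_nonneg_right ?_ (Nat.cast_nonneg _)
        have := card_even_tuples_le (Finset.Icc 1 H) hr
        rw [Nat.card_Icc, Nat.add_sub_cancel] at this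
        exact_mod_cast this
  · calc ∑ b ∈ T.filter (¬E ·), (completeSum (fun i ↦ (b i : ℤ)) N : ℝ)
        ≤ ∑ b ∈ T.filter (¬E ·), A * ∑ c ∈ Finset.Icc 1 H,
            ∏ j, (gcdOrOne N ((b j : ℤ) - c) : ℝ) := by
          refine Finset.sum_le_sum fun b hb ↦ ?_
          obtain ⟨hbT, hbE⟩ := Finset.mem_filter.mp hb
          rw [hE] at hbE
          push Not at hbE
          obtain ⟨i, hi⟩ := hbE
          have h1 := abs_completeSum_le_prod_gcdOrOne hN hodd (fun j ↦ (b j : ℤ)) (i := i)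
            (by simpa using hi)
          refine ((le_abs_self _).trans h1).trans ?_
          rw [hA]
          push_cast
          refine mul_le_mul_of_nonneg_left ?_ (by positivity)
          exact Finset.single_le_sum (f := fun c : ℕ ↦ ∏ j, (gcdOrOne N ((b j : ℤ) - c) : ℝ))
            (fun _ _ ↦ by positivity) (Fintype.mem_piFinset.mp hbT i)
      _ ≤ ∑ b ∈ T, A * ∑ c ∈ Finset.Icc 1 H, ∏ j, (gcdOrOne N ((b j : ℤ) - c) : ℝ) :=
          Finset.sum_le_sum_of_subset_of_nonneg (Finset.filter_subset _ _)
            fun _ _ _ ↦ by positivity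
      _ = A * ∑ c ∈ Finset.Icc 1 H,
            (∑ h ∈ Finset.Icc 1 H, (gcdOrOne N ((h : ℤ) - c) : ℝ)) ^ (2 * r) := by
          rw [← Finset.mul_sum, Finset.sum_comm]
          congr 1
          refine Finset.sum_congr rfl fun c _ ↦ ?_
          have := Finset.prod_univ_sum (fun _ : Fin (2 * r) ↦ Finset.Icc 1 H)
            (fun _ h ↦ (gcdOrOne N ((h : ℤ) - c) : ℝ))
          rw [Finset.prod_const, Finset.card_univ, Fintype.card_fin] at this
          rw [this]
      _ ≤ A * ∑ c ∈ Finset.Icc 1 H, (3 * H * N.divisors.card : ℝ) ^ (2 * r) := by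
          refine mul_le_mul_of_nonneg_left (Finset.sum_le_sum fun c hc ↦ ?_) hA0
          refine pow_le_pow_left₀ (Finset.sum_nonneg fun _ _ ↦ Nat.cast_nonneg _) ?_ _
          exact_mod_cast sum_gcdOrOne_le hN0 hc
      _ = _ := by
          rw [Finset.sum_const, nsmul_eq_mul, Nat.card_Icc, Nat.add_sub_cancel]

/-- `A ^ ω(N)` grows slower than any power of `N`. -/
lemma exists_pow_card_primeFactors_le (A : ℝ) (hA : 1 ≤ A) {ε : ℝ} (hε : 0 < ε) :
    ∃ C : ℝ, 1 ≤ C ∧ ∀ N : ℕ, N ≠ 0 → A ^ N.primeFactors.card ≤ C * (N : ℝ) ^ ε := by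
  set B := ⌈A ^ ε⁻¹⌉₊ with hB
  refine ⟨A ^ B, one_le_pow₀ hA, fun N hN ↦ ?_⟩
  have hA0 : 0 ≤ A := by linarith
  have hsplit : A ^ N.primeFactors.card ≤
      ∏ p ∈ N.primeFactors, ((if p < B then A else 1) * (p : ℝ) ^ ε) := by
    rw [← Finset.prod_const]
    refine Finset.prod_le_prod (fun _ _ ↦ hA0) fun p hp ↦ ?_
    have hp1 : (1 : ℝ) ≤ p := by exact_mod_cast (Nat.prime_of_mem_primeFactors hp).one_lt.le
    split_ifs with h
    · exact le_mul_of_one_le_right hA0 (Real.one_le_rpow hp1 hε.le)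
    · have h1 : A ^ ε⁻¹ ≤ p := (Nat.le_ceil _).trans (Nat.cast_le.mpr (not_lt.mp h))
      have h2 := Real.rpow_le_rpow (Real.rpow_nonneg hA0 _) h1 hε.le
      rwa [← Real.rpow_mul hA0, inv_mul_cancel₀ hε.ne', Real.rpow_one, ← one_mul (_ ^ _)] at h2
  refine hsplit.trans ?_
  rw [Finset.prod_mul_distrib]
  refine mul_le_mul ?_ ?_ (Finset.prod_nonneg fun _ _ ↦ by positivity) (by positivity)
  · rw [← Finset.prod_filter, Finset.prod_const]
    refine pow_le_pow_right₀ hA ?_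
    calc (N.primeFactors.filter (· < B)).card ≤ (Finset.range B).card :=
          Finset.card_le_card fun p hp ↦ Finset.mem_range.mpr (Finset.mem_filter.mp hp).2
      _ = B := Finset.card_range B
  · rw [Real.finsetProd_rpow _ _ fun _ _ ↦ Nat.cast_nonneg _, ← Nat.cast_prod]
    exact Real.rpow_le_rpow (Nat.cast_nonneg _) (Nat.cast_le.mpr
      (Nat.le_of_dvd (Nat.pos_of_ne_zero hN) (Nat.prod_primeFactors_dvd N))) hε.le

lemma card_divisors_le_of_squarefree {N : ℕ} (hN : Squarefree N) :
    N.divisors.card ≤ 2 ^ N.primeFactors.card := by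
  rw [Nat.card_divisors hN.ne_zero, ← Finset.prod_const]
  exact Finset.prod_le_prod' fun p _ ↦ Nat.succ_le_succ (hN.natFactorization_le_one p)

theorem exists_sum_jacobiSym_pow_le {r : ℕ} (hr : 0 < r) {δ : ℝ} (hδ : 0 < δ) :
    ∃ C : ℝ, 1 ≤ C ∧ ∀ N H : ℕ, Squarefree N → Odd N →
      ∑ x ∈ Finset.range N, (∑ h ∈ Finset.Icc 1 H, (J((x : ℤ) + (h : ℕ) | N) : ℝ)) ^ (2 * r) ≤
        C * ((N : ℝ) * H ^ r + (N : ℝ) ^ (1 / 2 + δ) * H ^ (2 * r + 1)) := by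
  obtain ⟨C, hC1, hC⟩ := exists_pow_card_primeFactors_le
    ((200 * (2 * r + 1)) * 2 ^ (2 * r)) (by
      have : (1 : ℝ) ≤ 2 ^ (2 * r) := one_le_pow₀ (by norm_num)
      have hr0 : (0 : ℝ) ≤ r := Nat.cast_nonneg _
      nlinarith) hδ
  refine ⟨(r : ℝ) ^ (2 * r) + C * 3 ^ (2 * r), ?_, fun N H hN hodd ↦ ?_⟩
  · have h1 : (1 : ℝ) ≤ 3 ^ (2 * r) := one_le_pow₀ (by norm_num)
    have h2 : (0 : ℝ) ≤ (r : ℝ) ^ (2 * r) := by positivity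
    nlinarith
  have hN0 := hN.ne_zero
  have hNpos : (0 : ℝ) < N := by exact_mod_cast Nat.pos_of_ne_zero hN0
  refine (sum_jacobiSym_pow_le hN hodd H hr).trans ?_
  set ω := N.primeFactors.card with hω
  have hdiv : (N.divisors.card : ℝ) ≤ 2 ^ ω := by exact_mod_cast card_divisors_le_of_squarefree hN
  have hmain : (200 * (2 * (r : ℝ) + 1)) ^ ω * (N.divisors.card : ℝ) ^ (2 * r) ≤ C * N ^ δ := by
    refine le_trans ?_ (hC N hN0)
    rw [← hω, mul_pow (200 * (2 * (r : ℝ) + 1))]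
    refine mul_le_mul_of_nonneg_left ?_ (by positivity)
    exact (pow_le_pow_left₀ (Nat.cast_nonneg _) hdiv (2 * r)).trans_eq
      (by rw [← pow_mul, ← pow_mul, mul_comm])
  have hrp : (N : ℝ) ^ (1 / 2 + δ) = √N * N ^ δ := by
    rw [Real.rpow_add hNpos, Real.sqrt_eq_rpow]
  have e1 : (200 * (2 * (r : ℝ) + 1)) ^ ω * √N * (H * (3 * H * N.divisors.card) ^ (2 * r)) =
      ((200 * (2 * (r : ℝ) + 1)) ^ ω * (N.divisors.card : ℝ) ^ (2 * r)) *
        (√N * (3 ^ (2 * r) * H ^ (2 * r + 1))) := by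
    ring
  have e2 : (200 * (2 * (r : ℝ) + 1)) ^ ω * √N * (H * (3 * H * N.divisors.card) ^ (2 * r)) ≤
      (C * 3 ^ (2 * r)) * ((N : ℝ) ^ (1 / 2 + δ) * H ^ (2 * r + 1)) := by
    rw [e1, hrp]
    refine (mul_le_mul_of_nonneg_right hmain (by positivity)).trans (le_of_eq ?_)
    ring
  have e3 : 0 ≤ C * 3 ^ (2 * r) * ((N : ℝ) * H ^ r) := by positivity
  have e4 : 0 ≤ (r : ℝ) ^ (2 * r) * ((N : ℝ) ^ (1 / 2 + δ) * H ^ (2 * r + 1)) := by positivity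
  have e5 : (r : ℝ) ^ (2 * r) * H ^ r * N = (r : ℝ) ^ (2 * r) * (N * H ^ r) := by ring
  rw [e5]
  linarith

end Moments

section Shifting

/-- Hölder's inequality for a sum over the fibres of a map. -/
lemma sum_comp_pow_le {ι : Type*} (I : Finset ι) (g : ι → ℕ) {N : ℕ} (hg : ∀ i ∈ I, g i < N)
    (T : ℕ → ℝ) (hT : ∀ x, 0 ≤ T x) {r : ℕ} (hr : 0 < r) :
    (∑ i ∈ I, T (g i)) ^ (2 * r) ≤ (I.card : ℝ) ^ (2 * r - 2) *
      ((I ×ˢ I).filter fun ij ↦ g ij.1 = g ij.2).card * ∑ x ∈ Finset.range N, T x ^ (2 * r) := by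
  classical
  obtain ⟨k, rfl⟩ := Nat.exists_eq_add_of_lt hr
  rw [zero_add]
  rcases I.eq_empty_or_nonempty with rfl | hI
  · simp
  have hIc : (0 : ℝ) < (I.card : ℝ) ^ k := pow_pos (Nat.cast_pos.mpr hI.card_pos) _
  have h1 : (∑ i ∈ I, T (g i)) ^ (k + 1) ≤ (I.card : ℝ) ^ k * ∑ i ∈ I, T (g i) ^ (k + 1) := by
    have := pow_sum_div_card_le_sum_pow (s := I) (f := fun i ↦ T (g i)) (fun i _ ↦ hT _) k
    rwa [div_le_iff₀ hIc, mul_comm] at this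
  set ν : ℕ → ℕ := fun x ↦ (I.filter fun i ↦ g i = x).card with hν
  have h2 : ∑ i ∈ I, T (g i) ^ (k + 1) = ∑ x ∈ Finset.range N, (ν x : ℝ) * T x ^ (k + 1) := by
    rw [← Finset.sum_fiberwise_of_maps_to (t := Finset.range N) (g := g)
      fun i hi ↦ Finset.mem_range.mpr (hg i hi)]
    refine Finset.sum_congr rfl fun x _ ↦ ?_
    rw [Finset.sum_congr rfl fun i hi ↦ by rw [(Finset.mem_filter.mp hi).2], Finset.sum_const,
      nsmul_eq_mul]
  have h3 : ∑ x ∈ Finset.range N, (ν x : ℝ) ^ 2 =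
      ((I ×ˢ I).filter fun ij ↦ g ij.1 = g ij.2).card := by
    rw [Finset.card_filter, Finset.sum_product]
    push_cast
    rw [← Finset.sum_fiberwise_of_maps_to (t := Finset.range N) (g := g)
      fun i hi ↦ Finset.mem_range.mpr (hg i hi)]
    refine Finset.sum_congr rfl fun x _ ↦ ?_
    rw [Finset.sum_congr rfl fun i hi ↦ by
      rw [(Finset.mem_filter.mp hi).2, Finset.sum_boole], Finset.sum_const, nsmul_eq_mul, sq]
    simp only [hν, eq_comm]
  have h4 := Finset.sum_mul_sq_le_sq_mul_sq (Finset.range N) (fun x ↦ (ν x : ℝ))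
    (fun x ↦ T x ^ (k + 1))
  rw [h3] at h4
  have h5 : ∀ x, (T x ^ (k + 1)) ^ 2 = T x ^ (2 * (k + 1)) := fun x ↦ by rw [← pow_mul, mul_comm]
  simp only [h5] at h4
  have hS0 : 0 ≤ ∑ i ∈ I, T (g i) := Finset.sum_nonneg fun i _ ↦ hT _
  calc (∑ i ∈ I, T (g i)) ^ (2 * (k + 1)) = ((∑ i ∈ I, T (g i)) ^ (k + 1)) ^ 2 := by
        rw [← pow_mul, mul_comm]
    _ ≤ ((I.card : ℝ) ^ k * ∑ i ∈ I, T (g i) ^ (k + 1)) ^ 2 :=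
        pow_le_pow_left₀ (pow_nonneg hS0 _) h1 2
    _ = (I.card : ℝ) ^ (2 * (k + 1) - 2) *
          (∑ x ∈ Finset.range N, (ν x : ℝ) * T x ^ (k + 1)) ^ 2 := by
        rw [mul_pow, h2, ← pow_mul, show 2 * (k + 1) - 2 = k * 2 by omega]
    _ ≤ _ := by
        rw [mul_assoc]
        exact mul_le_mul_of_nonneg_left h4 (by positivity)

/-- Pairs of shifts solving a two term linear congruence are few. -/
lemma card_linear_congruence_le {N A B a₁ a₂ : ℕ} (M : ℤ) (hAB : 2 * (A * B) ≤ N) (h₁ : a₁ ≤ A)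
    (h₂ : a₂ ≤ A) (ha₁ : 0 < a₁) (hcop : a₁.Coprime a₂) :
    ((Finset.range B ×ˢ Finset.range B).filter fun t ↦
      a₂ * (M + (t.1 : ℕ)) ≡ a₁ * (M + (t.2 : ℕ)) [ZMOD N]).card ≤ B / a₁ + 1 := by
  have key : ∀ s t : ℕ × ℕ, s.1 < B → s.2 < B → t.1 < B → t.2 < B →
      a₂ * (M + (s.1 : ℕ)) ≡ a₁ * (M + (s.2 : ℕ)) [ZMOD N] →
      a₂ * (M + (t.1 : ℕ)) ≡ a₁ * (M + (t.2 : ℕ)) [ZMOD N] →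
      (a₂ : ℤ) * ((s.1 : ℤ) - t.1) = a₁ * ((s.2 : ℤ) - t.2) := by
    intro s t hs1 hs2 ht1 ht2 hs ht
    have hd : (N : ℤ) ∣ a₁ * ((s.2 : ℤ) - t.2) - a₂ * ((s.1 : ℤ) - t.1) := by
      have := (hs.sub ht).dvd
      convert this using 1
      ring
    have hlt : |(a₁ : ℤ) * ((s.2 : ℤ) - t.2) - a₂ * ((s.1 : ℤ) - t.1)| < N := by
      have hA0 : (0 : ℤ) < A := by omega
      have e1 : |(a₁ : ℤ) * ((s.2 : ℤ) - t.2)| ≤ A * (B - 1) := by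
        rw [abs_mul, Nat.abs_cast]
        refine mul_le_mul (by exact_mod_cast h₁) ?_ (abs_nonneg _) hA0.le
        rw [abs_le]
        omega
      have e2 : |(a₂ : ℤ) * ((s.1 : ℤ) - t.1)| ≤ A * (B - 1) := by
        rw [abs_mul, Nat.abs_cast]
        refine mul_le_mul (by exact_mod_cast h₂) ?_ (abs_nonneg _) hA0.le
        rw [abs_le]
        omega
      have e3 : 2 * ((A : ℤ) * B) ≤ N := by exact_mod_cast hAB
      have := abs_sub ((a₁ : ℤ) * ((s.2 : ℤ) - t.2)) (a₂ * ((s.1 : ℤ) - t.1))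
      linarith
    have := Int.eq_zero_of_abs_lt_dvd hd hlt
    linarith
  rw [← Finset.card_range (B / a₁ + 1)]
  refine Finset.card_le_card_of_injOn (fun t ↦ t.1 / a₁) ?_ ?_
  · intro t ht
    simp only [Finset.coe_filter, Finset.mem_product, Finset.mem_range, Set.mem_ofPred_eq] at ht
    simp only [Finset.coe_range, Set.mem_Iio]
    exact Nat.lt_succ_of_le (Nat.div_le_div_right ht.1.1.le)
  · intro s hs t ht hst
    simp only [Finset.coe_filter, Finset.mem_product, Finset.mem_range, Set.mem_ofPred_eq] at hs ht
    dsimp only at hst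
    have heq := key s t hs.1.1 hs.1.2 ht.1.1 ht.1.2 hs.2 ht.2
    have hdvd : (a₁ : ℤ) ∣ (s.1 : ℤ) - t.1 := by
      exact IsCoprime.dvd_of_dvd_mul_left (Nat.isCoprime_iff_coprime.mpr hcop) ⟨_, heq⟩
    have hmod : s.1 ≡ t.1 [MOD a₁] := by
      rw [← Int.natCast_modEq_iff, Int.modEq_iff_dvd]
      exact (dvd_sub_comm).mp hdvd
    have h1 : s.1 = t.1 := by
      rw [← Nat.div_add_mod s.1 a₁, ← Nat.div_add_mod t.1 a₁, hst, hmod]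
    have h2 : (s.2 : ℤ) - t.2 = 0 := by
      rw [h1, sub_self, mul_zero] at heq
      exact (mul_eq_zero.mp heq.symm).resolve_left (by omega)
    exact Prod.ext h1 (by omega)

/-- The number of coincidences among the residues `(M + t) / a`. -/
lemma card_coincidences_le {N A B : ℕ} (M : ℤ) (hAB : 2 * (A * B) ≤ N) {P : Finset ℕ}
    (hP : ∀ a ∈ P, a.Prime ∧ a ≤ A ∧ a.Coprime N) (hPB : P.card ≤ B) (g : ℕ × ℕ → ℕ)
    (hg : ∀ a ∈ P, ∀ t, a * (g (a, t) : ℤ) ≡ M + t [ZMOD N]) :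
    (((P ×ˢ Finset.range B) ×ˢ (P ×ˢ Finset.range B)).filter fun ij ↦ g ij.1 = g ij.2).card ≤
      5 * (P.card * B) := by
  classical
  set Q : ℕ → ℕ → Finset (ℕ × ℕ) := fun a₁ a₂ ↦ (Finset.range B ×ˢ Finset.range B).filter fun t ↦
      a₂ * (M + (t.1 : ℕ)) ≡ a₁ * (M + (t.2 : ℕ)) [ZMOD N] with hQ
  have hswap : ∀ a₁ a₂, (Q a₁ a₂).card = (Q a₂ a₁).card := by
    intro a₁ a₂
    refine Finset.card_bij' (fun t _ ↦ t.swap) (fun t _ ↦ t.swap) ?_ ?_ ?_ ?_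
    · intro t ht
      simp only [hQ, Finset.mem_filter, Finset.mem_product, Prod.fst_swap, Prod.snd_swap] at ht ⊢
      exact ⟨ht.1.symm, ht.2.symm⟩
    · intro t ht
      simp only [hQ, Finset.mem_filter, Finset.mem_product, Prod.fst_swap, Prod.snd_swap] at ht ⊢
      exact ⟨ht.1.symm, ht.2.symm⟩
    all_goals simp
  have hfib : (((P ×ˢ Finset.range B) ×ˢ (P ×ˢ Finset.range B)).filter fun ij ↦
      g ij.1 = g ij.2).card ≤ ∑ a₁ ∈ P, ∑ a₂ ∈ P, (Q a₁ a₂).card := by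
    rw [← Finset.sum_product', ← Finset.card_sigma]
    refine Finset.card_le_card_of_injOn
      (fun ij ↦ ⟨(ij.1.1, ij.2.1), (ij.1.2, ij.2.2)⟩) ?_ ?_
    · rintro ⟨⟨a₁, t₁⟩, ⟨a₂, t₂⟩⟩ h
      simp only [Finset.coe_filter, Finset.mem_product, Set.mem_ofPred_eq] at h
      simp only [hQ, Finset.coe_sigma, Set.mem_sigma_iff, Finset.mem_coe, Finset.mem_product,
        Finset.mem_filter]
      refine ⟨⟨h.1.1.1, h.1.2.1⟩, ⟨h.1.1.2, h.1.2.2⟩, ?_⟩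
      calc a₂ * (M + (t₁ : ℕ)) ≡ a₂ * (a₁ * (g (a₁, t₁) : ℤ)) [ZMOD N] :=
            (hg a₁ h.1.1.1 t₁).symm.mul_left _
        _ = a₁ * (a₂ * (g (a₂, t₂) : ℤ)) := by rw [h.2]; ring
        _ ≡ _ [ZMOD N] := (hg a₂ h.1.2.1 t₂).mul_left _
    · rintro ⟨⟨a₁, t₁⟩, ⟨a₂, t₂⟩⟩ _ ⟨⟨a₁', t₁'⟩, ⟨a₂', t₂'⟩⟩ _ h
      simp only [Sigma.mk.injEq, Prod.mk.injEq, heq_eq_eq] at h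
      simp only [Prod.mk.injEq]
      tauto
  have hdiag : ∀ a ∈ P, (Q a a).card ≤ B := by
    intro a ha
    rw [← Finset.card_range B]
    refine Finset.card_le_card_of_injOn Prod.fst ?_ ?_
    · intro t ht
      simp only [hQ, Finset.coe_filter, Finset.mem_product, Set.mem_ofPred_eq] at ht
      exact ht.1.1
    · intro s hs t ht hst
      simp only [hQ, Finset.coe_filter, Finset.mem_product, Finset.mem_range,
        Set.mem_ofPred_eq] at hs ht
      have hcop : IsCoprime (N : ℤ) a := Nat.isCoprime_iff_coprime.mpr (hP a ha).2.2.symm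
      have hcancel : ∀ u : ℕ × ℕ, u.1 < B → u.2 < B →
          a * (M + (u.1 : ℕ)) ≡ a * (M + (u.2 : ℕ)) [ZMOD N] → u.1 = u.2 := by
        intro u hu1 hu2 hu
        have h2 : (u.1 : ℤ) ≡ u.2 [ZMOD N] := by
          refine Int.ModEq.add_left_cancel' M (Int.modEq_iff_dvd.mpr ?_)
          refine hcop.dvd_of_dvd_mul_left ?_
          rw [mul_sub]
          exact hu.dvd
        have hBN : B ≤ N := by
          have := (hP a ha).1.pos.trans_le (hP a ha).2.1
          nlinarith
        exact Nat.ModEq.eq_of_lt_of_lt (Int.natCast_modEq_iff.mp h2) (by omega) (by omega)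
      have e1 := hcancel s hs.1.1 hs.1.2 hs.2
      have e2 := hcancel t ht.1.1 ht.1.2 ht.2
      exact Prod.ext hst (by rw [← e1, ← e2]; exact hst)
  have hoff : ∀ a₁ ∈ P, ∀ a₂ ∈ P, a₂ < a₁ → (Q a₁ a₂).card ≤ B / a₁ + 1 := by
    intro a₁ h₁ a₂ h₂ hlt
    exact card_linear_congruence_le M hAB (hP a₁ h₁).2.1 (hP a₂ h₂).2.1 (hP a₁ h₁).1.pos
      ((Nat.coprime_primes (hP a₁ h₁).1 (hP a₂ h₂).1).mpr hlt.ne')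
  have hrow : ∀ a₁ ∈ P, ∑ a₂ ∈ P, (if a₂ < a₁ then B / a₁ + 1 else 0) ≤ 2 * B := by
    intro a₁ h₁
    rw [← Finset.sum_filter, Finset.sum_const, smul_eq_mul]
    have c1 : (P.filter (· < a₁)).card ≤ a₁ := by
      calc (P.filter (· < a₁)).card ≤ (Finset.range a₁).card :=
            Finset.card_le_card fun p hp ↦ Finset.mem_range.mpr (Finset.mem_filter.mp hp).2
        _ = a₁ := Finset.card_range _
    have c2 : (P.filter (· < a₁)).card ≤ B := (Finset.card_filter_le _ _).trans hPB
    have c3 := Nat.mul_div_le B a₁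
    have c4 := Nat.mul_le_mul_right (B / a₁) c1
    rw [mul_add, mul_one]
    omega
  have hbound : ∀ a₁ ∈ P, ∀ a₂ ∈ P, (Q a₁ a₂).card ≤ (if a₁ = a₂ then B else 0) +
      (if a₂ < a₁ then B / a₁ + 1 else 0) + if a₁ < a₂ then B / a₂ + 1 else 0 := by
    intro a₁ h₁ a₂ h₂
    rcases lt_trichotomy a₁ a₂ with h | rfl | h
    · rw [if_neg h.ne, if_neg h.not_gt, if_pos h, hswap]
      simpa using hoff a₂ h₂ a₁ h₁ h
    · simpa using hdiag a₁ h₁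
    · rw [if_neg h.ne', if_pos h, if_neg h.not_gt]
      simpa using hoff a₁ h₁ a₂ h₂ h
  calc _ ≤ ∑ a₁ ∈ P, ∑ a₂ ∈ P, (Q a₁ a₂).card := hfib
    _ ≤ ∑ a₁ ∈ P, ∑ a₂ ∈ P, ((if a₁ = a₂ then B else 0) +
      (if a₂ < a₁ then B / a₁ + 1 else 0) + if a₁ < a₂ then B / a₂ + 1 else 0) :=
        Finset.sum_le_sum fun a₁ h₁ ↦ Finset.sum_le_sum fun a₂ h₂ ↦ hbound a₁ h₁ a₂ h₂
    _ = ∑ a₁ ∈ P, ∑ a₂ ∈ P, (if a₁ = a₂ then B else 0) +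
        ∑ a₁ ∈ P, ∑ a₂ ∈ P, (if a₂ < a₁ then B / a₁ + 1 else 0) +
        ∑ a₂ ∈ P, ∑ a₁ ∈ P, (if a₁ < a₂ then B / a₂ + 1 else 0) := by
        simp only [Finset.sum_add_distrib]
        congr 1
        exact Finset.sum_comm
    _ ≤ ∑ a₁ ∈ P, B + ∑ a₁ ∈ P, 2 * B + ∑ a₁ ∈ P, 2 * B := by
        refine add_le_add (add_le_add ?_ (Finset.sum_le_sum hrow)) (Finset.sum_le_sum hrow)
        exact Finset.sum_le_sum fun a ha ↦ by rw [Finset.sum_ite_eq, if_pos ha]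
    _ = _ := by
        simp only [Finset.sum_const, smul_eq_mul]
        ring

end Shifting

section Shifting

open NumberTheorySymbols

lemma abs_sum_range_shift_sub_le {f : ℤ → ℝ} (hf : ∀ x, |f x| ≤ 1) (B k : ℕ) (M : ℤ) :
    |∑ t ∈ Finset.range B, f (M + t + k) - ∑ t ∈ Finset.range B, f (M + t)| ≤ 2 * k := by
  induction k with
  | zero => simp
  | succ k ih =>
    have h : ∑ t ∈ Finset.range B, f (M + t + (k + 1 : ℕ)) -
        ∑ t ∈ Finset.range B, f (M + t + k) = f (M + B + k) - f (M + k) := by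
      rw [← Finset.sum_sub_distrib]
      have := Finset.sum_range_sub (fun t : ℕ ↦ f (M + t + k)) B
      simp only [Nat.cast_zero, add_zero] at this
      rw [← this]
      refine Finset.sum_congr rfl fun t _ ↦ ?_
      congr 2
      push_cast
      ring
    have h1 := abs_le.mp (hf (M + B + k))
    have h2 := abs_le.mp (hf (M + k))
    have h3 := abs_le.mp ih
    push_cast at h ⊢
    rw [abs_le]
    constructor <;> linarith

lemma abs_jacobiSym_cast_le_one (a : ℤ) (N : ℕ) : |(J(a | N) : ℝ)| ≤ 1 := by
  exact_mod_cast jacobiSym_abs_le_one a N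

lemma exists_mul_modEq {N a : ℕ} (hN : N ≠ 0) (ha : a.Coprime N) (y : ℤ) :
    ∃ x : ℕ, x < N ∧ a * (x : ℤ) ≡ y [ZMOD N] := by
  have : NeZero N := ⟨hN⟩
  refine ⟨((a : ZMod N)⁻¹ * (y : ZMod N)).val, ZMod.val_lt _, ?_⟩
  rw [← ZMod.intCast_eq_intCast_iff]
  push_cast
  rw [ZMod.natCast_zmod_val, ← mul_assoc, ZMod.coe_mul_inv_eq_one a ha, one_mul]

/-- Burgess's shifting argument: an incomplete Jacobi symbol sum is controlled by moments of short
sums over a complete residue system. -/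
theorem exists_shift_bound {N A B H r : ℕ} (hN : N ≠ 0) (hr : 0 < r) (M : ℤ)
    (hAB : 2 * (A * B) ≤ N) {P : Finset ℕ} (hP : ∀ a ∈ P, a.Prime ∧ a ≤ A ∧ a.Coprime N)
    (hPB : P.card ≤ B) :
    ∃ Q : ℝ, 0 ≤ Q ∧
      P.card * H * |∑ t ∈ Finset.range B, (J(M + t | N) : ℝ)| ≤ Q + P.card * H * (2 * (A * H)) ∧
      Q ^ (2 * r) ≤ 5 * (P.card * B : ℝ) ^ (2 * r - 1) *
        ∑ x ∈ Finset.range N, (∑ h ∈ Finset.Icc 1 H, (J((x : ℤ) + (h : ℕ) | N) : ℝ)) ^ (2 * r) := by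
  classical
  have hx : ∀ at' : ℕ × ℕ, ∃ x : ℕ, x < N ∧
      (at'.1 ∈ P → at'.1 * (x : ℤ) ≡ M + at'.2 [ZMOD N]) := by
    rintro ⟨a, t⟩
    by_cases ha : a ∈ P
    · obtain ⟨x, h1, h2⟩ := exists_mul_modEq hN (hP a ha).2.2 (M + t)
      exact ⟨x, h1, fun _ ↦ h2⟩
    · exact ⟨0, Nat.pos_of_ne_zero hN, fun h ↦ absurd h ha⟩
  choose g hgN hg using hx
  set T : ℕ → ℝ := fun x ↦ |∑ h ∈ Finset.Icc 1 H, (J((x : ℤ) + (h : ℕ) | N) : ℝ)| with hT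
  set I := P ×ˢ Finset.range B with hI
  have hIc : (I.card : ℝ) = P.card * B := by rw [hI, Finset.card_product, Finset.card_range]; simp
  refine ⟨∑ i ∈ I, T (g i), Finset.sum_nonneg fun i _ ↦ abs_nonneg _, ?_, ?_⟩
  · set S := ∑ t ∈ Finset.range B, (J(M + t | N) : ℝ) with hS
    have hshift : ∀ a ∈ P, ∀ h ∈ Finset.Icc 1 H,
        |S - ∑ t ∈ Finset.range B, (J(M + t + (a * h : ℕ) | N) : ℝ)| ≤ 2 * (A * H) := by
      intro a ha h hh
      rw [abs_sub_comm]
      refine (abs_sum_range_shift_sub_le (f := fun x ↦ (J(x | N) : ℝ))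
        (fun x ↦ abs_jacobiSym_cast_le_one x N) B (a * h) M).trans ?_
      have : a * h ≤ A * H := Nat.mul_le_mul (hP a ha).2.1 (Finset.mem_Icc.mp hh).2
      have : ((a * h : ℕ) : ℝ) ≤ A * H := by exact_mod_cast this
      linarith
    have hterm : ∀ a ∈ P, ∀ t h : ℕ, (J(M + t + (a * h : ℕ) | N) : ℝ) =
        J(a | N) * J((g (a, t) : ℤ) + h | N) := by
      intro a ha t h
      rw [← Int.cast_mul, ← jacobiSym.mul_left]
      congr 1
      refine jacobiSym_congr ?_
      rw [mul_add]
      push_cast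
      exact ((hg (a, t) ha).symm).add_right _
    have hmain : |∑ a ∈ P, ∑ h ∈ Finset.Icc 1 H,
        ∑ t ∈ Finset.range B, (J(M + t + (a * h : ℕ) | N) : ℝ)| ≤ ∑ i ∈ I, T (g i) := by
      rw [hI, Finset.sum_product]
      refine (Finset.abs_sum_le_sum_abs _ _).trans (Finset.sum_le_sum fun a ha ↦ ?_)
      rw [Finset.sum_comm]
      refine (Finset.abs_sum_le_sum_abs _ _).trans (Finset.sum_le_sum fun t _ ↦ ?_)
      rw [Finset.sum_congr rfl fun h _ ↦ hterm a ha t h, ← Finset.mul_sum, abs_mul]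
      exact mul_le_of_le_one_left (abs_nonneg _) (abs_jacobiSym_cast_le_one _ _)
    have hdiff : |P.card * H * S - ∑ a ∈ P, ∑ h ∈ Finset.Icc 1 H,
        ∑ t ∈ Finset.range B, (J(M + t + (a * h : ℕ) | N) : ℝ)| ≤
          P.card * H * (2 * (A * H)) := by
      have e1 : P.card * H * S = ∑ a ∈ P, ∑ h ∈ Finset.Icc 1 H, S := by
        simp only [Finset.sum_const, Nat.card_Icc, Nat.add_sub_cancel, nsmul_eq_mul]
        ring
      have e2 : (P.card * H * (2 * (A * H)) : ℝ) =
          ∑ a ∈ P, ∑ h ∈ Finset.Icc 1 H, (2 * (A * H) : ℝ) := by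
        simp only [Finset.sum_const, Nat.card_Icc, Nat.add_sub_cancel, nsmul_eq_mul]
        ring
      rw [e1, e2]
      simp only [← Finset.sum_sub_distrib]
      refine (Finset.abs_sum_le_sum_abs _ _).trans (Finset.sum_le_sum fun a ha ↦ ?_)
      exact (Finset.abs_sum_le_sum_abs _ _).trans (Finset.sum_le_sum fun h hh ↦ hshift a ha h hh)
    have e3 : P.card * H * |S| = |P.card * H * S| := by
      rw [abs_mul, abs_of_nonneg (by positivity : (0 : ℝ) ≤ P.card * H)]
    rw [e3]
    have := abs_sub_abs_le_abs_sub (P.card * H * S) (∑ a ∈ P, ∑ h ∈ Finset.Icc 1 H,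
        ∑ t ∈ Finset.range B, (J(M + t + (a * h : ℕ) | N) : ℝ))
    linarith
  · have h1 := sum_comp_pow_le I g (fun i _ ↦ hgN i) T (fun _ ↦ abs_nonneg _) hr
    have h2 := card_coincidences_le M hAB hP hPB g fun a ha t ↦ hg (a, t) ha
    have h2' : (((I ×ˢ I).filter fun ij ↦ g ij.1 = g ij.2).card : ℝ) ≤ 5 * (P.card * B) := by
      exact_mod_cast h2
    have h3 : ∀ x, T x ^ (2 * r) =
        (∑ h ∈ Finset.Icc 1 H, (J((x : ℤ) + (h : ℕ) | N) : ℝ)) ^ (2 * r) := fun x ↦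
      Even.pow_abs (even_two_mul r) _
    simp only [h3] at h1
    refine h1.trans ?_
    rw [hIc]
    refine mul_le_mul_of_nonneg_right ?_ (Finset.sum_nonneg fun x _ ↦ (even_two_mul r).pow_nonneg _)
    rw [show 2 * r - 1 = (2 * r - 2) + 1 by omega, pow_succ]
    calc _ ≤ (P.card * B : ℝ) ^ (2 * r - 2) * (5 * (P.card * B)) :=
          mul_le_mul_of_nonneg_left h2' (by positivity)
      _ = _ := by ring

end Shifting

section PrimeSupply

open Filter Asymptotics

lemma eventually_rpow_le_primeCounting {s : ℝ} (hs : 0 < s) :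
    ∀ᶠ y : ℝ in atTop, 2 * y ^ (1 - s) ≤ (Nat.primeCounting ⌊y⌋₊ : ℝ) := by
  have h1 : ∀ᶠ y : ℝ in atTop, |Real.log y| ≤ 1 / 16 * |y ^ s| :=
    (isLittleO_log_rpow_atTop hs).bound (by norm_num)
  have h2 : ∀ᶠ y : ℝ in atTop, |Real.log y| ≤ 1 / 16 * |y ^ (1 : ℝ)| :=
    (isLittleO_log_rpow_atTop one_pos).bound (by norm_num)
  filter_upwards [h1, h2, eventually_ge_atTop (100 : ℝ)] with y hy1 hy2 hy3
  have hy0 : 0 < y := by linarith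
  have hlog : 0 < Real.log y := Real.log_pos (by linarith)
  rw [abs_of_pos hlog, abs_of_pos (Real.rpow_pos_of_pos hy0 _)] at hy1 hy2
  rw [Real.rpow_one] at hy2
  have hpi := Chebyshev.pi_ge' (x := y) (by linarith)
  rw [div_le_iff₀ hlog] at hpi
  have hl2 : 0.69 < Real.log 2 := by linarith [Real.log_two_gt_d9]
  have hl3 : Real.log (y + 2) ≤ 2 * Real.log y := by
    rw [← Real.log_rpow hy0]
    refine Real.log_le_log (by linarith) ?_
    rw [Real.rpow_two]
    nlinarith
  have hprod : y ^ (1 - s) * y ^ s = y := by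
    rw [← Real.rpow_add hy0]
    simp
  have h4 : 2 * y ^ (1 - s) * Real.log y ≤ y / 8 := by
    have := mul_le_mul_of_nonneg_left hy1 (by positivity : 0 ≤ 2 * y ^ (1 - s))
    nlinarith
  refine le_of_mul_le_mul_right (h4.trans (le_trans ?_ hpi)) hlog
  nlinarith

/-- The primes up to `y` not dividing `N`. -/
def coprimePrimes (N : ℕ) (A : ℕ) : Finset ℕ :=
  (Nat.primesLE A).filter fun p ↦ ¬ p ∣ N

lemma eventually_rpow_le_card_coprimePrimes {α η : ℝ} (hη : 0 < η) (hα : η < α) :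
    ∀ᶠ N : ℕ in atTop, (N : ℝ) ^ (α - η) ≤ (coprimePrimes N ⌊(N : ℝ) ^ α⌋₊).card := by
  have hα0 : 0 < α := hη.trans hα
  obtain ⟨C, hC1, hC⟩ := exists_pow_card_primeFactors_le 2 one_le_two
    (ε := (α - η) / 2) (by linarith)
  have h1 : ∀ᶠ N : ℕ in atTop, 2 * ((N : ℝ) ^ α) ^ (1 - η / α) ≤
      (Nat.primeCounting ⌊(N : ℝ) ^ α⌋₊ : ℝ) :=
    ((tendsto_rpow_atTop hα0).comp tendsto_natCast_atTop_atTop).eventually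
      (eventually_rpow_le_primeCounting (div_pos hη hα0))
  have h2 : ∀ᶠ N : ℕ in atTop, C ≤ (N : ℝ) ^ ((α - η) / 2) :=
    ((tendsto_rpow_atTop (by linarith)).comp tendsto_natCast_atTop_atTop).eventually_ge_atTop C
  filter_upwards [h1, h2, eventually_gt_atTop 0] with N hN1 hN2 hN0
  have hNpos : (0 : ℝ) < N := by exact_mod_cast hN0
  have e1 : ((N : ℝ) ^ α) ^ (1 - η / α) = (N : ℝ) ^ (α - η) := by
    rw [← Real.rpow_mul hNpos.le]
    congr 1
    field_simp
  rw [e1] at hN1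
  have e2 : (N.primeFactors.card : ℝ) ≤ (N : ℝ) ^ (α - η) := by
    calc (N.primeFactors.card : ℝ) ≤ 2 ^ N.primeFactors.card := by
          exact_mod_cast Nat.lt_two_pow_self.le
      _ ≤ C * (N : ℝ) ^ ((α - η) / 2) := hC N hN0.ne'
      _ ≤ (N : ℝ) ^ ((α - η) / 2) * (N : ℝ) ^ ((α - η) / 2) := by gcongr
      _ = _ := by rw [← Real.rpow_add hNpos]; congr 1; ring
  have e3 : Nat.primeCounting ⌊(N : ℝ) ^ α⌋₊ ≤
      (coprimePrimes N ⌊(N : ℝ) ^ α⌋₊).card + N.primeFactors.card := by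
    rw [← Nat.primesLE_card_eq_primeCounting,
      ← Finset.card_filter_add_card_filter_not (s := Nat.primesLE _) fun p ↦ ¬ p ∣ N]
    refine Nat.add_le_add_left (Finset.card_le_card fun p hp ↦ ?_) _
    rw [Finset.mem_filter, not_not] at hp
    exact Nat.mem_primeFactors.mpr ⟨Nat.prime_of_mem_primesLE hp.1, hp.2, hN0.ne'⟩
  have e4 : (Nat.primeCounting ⌊(N : ℝ) ^ α⌋₊ : ℝ) ≤
      (coprimePrimes N ⌊(N : ℝ) ^ α⌋₊).card + N.primeFactors.card := by exact_mod_cast e3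
  linarith

end PrimeSupply

section Burgess

open Filter NumberTheorySymbols

lemma mem_coprimePrimes {N A p : ℕ} (hp : p ∈ coprimePrimes N A) :
    p.Prime ∧ p ≤ A ∧ p.Coprime N := by
  obtain ⟨h1, h2⟩ := Finset.mem_filter.mp hp
  have hpp := Nat.prime_of_mem_primesLE h1
  exact ⟨hpp, Nat.le_of_mem_primesLE h1, (Nat.Prime.coprime_iff_not_dvd hpp).mpr h2⟩

lemma half_le_floor {x : ℝ} (hx : 1 ≤ x) : x / 2 ≤ ⌊x⌋₊ := by
  have h1 := Nat.lt_floor_add_one x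
  have h2 : (1 : ℝ) ≤ ⌊x⌋₊ := by exact_mod_cast (Nat.one_le_floor_iff x).mpr hx
  linarith

set_option maxHeartbeats 1000000 in
lemma exists_burgess_block {κ : ℝ} (hκ : 0 < κ) (hκ8 : κ ≤ 1 / 8) :
    ∃ δ : ℝ, 0 < δ ∧ ∃ C : ℝ, ∀ᶠ N : ℕ in atTop, Squarefree N → Odd N → ∀ M : ℤ,
      |∑ t ∈ Finset.range ⌊(N : ℝ) ^ (1 / 4 + κ)⌋₊, (J(M + t | N) : ℝ)| ≤
        C * ⌊(N : ℝ) ^ (1 / 4 + κ)⌋₊ * (N : ℝ) ^ (-δ) := by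
  set r := ⌈2 / κ⌉₊ with hr
  have hr0 : 0 < r := Nat.ceil_pos.mpr (by positivity)
  have hrpos : (0 : ℝ) < r := by exact_mod_cast hr0
  set u : ℝ := 1 / (2 * r) with hu
  have hu0 : 0 < u := by positivity
  have hru : r * u = 1 / 2 := by rw [hu]; field_simp
  have hrκ : 2 / κ ≤ r := Nat.le_ceil _
  have huκ : u ≤ κ / 4 := by
    rw [div_le_iff₀ hκ] at hrκ
    nlinarith
  obtain ⟨C, hC1, hC⟩ := exists_sum_jacobiSym_pow_le hr0 hu0
  set α : ℝ := 1 / 4 + κ - κ / 4 - u with hα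
  set δ : ℝ := 3 / 4 * κ * u with hδ
  have hδ0 : 0 < δ := by positivity
  have hδκ : δ ≤ κ / 4 := by nlinarith
  set K : ℝ := 20 * C * 2 ^ (2 * r) with hK
  have hK1 : 1 ≤ K := by
    have : (1 : ℝ) ≤ 2 ^ (2 * r) := one_le_pow₀ (by norm_num)
    nlinarith
  refine ⟨δ, hδ0, K + 4, ?_⟩
  filter_upwards [eventually_rpow_le_card_coprimePrimes (α := α) (η := κ / 4) (by linarith)
    (by linarith), eventually_ge_atTop 16] with N hX hN16 hN hodd M
  have hN1 : (1 : ℝ) ≤ N := by exact_mod_cast (by omega : 1 ≤ N)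
  have hN16' : (16 : ℝ) ≤ N := by exact_mod_cast hN16
  have hN0 : (0 : ℝ) < N := by linarith
  have hone : ∀ e : ℝ, 0 ≤ e → 1 ≤ (N : ℝ) ^ e := fun e he ↦ Real.one_le_rpow hN1 he
  have hpow : ∀ e : ℝ, 0 < (N : ℝ) ^ e := fun e ↦ Real.rpow_pos_of_pos hN0 e
  set B := ⌊(N : ℝ) ^ (1 / 4 + κ)⌋₊ with hB
  set A := ⌊(N : ℝ) ^ α⌋₊ with hA
  set H := ⌊(N : ℝ) ^ u⌋₊ with hH
  set P := coprimePrimes N A with hPdef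
  have hB1 : (B : ℝ) ≤ (N : ℝ) ^ (1 / 4 + κ) := Nat.floor_le (hpow _).le
  have hB2 : (N : ℝ) ^ (1 / 4 + κ) / 2 ≤ B := half_le_floor (hone _ (by linarith))
  have hA1 : (A : ℝ) ≤ (N : ℝ) ^ α := Nat.floor_le (hpow _).le
  have hH1 : (H : ℝ) ≤ (N : ℝ) ^ u := Nat.floor_le (hpow _).le
  have hH2 : (N : ℝ) ^ u / 2 ≤ H := half_le_floor (hone _ hu0.le)
  have hBpos : (0 : ℝ) < B := lt_of_lt_of_le (half_pos (hpow _)) hB2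
  have hHpos : (0 : ℝ) < H := lt_of_lt_of_le (half_pos (hpow _)) hH2
  have hXpos : (0 : ℝ) < P.card := lt_of_lt_of_le (hpow _) hX
  have hAB' : 2 * ((A : ℝ) * B) ≤ N := by
    have h1 : (A : ℝ) * B ≤ (N : ℝ) ^ α * (N : ℝ) ^ (1 / 4 + κ) :=
      mul_le_mul hA1 hB1 hBpos.le (hpow _).le
    rw [← Real.rpow_add hN0] at h1
    have h2 : (N : ℝ) ^ (α + (1 / 4 + κ)) ≤ (N : ℝ) ^ (3 / 4 : ℝ) :=
      Real.rpow_le_rpow_of_exponent_le hN1 (by linarith)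
    have h3 : (2 : ℝ) ≤ (N : ℝ) ^ (1 / 4 : ℝ) := by
      calc (2 : ℝ) = (16 : ℝ) ^ (1 / 4 : ℝ) := by
            rw [show (16 : ℝ) = 2 ^ (4 : ℝ) by norm_num, ← Real.rpow_mul (by norm_num)]
            norm_num
        _ ≤ _ := Real.rpow_le_rpow (by norm_num) hN16' (by norm_num)
    have h4 : (N : ℝ) ^ (1 / 4 : ℝ) * (N : ℝ) ^ (3 / 4 : ℝ) = N := by
      rw [← Real.rpow_add hN0]
      norm_num
    have h5 := mul_le_mul_of_nonneg_right h3 (hpow (3 / 4)).le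
    linarith
  have hAB : 2 * (A * B) ≤ N := by exact_mod_cast hAB'
  have hP : ∀ a ∈ P, a.Prime ∧ a ≤ A ∧ a.Coprime N := fun a ha ↦ mem_coprimePrimes ha
  have hPB : P.card ≤ B := by
    calc P.card ≤ (Finset.Icc 1 A).card := Finset.card_le_card fun a ha ↦
          Finset.mem_Icc.mpr ⟨(hP a ha).1.one_lt.le, (hP a ha).2.1⟩
      _ = A := by simp
      _ ≤ B := Nat.floor_le_floor (Real.rpow_le_rpow_of_exponent_le hN1 (by linarith))
  obtain ⟨Q, hQ0, hQ1, hQ2⟩ := exists_shift_bound (N := N) (H := H) hN.ne_zero hr0 M hAB hP hPB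
  have hHr : (H : ℝ) ^ r ≤ (N : ℝ) ^ (1 / 2 : ℝ) := by
    refine (pow_le_pow_left₀ hHpos.le hH1 r).trans (le_of_eq ?_)
    rw [← Real.rpow_mul_natCast hN0.le, mul_comm, hru]
  have hH2r : (H : ℝ) ^ (2 * r + 1) ≤ (N : ℝ) ^ (1 + u) := by
    refine (pow_le_pow_left₀ hHpos.le hH1 _).trans (le_of_eq ?_)
    rw [← Real.rpow_mul_natCast hN0.le]
    congr 1
    push_cast
    linarith
  have hH2r' : (N : ℝ) / 2 ^ (2 * r) ≤ (H : ℝ) ^ (2 * r) := by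
    refine le_trans (le_of_eq ?_) (pow_le_pow_left₀ (half_pos (hpow _)).le hH2 _)
    rw [div_pow, ← Real.rpow_mul_natCast hN0.le]
    push_cast
    rw [show u * (2 * (r : ℝ)) = 1 by linarith, Real.rpow_one]
  have hmom : ∑ x ∈ Finset.range N, (∑ h ∈ Finset.Icc 1 H, (J((x : ℤ) + (h : ℕ) | N) : ℝ)) ^ (2 * r)
      ≤ 2 * C * (N : ℝ) ^ (3 / 2 + 2 * u) := by
    refine (hC N H hN hodd).trans ?_
    have h1 : (N : ℝ) * H ^ r ≤ (N : ℝ) ^ (3 / 2 + 2 * u) := by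
      calc (N : ℝ) * H ^ r ≤ N * (N : ℝ) ^ (1 / 2 : ℝ) := by gcongr
        _ = (N : ℝ) ^ (3 / 2 : ℝ) := by
          nth_rewrite 1 [← Real.rpow_one (N : ℝ)]
          rw [← Real.rpow_add hN0]
          norm_num
        _ ≤ _ := Real.rpow_le_rpow_of_exponent_le hN1 (by linarith)
    have h2 : (N : ℝ) ^ (1 / 2 + u) * H ^ (2 * r + 1) ≤ (N : ℝ) ^ (3 / 2 + 2 * u) := by
      refine (mul_le_mul_of_nonneg_left hH2r (hpow _).le).trans (le_of_eq ?_)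
      rw [← Real.rpow_add hN0]
      congr 1
      ring
    nlinarith
  have hQ : Q ≤ P.card * H * (B * K * (N : ℝ) ^ (-δ)) := by
    refine le_of_pow_le_pow_left₀ (n := 2 * r) (by omega) (by positivity) (hQ2.trans ?_)
    have h1 : (P.card * H * (B * K * (N : ℝ) ^ (-δ))) ^ (2 * r) =
        (P.card * B : ℝ) ^ (2 * r - 1) *
          ((P.card * B) * H ^ (2 * r) * (K ^ (2 * r) * (N : ℝ) ^ (-(3 / 4 * κ)))) := by
      have e1 : (N : ℝ) ^ (-(3 / 4 * κ)) = ((N : ℝ) ^ (-δ)) ^ (2 * r) := by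
        rw [← Real.rpow_mul_natCast hN0.le]
        congr 1
        push_cast
        rw [hδ]
        linear_combination (3 / 2 * κ) * hru
      rw [e1]
      obtain ⟨k, hk⟩ := Nat.exists_eq_add_one_of_ne_zero (by omega : 2 * r ≠ 0)
      rw [hk, Nat.add_sub_cancel]
      ring
    rw [h1, mul_assoc 5, mul_left_comm]
    refine mul_le_mul_of_nonneg_left ?_ (by positivity)
    have h2 : (N : ℝ) ^ (3 / 2 + 2 * κ - κ / 2 - u) / (2 * 2 ^ (2 * r)) ≤
        (P.card * B) * H ^ (2 * r) := by
      calc (N : ℝ) ^ (3 / 2 + 2 * κ - κ / 2 - u) / (2 * 2 ^ (2 * r)) =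
            ((N : ℝ) ^ (α - κ / 4) * ((N : ℝ) ^ (1 / 4 + κ) / 2)) * (N / 2 ^ (2 * r)) := by
            have : (N : ℝ) ^ (3 / 2 + 2 * κ - κ / 2 - u) =
                (N : ℝ) ^ (α - κ / 4) * (N : ℝ) ^ (1 / 4 + κ) * N := by
              nth_rewrite 4 [← Real.rpow_one (N : ℝ)]
              rw [← Real.rpow_add hN0, ← Real.rpow_add hN0]
              congr 1
              rw [hα]
              ring
            rw [this, div_mul_eq_div_div]
            ring
        _ ≤ _ := by gcongr
    have hKK : K ≤ K ^ (2 * r) := le_self_pow₀ hK1 (by omega)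
    have h3 : (N : ℝ) ^ (3 / 2 + 2 * u) ≤
        (N : ℝ) ^ (3 / 2 + 2 * κ - κ / 2 - u) * (N : ℝ) ^ (-(3 / 4 * κ)) := by
      rw [← Real.rpow_add hN0]
      exact Real.rpow_le_rpow_of_exponent_le hN1 (by linarith)
    calc 5 * ∑ x ∈ Finset.range N,
          (∑ h ∈ Finset.Icc 1 H, (J((x : ℤ) + (h : ℕ) | N) : ℝ)) ^ (2 * r)
        ≤ 10 * C * (N : ℝ) ^ (3 / 2 + 2 * u) := by linarith
      _ ≤ 10 * C * ((N : ℝ) ^ (3 / 2 + 2 * κ - κ / 2 - u) * (N : ℝ) ^ (-(3 / 4 * κ))) := by gcongr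
      _ = (N : ℝ) ^ (3 / 2 + 2 * κ - κ / 2 - u) / (2 * 2 ^ (2 * r)) *
            (K * (N : ℝ) ^ (-(3 / 4 * κ))) := by
          have : (2 : ℝ) ^ (2 * r) ≠ 0 := by positivity
          rw [hK]
          generalize (2 : ℝ) ^ (2 * r) = a at *
          field_simp
          ring
      _ ≤ _ := by gcongr
  have hAH : (A : ℝ) * H ≤ 2 * B * (N : ℝ) ^ (-δ) := by
    calc (A : ℝ) * H ≤ (N : ℝ) ^ α * (N : ℝ) ^ u := by gcongr
      _ = (N : ℝ) ^ (1 / 4 + κ) * (N : ℝ) ^ (-(κ / 4)) := by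
        rw [← Real.rpow_add hN0, ← Real.rpow_add hN0]
        congr 1
        rw [hα]
        ring
      _ ≤ (2 * B) * (N : ℝ) ^ (-δ) := by
        refine mul_le_mul (by linarith) ?_ (hpow _).le (by positivity)
        exact Real.rpow_le_rpow_of_exponent_le hN1 (by linarith)
  have hfin : P.card * H * |∑ t ∈ Finset.range B, (J(M + t | N) : ℝ)| ≤
      P.card * H * (B * K * (N : ℝ) ^ (-δ) + 2 * (2 * B * (N : ℝ) ^ (-δ))) := by
    refine hQ1.trans ?_
    rw [mul_add]
    refine add_le_add hQ (mul_le_mul_of_nonneg_left ?_ (by positivity))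
    linarith
  refine (le_of_mul_le_mul_left hfin (by positivity)).trans (le_of_eq ?_)
  ring

lemma abs_sum_range_blocks_le {f : ℤ → ℝ} (hf : ∀ x, |f x| ≤ 1) {B : ℕ} (hB : 0 < B) {E : ℝ}
    (hE : ∀ M : ℤ, |∑ t ∈ Finset.range B, f (M + t)| ≤ E) (M : ℤ) (L : ℕ) :
    |∑ t ∈ Finset.range L, f (M + t)| ≤ (L / B : ℕ) * E + B := by
  induction L using Nat.strong_induction_on generalizing M with
  | _ L ih =>
    have htriv : |∑ t ∈ Finset.range L, f (M + t)| ≤ L :=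
      (Finset.abs_sum_le_sum_abs _ _).trans
        ((Finset.sum_le_sum fun t _ ↦ hf _).trans (by simp))
    rcases lt_or_ge L B with h | h
    · rw [Nat.div_eq_of_lt h]
      have : (L : ℝ) ≤ B := by exact_mod_cast h.le
      simp only [Nat.cast_zero, zero_mul, zero_add]
      linarith
    · obtain ⟨k, rfl⟩ := Nat.exists_eq_add_of_le h
      rw [Finset.sum_range_add]
      have h1 := ih k (by omega) (M + B)
      have h2 := hE M
      have h3 : ((B + k) / B : ℕ) = k / B + 1 := by rw [Nat.add_div_left _ hB]
      have h4 : ∑ t ∈ Finset.range k, f (M + (B + t : ℕ)) =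
          ∑ t ∈ Finset.range k, f (M + B + t) := by
        refine Finset.sum_congr rfl fun t _ ↦ ?_
        push_cast
        rw [add_assoc]
      rw [h3, h4]
      push_cast
      have := abs_add_le (∑ t ∈ Finset.range B, f (M + t)) (∑ t ∈ Finset.range k, f (M + B + t))
      linarith

/-- **Burgess's bound** for Jacobi symbol sums of length at least `N ^ (1 / 4 + κ)`. -/
theorem exists_burgess {κ : ℝ} (hκ : 0 < κ) :
    ∃ δ : ℝ, 0 < δ ∧ ∃ C : ℝ, 0 < C ∧ ∀ N : ℕ, Squarefree N → Odd N → ∀ (M : ℤ) (L : ℕ),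
      (N : ℝ) ^ (1 / 4 + κ) ≤ L →
        |∑ t ∈ Finset.range L, (J(M + t | N) : ℝ)| ≤ C * L * (N : ℝ) ^ (-δ) := by
  set κ' := min (κ / 2) (1 / 8) with hκ'
  have hκ'0 : 0 < κ' := lt_min (by linarith) (by norm_num)
  obtain ⟨δ, hδ, C, hC⟩ := exists_burgess_block hκ'0 (min_le_right _ _)
  obtain ⟨N₀, hN₀⟩ := eventually_atTop.mp hC
  set δ' := min δ (κ / 2) with hδ'
  have hδ'0 : 0 < δ' := lt_min hδ (by linarith)
  refine ⟨δ', hδ'0, |C| + 1 + ((N₀ : ℝ) + 1) ^ δ', by positivity, fun N hN hodd M L hL ↦ ?_⟩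
  have hN1 : (1 : ℝ) ≤ N := by exact_mod_cast Nat.one_le_iff_ne_zero.mpr hN.ne_zero
  have hN0 : (0 : ℝ) < N := by linarith
  have hpow : ∀ e : ℝ, 0 < (N : ℝ) ^ e := fun e ↦ Real.rpow_pos_of_pos hN0 e
  have hle := fun x : ℤ ↦ abs_jacobiSym_cast_le_one x N
  have hsplit : (|C| + 1 + ((N₀ : ℝ) + 1) ^ δ') * L * (N : ℝ) ^ (-δ') =
      (|C| + 1) * (L * (N : ℝ) ^ (-δ')) + L * (((N₀ : ℝ) + 1) ^ δ' * (N : ℝ) ^ (-δ')) := by ring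
  rw [hsplit]
  have hL0 : (0 : ℝ) ≤ L := Nat.cast_nonneg _
  rcases lt_or_ge N N₀ with hlt | hge
  · have htriv : |∑ t ∈ Finset.range L, (J(M + t | N) : ℝ)| ≤ L :=
      (Finset.abs_sum_le_sum_abs _ _).trans
        ((Finset.sum_le_sum fun t _ ↦ hle _).trans (by simp))
    have h1 : 1 ≤ ((N₀ : ℝ) + 1) ^ δ' * (N : ℝ) ^ (-δ') := by
      rw [Real.rpow_neg hN0.le, ← div_eq_mul_inv, one_le_div (hpow _)]
      refine Real.rpow_le_rpow hN0.le ?_ hδ'0.le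
      have : (N : ℝ) < N₀ := by exact_mod_cast hlt
      linarith
    have h2 := mul_le_mul_of_nonneg_left h1 hL0
    have h3 : 0 ≤ (|C| + 1) * (L * (N : ℝ) ^ (-δ')) := by positivity
    linarith
  · set B := ⌊(N : ℝ) ^ (1 / 4 + κ')⌋₊ with hB
    have hB0 : 0 < B := Nat.floor_pos.mpr (Real.one_le_rpow hN1 (by linarith))
    have hBpos : (0 : ℝ) < B := by exact_mod_cast hB0
    have hblock : ∀ M : ℤ, |∑ t ∈ Finset.range B, (J(M + t | N) : ℝ)| ≤
        |C| * B * (N : ℝ) ^ (-δ) := fun M ↦ by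
      refine (hN₀ N hge hN hodd M).trans ?_
      have := le_abs_self C
      gcongr
    have h1 := abs_sum_range_blocks_le (f := fun x ↦ (J(x | N) : ℝ)) hle hB0 hblock M L
    have h2 : ((L / B : ℕ) : ℝ) * B ≤ L := by exact_mod_cast Nat.div_mul_le_self L B
    have h3 : (B : ℝ) ≤ L * (N : ℝ) ^ (-δ') := by
      calc (B : ℝ) ≤ (N : ℝ) ^ (1 / 4 + κ') := Nat.floor_le (hpow _).le
        _ ≤ (N : ℝ) ^ (1 / 4 + κ + -δ') := by
          refine Real.rpow_le_rpow_of_exponent_le hN1 ?_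
          have := min_le_left (κ / 2) (1 / 8)
          have := min_le_right δ (κ / 2)
          linarith
        _ = (N : ℝ) ^ (1 / 4 + κ) * (N : ℝ) ^ (-δ') := Real.rpow_add hN0 _ _
        _ ≤ _ := by gcongr
    have h4 : (N : ℝ) ^ (-δ) ≤ (N : ℝ) ^ (-δ') :=
      Real.rpow_le_rpow_of_exponent_le hN1 (neg_le_neg (min_le_left _ _))
    have h5 : ((L / B : ℕ) : ℝ) * (|C| * B * (N : ℝ) ^ (-δ)) ≤ |C| * (L * (N : ℝ) ^ (-δ')) := by
      calc ((L / B : ℕ) : ℝ) * (|C| * B * (N : ℝ) ^ (-δ))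
          = |C| * ((((L / B : ℕ) : ℝ) * B) * (N : ℝ) ^ (-δ)) := by ring
        _ ≤ _ := by gcongr
    have h6 : 0 ≤ L * (((N₀ : ℝ) + 1) ^ δ' * (N : ℝ) ^ (-δ')) := by positivity
    linarith

end Burgess

section QuadraticStructure

open NumberTheorySymbols

/-- A function on the naturals which behaves like a quadratic character modulo `q` at the
integers coprime to `q`. -/
structure IsQuadraticMod (q : ℕ) (φ : ℕ → ℂ) : Prop where
  congr : ∀ a b, a ≡ b [MOD q] → φ a = φ b
  map_mul : ∀ a b, a.Coprime q → b.Coprime q → φ (a * b) = φ a * φ b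
  mul_self : ∀ a, a.Coprime q → φ a * φ a = 1

namespace IsQuadraticMod

variable {q : ℕ} {φ : ℕ → ℂ}

lemma map_pow (h : IsQuadraticMod q φ) {a : ℕ} (ha : a.Coprime q) {k : ℕ} (hk : k ≠ 0) :
    φ (a ^ k) = φ a ^ k := by
  induction k with
  | zero => exact absurd rfl hk
  | succ n ih =>
    rcases eq_or_ne n 0 with rfl | hn
    · simp
    · rw [pow_succ, pow_succ, h.map_mul _ _ (ha.pow_left n) ha, ih hn]

lemma pow_odd (h : IsQuadraticMod q φ) {a : ℕ} (ha : a.Coprime q) {k : ℕ} (hk : Odd k) :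
    φ (a ^ k) = φ a := by
  obtain ⟨j, rfl⟩ := hk
  rw [h.map_pow ha (by omega), pow_succ, pow_mul, sq, h.mul_self a ha, one_pow, one_mul]

lemma eq_of_mul_eq_one (h : IsQuadraticMod q φ) {a b : ℕ} (ha : a.Coprime q) (hb : b.Coprime q)
    (hab : φ (a * b) = 1) : φ a = φ b := by
  rw [h.map_mul a b ha hb] at hab
  calc φ a = φ a * (φ b * φ b) := by rw [h.mul_self b hb, mul_one]
    _ = φ b := by rw [← mul_assoc, hab, one_mul]

lemma eq_one_or (h : IsQuadraticMod q φ) {a : ℕ} (ha : a.Coprime q) : φ a = 1 ∨ φ a = -1 :=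
  mul_self_eq_one_iff.mp (h.mul_self a ha)

lemma mul {ψ : ℕ → ℂ} (h : IsQuadraticMod q φ) (h' : IsQuadraticMod q ψ) :
    IsQuadraticMod q fun n ↦ φ n * ψ n where
  congr a b hab := by simp only [h.congr a b hab, h'.congr a b hab]
  map_mul a b ha hb := by simp only [h.map_mul a b ha hb, h'.map_mul a b ha hb]; ring
  mul_self a ha := by linear_combination φ a * φ a * h'.mul_self a ha + h.mul_self a ha

lemma exists_split {a b : ℕ} (hab : a.Coprime b) (h : IsQuadraticMod (a * b) φ) :
    ∃ φ₁ φ₂, IsQuadraticMod a φ₁ ∧ IsQuadraticMod b φ₂ ∧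
      ∀ n, n.Coprime (a * b) → φ n = φ₁ n * φ₂ n := by
  have key : ∀ {a b : ℕ} (hab : a.Coprime b), IsQuadraticMod (a * b) φ →
      IsQuadraticMod a fun n ↦ φ (Nat.chineseRemainder hab n 1) := by
    intro a b hab h
    have hcop : ∀ n, n.Coprime a → (Nat.chineseRemainder hab n 1 : ℕ).Coprime (a * b) := by
      intro n hn
      have h1 := (Nat.chineseRemainder hab n 1).2
      refine Nat.Coprime.mul_right ?_ ?_
      · rw [Nat.Coprime, h1.1.gcd_eq]; exact hn
      · rw [Nat.Coprime, h1.2.gcd_eq]; simp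
    refine ⟨fun x y hxy ↦ h.congr _ _ ?_, fun x y hx hy ↦ ?_, fun x hx ↦ h.mul_self _ (hcop x hx)⟩
    · have h1 := (Nat.chineseRemainder hab x 1).2
      have h2 := (Nat.chineseRemainder hab y 1).2
      exact (Nat.modEq_and_modEq_iff_modEq_mul hab).mp
        ⟨(h1.1.trans hxy).trans h2.1.symm, h1.2.trans h2.2.symm⟩
    · rw [← h.map_mul _ _ (hcop x hx) (hcop y hy)]
      refine h.congr _ _ ?_
      have h1 := (Nat.chineseRemainder hab x 1).2
      have h2 := (Nat.chineseRemainder hab y 1).2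
      have h3 := (Nat.chineseRemainder hab (x * y) 1).2
      refine (Nat.modEq_and_modEq_iff_modEq_mul hab).mp
        ⟨h3.1.trans (h1.1.mul h2.1).symm, h3.2.trans ?_⟩
      exact (h1.2.mul h2.2).symm
  have h' : IsQuadraticMod (b * a) φ := by rwa [mul_comm]
  refine ⟨_, _, key hab h, key hab.symm h', fun n hn ↦ ?_⟩
  have h1 := (Nat.chineseRemainder hab n 1).2
  have h2 := (Nat.chineseRemainder hab.symm n 1).2
  have hna := Nat.Coprime.coprime_mul_right_right hn
  have hnb := Nat.Coprime.coprime_mul_left_right hn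
  rw [← h.map_mul]
  · refine h.congr _ _ ((Nat.modEq_and_modEq_iff_modEq_mul hab).mp ⟨?_, ?_⟩)
    · simpa using (h1.1.mul h2.2).symm
    · simpa using (h1.2.mul h2.1).symm
  · refine Nat.Coprime.mul_right ?_ ?_
    · rw [Nat.Coprime, h1.1.gcd_eq]; exact hna
    · rw [Nat.Coprime, h1.2.gcd_eq]; simp
  · refine Nat.Coprime.mul_right ?_ ?_
    · rw [Nat.Coprime, h2.2.gcd_eq]; simp
    · rw [Nat.Coprime, h2.1.gcd_eq]; exact hnb

lemma eq_one_of_isSquare {p k : ℕ} [Fact p.Prime] (hp2 : p ≠ 2) (h : IsQuadraticMod (p ^ (k + 1)) φ)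
    {n : ℕ} (hn : n.Coprime p) (hsq : IsSquare (n : ZMod p)) : φ n = 1 := by
  have hp : p.Prime := Fact.out
  obtain ⟨y, hy⟩ := hsq
  obtain ⟨y, rfl⟩ := ZMod.natCast_zmod_surjective y
  have hmod : n ≡ y * y [MOD p] := by
    rw [← ZMod.natCast_eq_natCast_iff]; exact_mod_cast hy
  have hy' : y.Coprime p := by
    have : (y * y).Coprime p := by rw [Nat.Coprime, ← hmod.gcd_eq]; exact hn
    exact Nat.Coprime.coprime_mul_right this
  have hodd : Odd (p ^ k) := (hp.odd_of_ne_two hp2).pow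
  have hpow : n ^ p ^ k ≡ (y * y) ^ p ^ k [MOD p ^ (k + 1)] := by
    have h1 : ((p : ℕ) : ℤ) ∣ (n : ℤ) - (y * y : ℕ) := (Nat.modEq_iff_dvd.mp hmod.symm)
    have h2 := dvd_sub_pow_of_dvd_sub h1 k
    refine (Nat.modEq_iff_dvd.mpr ?_).symm
    push_cast at h2 ⊢
    exact h2
  have hyq := hy'.pow_right (k + 1)
  rw [← h.pow_odd (hn.pow_right (k + 1)) hodd, h.congr _ _ hpow, mul_pow,
    h.map_mul _ _ (hyq.pow_left _) (hyq.pow_left _), h.mul_self _ (hyq.pow_left _)]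

lemma exists_of_odd_prime_pow {p k : ℕ} (hp : p.Prime) (hp2 : p ≠ 2)
    (h : IsQuadraticMod (p ^ (k + 1)) φ) :
    ∃ N, N ∣ p ∧ ∀ n : ℕ, n.Coprime p → φ n = (J(n | N) : ℂ) := by
  have : Fact p.Prime := ⟨hp⟩
  by_cases hall : ∀ n : ℕ, n.Coprime p → φ n = 1
  · exact ⟨1, one_dvd p, fun n hn ↦ by simp [hall n hn]⟩
  push Not at hall
  obtain ⟨a, ha, ha1⟩ := hall
  have hasq : ¬ IsSquare (a : ZMod p) := fun hs ↦ ha1 (h.eq_one_of_isSquare hp2 ha hs)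
  have hne : ∀ n : ℕ, n.Coprime p → (n : ZMod p) ≠ 0 := fun n hn h0 ↦ by
    rw [ZMod.natCast_eq_zero_iff] at h0
    exact (Nat.Prime.coprime_iff_not_dvd hp).mp hn.symm h0
  refine ⟨p, dvd_rfl, fun n hn ↦ ?_⟩
  rw [← jacobiSym.legendreSym.to_jacobiSym]
  have hn0 : ((n : ℤ) : ZMod p) ≠ 0 := by exact_mod_cast hne n hn
  have ha0 : ((a : ℤ) : ZMod p) ≠ 0 := by exact_mod_cast hne a ha
  by_cases hs : IsSquare (n : ZMod p)
  · rw [h.eq_one_of_isSquare hp2 hn hs, (legendreSym.eq_one_iff p hn0).mpr (by exact_mod_cast hs)]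
    simp
  · have hna : φ (n * a) = 1 := by
      refine h.eq_one_of_isSquare hp2 (hn.mul_left ha) ?_
      have h0 : (((n * a : ℕ) : ℤ) : ZMod p) ≠ 0 := by
        push_cast
        exact mul_ne_zero (hne n hn) (hne a ha)
      have h1 : legendreSym p (n * a : ℕ) = 1 := by
        push_cast
        rw [legendreSym.mul, (legendreSym.eq_neg_one_iff p).mpr (by exact_mod_cast hs),
          (legendreSym.eq_neg_one_iff p).mpr (by exact_mod_cast hasq)]
        norm_num
      exact_mod_cast (legendreSym.eq_one_iff p h0).mp h1
    rw [h.eq_of_mul_eq_one (hn.pow_right _) (ha.pow_right _) hna,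
      (h.eq_one_or (ha.pow_right _)).resolve_left ha1,
      (legendreSym.eq_neg_one_iff p).mpr (by exact_mod_cast hs)]
    simp

lemma exists_sq_modEq_two_pow {u : ℕ} (hu : u ≡ 1 [MOD 8]) (k : ℕ) :
    ∃ x : ℕ, x ^ 2 ≡ u [MOD 2 ^ k] := by
  suffices ∃ x : ℤ, Odd x ∧ (2 : ℤ) ^ (k + 3) ∣ x ^ 2 - u by
    obtain ⟨x, -, hx⟩ := this
    refine ⟨x.natAbs, (Nat.modEq_iff_dvd.mpr ?_).symm⟩
    push_cast
    rw [sq_abs]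
    exact (pow_dvd_pow 2 (by omega)).trans hx
  induction k with
  | zero =>
    refine ⟨1, odd_one, ?_⟩
    have := Nat.modEq_iff_dvd.mp hu
    push_cast at this ⊢
    exact this
  | succ k ih =>
    obtain ⟨x, hxo, c, hc⟩ := ih
    rcases Int.even_or_odd c with ⟨d, hd⟩ | hcodd
    · exact ⟨x, hxo, d, by rw [hc, hd]; ring⟩
    · obtain ⟨d, hd⟩ := hcodd.add_odd hxo
      refine ⟨x + 2 ^ (k + 2), hxo.add_even ⟨2 ^ (k + 1), by ring⟩, d + 2 ^ k, ?_⟩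
      linear_combination hc + 2 ^ (k + 3) * hd

lemma exists_of_two_pow {k : ℕ} (h : IsQuadraticMod (2 ^ (k + 1)) φ) :
    ∃ s, IsQuadraticMod 8 s ∧ ∀ n, n.Coprime 2 → φ n = s n := by
  have hcop : ∀ n : ℕ, n.Coprime 2 → n.Coprime (2 ^ (k + 1)) := fun n hn ↦ hn.pow_right _
  have h8 : ∀ n : ℕ, n.Coprime 8 → n.Coprime 2 := fun n hn ↦
    Nat.Coprime.coprime_dvd_right (by norm_num) hn
  have hmod : ∀ n : ℕ, n.Coprime 2 → (n % 8).Coprime 2 := fun n hn ↦ by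
    rw [Nat.coprime_two_right] at hn ⊢
    rw [Nat.odd_iff] at hn ⊢
    omega
  have hone : ∀ u : ℕ, u ≡ 1 [MOD 8] → φ u = 1 := fun u hu ↦ by
    obtain ⟨x, hx⟩ := exists_sq_modEq_two_pow hu (k + 1)
    have hu2 : u.Coprime 2 := by
      rw [Nat.coprime_two_right, Nat.odd_iff]
      have : u % 8 = 1 % 8 := hu
      omega
    have hx2 : x.Coprime (2 ^ (k + 1)) := by
      have : (x ^ 2).Coprime (2 ^ (k + 1)) := by
        rw [Nat.Coprime, hx.gcd_eq]; exact hcop u hu2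
      exact (Nat.coprime_pow_left_iff (by norm_num) _ _).mp this
    rw [← h.congr _ _ hx, sq, h.map_mul _ _ hx2 hx2, h.mul_self _ hx2]
  have hodd : ∀ a b : ℕ, a.Coprime 2 → b.Coprime 2 → a ≡ b [MOD 8] → φ a = φ b := by
    intro a b ha hb hab
    refine h.eq_of_mul_eq_one (hcop a ha) (hcop b hb) (hone _ ?_)
    refine (hab.mul_right b).trans ?_
    rw [Nat.coprime_two_right, Nat.odd_iff] at hb
    have : b % 8 = 1 ∨ b % 8 = 3 ∨ b % 8 = 5 ∨ b % 8 = 7 := by omega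
    rw [Nat.ModEq, Nat.mul_mod]
    rcases this with h | h | h | h <;> rw [h]
  have hval : ∀ n : ℕ, n.Coprime 2 → φ n = φ (n % 8) := fun n hn ↦
    hodd _ _ hn (hmod n hn) (Nat.mod_modEq n 8).symm
  refine ⟨fun n ↦ φ (n % 8), ⟨fun a b hab ↦ ?_, fun a b ha hb ↦ ?_, fun a ha ↦ ?_⟩, hval⟩
  · exact congrArg φ hab
  · rw [← hval _ ((h8 a ha).mul_left (h8 b hb)), ← hval a (h8 a ha), ← hval b (h8 b hb)]
    exact h.map_mul _ _ (hcop _ (h8 a ha)) (hcop _ (h8 b hb))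
  · rw [← hval a (h8 a ha)]
    exact h.mul_self _ (hcop _ (h8 a ha))

lemma const_one (q : ℕ) : IsQuadraticMod q fun _ ↦ 1 :=
  ⟨fun _ _ _ ↦ rfl, fun _ _ _ _ ↦ (one_mul 1).symm, fun _ _ ↦ one_mul 1⟩

theorem exists_jacobiSym (hq : q ≠ 0) (h : IsQuadraticMod q φ) :
    ∃ N : ℕ, Squarefree N ∧ Odd N ∧ N ∣ q ∧ ∃ s, IsQuadraticMod 8 s ∧
      ∀ n : ℕ, n.Coprime (2 * q) → φ n = s n * (J(n | N) : ℂ) := by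
  induction q using Nat.recOnPosPrimePosCoprime generalizing φ with
  | zero => exact absurd rfl hq
  | one =>
    refine ⟨1, squarefree_one, odd_one, dvd_rfl, _, const_one 8, fun n hn ↦ ?_⟩
    have h1 := h.congr n 1 (Nat.modEq_one)
    have h2 := h.map_mul 1 1 (by simp) (by simp)
    have h3 := h.mul_self 1 (by simp)
    rw [h1]
    simp only [jacobiSym.one_right, Int.cast_one, mul_one]
    rw [← h3, ← h2]
  | prime_pow p k hp hk =>
    obtain ⟨k, rfl⟩ := Nat.exists_eq_add_one_of_ne_zero hk.ne'
    rcases eq_or_ne p 2 with rfl | hp2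
    · obtain ⟨s, hs, hs'⟩ := h.exists_of_two_pow
      refine ⟨1, squarefree_one, odd_one, one_dvd _, s, hs, fun n hn ↦ ?_⟩
      simpa using hs' n (Nat.Coprime.coprime_mul_right_right hn)
    · obtain ⟨N, hN, hN'⟩ := h.exists_of_odd_prime_pow hp hp2
      refine ⟨N, hp.squarefree.squarefree_of_dvd hN, (hp.odd_of_ne_two hp2).of_dvd_nat hN,
        hN.trans (dvd_pow_self p (by omega)), _, const_one 8, fun n hn ↦ ?_⟩
      rw [one_mul]
      exact hN' n (Nat.Coprime.coprime_dvd_right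
        ((dvd_pow_self p (by omega)).trans (dvd_mul_left _ 2)) hn)
  | coprime a b ha hb hab iha ihb =>
    obtain ⟨φ₁, φ₂, h₁, h₂, hφ⟩ := h.exists_split hab
    obtain ⟨N₁, hsq₁, ho₁, hd₁, s₁, hs₁, e₁⟩ := iha (by omega) h₁
    obtain ⟨N₂, hsq₂, ho₂, hd₂, s₂, hs₂, e₂⟩ := ihb (by omega) h₂
    have hcop : N₁.Coprime N₂ := Nat.Coprime.of_dvd hd₁ hd₂ hab
    refine ⟨N₁ * N₂, (Nat.squarefree_mul hcop).mpr ⟨hsq₁, hsq₂⟩, ho₁.mul ho₂, mul_dvd_mul hd₁ hd₂,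
      _, hs₁.mul hs₂, fun n hn ↦ ?_⟩
    have : NeZero N₁ := ⟨hsq₁.ne_zero⟩
    have : NeZero N₂ := ⟨hsq₂.ne_zero⟩
    rw [hφ n (Nat.Coprime.coprime_mul_left_right hn),
      e₁ n (Nat.Coprime.coprime_dvd_right (mul_dvd_mul_left 2 (dvd_mul_right a b)) hn),
      e₂ n (Nat.Coprime.coprime_dvd_right (mul_dvd_mul_left 2 (dvd_mul_left b a)) hn),
      jacobiSym.mul_right]
    push_cast
    ring

end IsQuadraticMod

end QuadraticStructure

section QuadraticCharacter

open NumberTheorySymbols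

namespace IsQuadraticMod

/-- The completely multiplicative function, supported on odd integers, which agrees with a
quadratic character modulo `8` there. -/
noncomputable def toMonoidWithZeroHom {s : ℕ → ℂ} (h : IsQuadraticMod 8 s) : ℕ →*₀ ℂ where
  toFun n := if Odd n then s n else 0
  map_zero' := by simp
  map_one' := by
    have h2 := h.map_mul 1 1 (by simp) (by simp)
    have h3 := h.mul_self 1 (by simp)
    rw [mul_one, h3] at h2
    simpa using h2
  map_mul' a b := by
    have key : ∀ n : ℕ, Odd n → n.Coprime 8 := fun n hn ↦
      (Nat.coprime_two_right.mpr hn).pow_right 3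
    by_cases ha : Odd a <;> by_cases hb : Odd b
    · simp [ha, hb, ha.mul hb, h.map_mul a b (key a ha) (key b hb)]
    all_goals simp [ha, hb, Nat.odd_mul]

lemma toMonoidWithZeroHom_apply {s : ℕ → ℂ} (h : IsQuadraticMod 8 s) {n : ℕ} (hn : Odd n) :
    h.toMonoidWithZeroHom n = s n := if_pos hn

lemma toMonoidWithZeroHom_mod {s : ℕ → ℂ} (h : IsQuadraticMod 8 s) (n : ℕ) :
    h.toMonoidWithZeroHom (n % 8) = h.toMonoidWithZeroHom n := by
  have hodd : Odd (n % 8) ↔ Odd n := by simp only [Nat.odd_iff]; omega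
  change (if Odd (n % 8) then s (n % 8) else 0) = if Odd n then s n else 0
  simp only [hodd]
  rw [h.congr _ _ (Nat.mod_modEq n 8)]

end IsQuadraticMod

/-- A completely multiplicative function whose non-zero values have square one. -/
def IsSignHom (w : ℕ →*₀ ℂ) : Prop := ∀ n, w n = 0 ∨ w n = 1 ∨ w n = -1

/-- The Jacobi symbol as a completely multiplicative function, multiplied by a completely
multiplicative function. -/
noncomputable def mulJacobi (w : ℕ →*₀ ℂ) (N : ℕ) : ℕ →*₀ ℂ where
  toFun n := w n * (J(n | N) : ℂ)
  map_zero' := by simp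
  map_one' := by simp
  map_mul' a b := by
    push_cast
    rw [jacobiSym.mul_left, map_mul]
    push_cast
    ring

lemma mulJacobi_apply (w : ℕ →*₀ ℂ) (N n : ℕ) : mulJacobi w N n = w n * (J(n | N) : ℂ) := rfl

lemma IsSignHom.norm_le {w : ℕ →*₀ ℂ} (hw : IsSignHom w) (n : ℕ) : ‖w n‖ ≤ 1 := by
  rcases hw n with h | h | h <;> simp [h]

lemma dirichletCharacter_eq_one_or_neg_one {q : ℕ} {χ : DirichletCharacter ℂ q} (hχ : χ ^ 2 = 1)
    {n : ℕ} (hn : n.Coprime q) : χ n = 1 ∨ χ n = -1 := by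
  have hu : IsUnit (n : ZMod q) := (ZMod.isUnit_iff_coprime n q).mpr hn
  rw [← mul_self_eq_one_iff, ← sq, ← MulChar.pow_apply' χ two_ne_zero, hχ, MulChar.one_apply hu]

lemma isQuadraticMod_dirichletCharacter {q : ℕ} {χ : DirichletCharacter ℂ q} (hχ : χ ^ 2 = 1) :
    IsQuadraticMod q fun n ↦ χ n where
  congr a b hab := by rw [(ZMod.natCast_eq_natCast_iff a b q).mpr hab]
  map_mul a b _ _ := by push_cast; rw [map_mul]
  mul_self a ha := by
    rcases dirichletCharacter_eq_one_or_neg_one hχ ha with h | h <;> simp [h]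

/-- Away from `2 * q`, a quadratic character modulo `q` is a character modulo `8` times a Jacobi
symbol. -/
theorem exists_eq_mulJacobi {q : ℕ} (hq : q ≠ 0) {χ : DirichletCharacter ℂ q} (hχ : χ ^ 2 = 1) :
    ∃ N : ℕ, Squarefree N ∧ Odd N ∧ N ∣ q ∧ ∃ w : ℕ →*₀ ℂ, (∀ n, w (n % 8) = w n) ∧ IsSignHom w ∧
      ∀ n : ℕ, n.Coprime (2 * q) → χ n = mulJacobi w N n := by
  obtain ⟨N, h1, h2, h3, s, hs, h⟩ := (isQuadraticMod_dirichletCharacter hχ).exists_jacobiSym hq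
  refine ⟨N, h1, h2, h3, hs.toMonoidWithZeroHom, hs.toMonoidWithZeroHom_mod, fun n ↦ ?_,
    fun n hn ↦ ?_⟩
  · by_cases hn : Odd n
    · rw [hs.toMonoidWithZeroHom_apply hn]
      exact Or.inr (hs.eq_one_or ((Nat.coprime_two_right.mpr hn).pow_right 3))
    · exact Or.inl (if_neg hn)
  · rw [mulJacobi_apply, hs.toMonoidWithZeroHom_apply]
    · exact h n hn
    · exact Nat.coprime_two_right.mp (Nat.Coprime.coprime_mul_right_right hn)

/-- A quadratic character whose conductor does not divide `m` takes the value `-1` at arbitrarily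
large primes congruent to `1` modulo `m`. -/
theorem exists_prime_gt_char_eq_neg_one {q m : ℕ} (hq : q ≠ 0) (hm : m ≠ 0)
    {χ : DirichletCharacter ℂ q} (hχ : χ ^ 2 = 1) (hcond : ¬ χ.conductor ∣ m) (B : ℕ) :
    ∃ p > B, p.Prime ∧ p ≡ 1 [MOD m] ∧ χ p = -1 := by
  have : NeZero q := ⟨hq⟩
  set d := Nat.gcd q m with hd
  have hdq : d ∣ q := Nat.gcd_dvd_left q m
  have hnot : ¬ χ.FactorsThrough d := fun h ↦ by
    exact hcond ((DirichletCharacter.conductor_dvd_of_mem_conductorSet χ h).trans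
      (Nat.gcd_dvd_right q m))
  rw [DirichletCharacter.factorsThrough_iff_ker_unitsMap hdq] at hnot
  obtain ⟨u, hu, hu'⟩ := SetLike.not_le_iff_exists.mp hnot
  have hcop : (u : ZMod q).val.Coprime q := ZMod.val_coe_unit_coprime u
  have hval : (((u : ZMod q).val : ℕ) : ZMod q) = u := ZMod.natCast_zmod_val _
  have hu1 : χ (u : ZMod q) = -1 := by
    have h1 := dirichletCharacter_eq_one_or_neg_one hχ hcop
    rw [hval] at h1
    refine h1.resolve_left fun h ↦ hu' ?_
    rw [MonoidHom.mem_ker]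
    ext
    rw [MulChar.coe_toUnitHom, h, Units.val_one]
  have hmod : (u : ZMod q).val ≡ 1 [MOD d] := by
    rw [MonoidHom.mem_ker] at hu
    have h2 := congrArg Units.val hu
    rw [ZMod.unitsMap_val, Units.val_one] at h2
    rw [← ZMod.natCast_eq_natCast_iff, Nat.cast_one, ← h2, ZMod.natCast_val]
  obtain ⟨c, hc1, hc2⟩ := (Nat.chineseRemainder' (n := q) (m := m) hmod)
  have hcq : c.Coprime q := by rw [Nat.Coprime, hc1.gcd_eq]; exact hcop
  have hcm : c.Coprime m := by rw [Nat.Coprime, hc2.gcd_eq]; simp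
  obtain ⟨p, hp, hpp, hpm⟩ := Nat.forall_exists_prime_gt_and_modEq B (mul_ne_zero hq hm)
    (hcq.mul_right hcm)
  refine ⟨p, hp, hpp, (Nat.ModEq.of_mul_left q hpm).trans hc2, ?_⟩
  rw [(ZMod.natCast_eq_natCast_iff p _ q).mpr ((Nat.ModEq.of_mul_right m hpm).trans hc1), hval, hu1]

end QuadraticCharacter

section PeriodicSums

open Filter NumberTheorySymbols

lemma sum_range_eq_zero_of_periodic {θ : ℕ →*₀ ℂ} {R : ℕ} (hR : R ≠ 0) (hper : ∀ n, θ (n % R) = θ n)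
    {u : ℕ} (hu : u.Coprime R) (hu1 : θ u ≠ 1) : ∑ n ∈ Finset.range R, θ n = 0 := by
  have h1 : ∑ n ∈ Finset.range R, θ (u * n) = ∑ n ∈ Finset.range R, θ n := by
    refine Finset.sum_bij (fun n _ ↦ u * n % R) ?_ ?_ ?_ ?_
    · intro n _
      exact Finset.mem_range.mpr (Nat.mod_lt _ (Nat.pos_of_ne_zero hR))
    · intro a ha b hb hab
      have h : a ≡ b [MOD R] := Nat.ModEq.cancel_left_of_coprime hu.symm hab
      exact h.eq_of_lt_of_lt (Finset.mem_range.mp ha) (Finset.mem_range.mp hb)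
    · intro b hb
      obtain ⟨x, hx, hxb⟩ := exists_mul_modEq hR hu (b : ℤ)
      refine ⟨x, Finset.mem_range.mpr hx, ?_⟩
      have : u * x ≡ b [MOD R] := by
        rw [← Int.natCast_modEq_iff]
        exact_mod_cast hxb
      exact Eq.trans this (Nat.mod_eq_of_lt (Finset.mem_range.mp hb))
    · intro n _
      rw [hper]
  simp_rw [map_mul, ← Finset.mul_sum] at h1
  have h2 : (θ u - 1) * ∑ n ∈ Finset.range R, θ n = 0 := by rw [sub_mul, h1]; ring
  exact (mul_eq_zero.mp h2).resolve_left (sub_ne_zero.mpr hu1)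

lemma norm_sum_range_le_of_periodic {θ : ℕ →*₀ ℂ} {R : ℕ} (hR : R ≠ 0)
    (hper : ∀ n, θ (n % R) = θ n) (hle : ∀ n, ‖θ n‖ ≤ 1) {u : ℕ} (hu : u.Coprime R)
    (hu1 : θ u ≠ 1) (z : ℕ) : ‖∑ n ∈ Finset.range z, θ n‖ ≤ R := by
  induction z using Nat.strong_induction_on with
  | _ z ih =>
    rcases lt_or_ge z R with h | h
    · refine (norm_sum_le _ _).trans ((Finset.sum_le_sum fun n _ ↦ hle n).trans ?_)
      simpa using h.le
    · obtain ⟨k, rfl⟩ := Nat.exists_eq_add_of_le h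
      rw [Finset.sum_range_add, sum_range_eq_zero_of_periodic hR hper hu hu1, zero_add]
      have : ∀ n, θ (R + n) = θ n := fun n ↦ by rw [← hper, Nat.add_mod_left, hper]
      simp_rw [this]
      exact ih k (by omega)

lemma sum_Ioc_eq_sum_range {θ : ℕ →*₀ ℂ} (z : ℕ) :
    ∑ n ∈ Finset.Ioc 0 z, θ n = ∑ n ∈ Finset.range (z + 1), θ n := by
  induction z with
  | zero => simp
  | succ z ih => rw [Finset.sum_Ioc_succ_top (Nat.zero_le z), ih, Finset.sum_range_succ _ (z + 1)]

lemma mulJacobi_mod {w : ℕ →*₀ ℂ} {M : ℕ} (hw : ∀ n, w (n % M) = w n) (N n : ℕ) :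
    mulJacobi w N (n % (M * N)) = mulJacobi w N n := by
  have h1 : w (n % (M * N)) = w n := by rw [← hw, Nat.mod_mul_right_mod, hw]
  have h2 : J((n % (M * N) : ℕ) | N) = J(n | N) := by
    refine jacobiSym_congr ?_
    rw [Int.natCast_modEq_iff]
    exact (Nat.mod_modEq n (M * N)).of_mul_left M
  rw [mulJacobi_apply, mulJacobi_apply, h1, h2]

lemma norm_mulJacobi_le {w : ℕ →*₀ ℂ} (hle : ∀ n, ‖w n‖ ≤ 1) (N n : ℕ) :
    ‖mulJacobi w N n‖ ≤ 1 := by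
  rw [mulJacobi_apply, norm_mul]
  refine mul_le_one₀ (hle n) (norm_nonneg _) ?_
  rw [Complex.norm_intCast]
  exact abs_jacobiSym_cast_le_one n N

lemma exists_norm_sum_progression_le {w : ℕ →*₀ ℂ} {M : ℕ} (hM : 0 < M)
    (hw : ∀ n, w (n % M) = w n) (hle : ∀ n, ‖w n‖ ≤ 1) {N : ℕ} (hN : Squarefree N) (hodd : Odd N) :
    ∃ N', Squarefree N' ∧ Odd N' ∧ N' ≤ N ∧ N ≤ M * N' ∧ ∀ a L, ∃ a' : ℤ,
      ‖∑ t ∈ Finset.range L, mulJacobi w N (a + M * t)‖ ≤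
        |∑ t ∈ Finset.range L, (J(a' + t | N') : ℝ)| := by
  set e := Nat.gcd N M with he
  obtain ⟨N', hN'⟩ : e ∣ N := Nat.gcd_dvd_left N M
  have heM : e ∣ M := Nat.gcd_dvd_right N M
  have hd : N' ∣ N := ⟨e, by rw [mul_comm]; exact hN'⟩
  have hsq := hN.squarefree_of_dvd hd
  have he0 : e ≠ 0 := fun h ↦ hN.ne_zero (by rw [hN', h, zero_mul])
  have hcop : M.Coprime N' := by
    refine Nat.Coprime.symm (Nat.coprime_of_dvd fun p hp h1 h2 ↦ ?_)
    have hpe : p ∣ e := Nat.dvd_gcd (h1.trans hd) h2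
    have : p * p ∣ N := by rw [hN']; exact mul_dvd_mul hpe h1
    exact hp.not_isUnit (hN p this)
  have : NeZero e := ⟨he0⟩
  have : NeZero N' := ⟨hsq.ne_zero⟩
  refine ⟨N', hsq, hodd.of_dvd_nat hd, Nat.le_of_dvd (Nat.pos_of_ne_zero hN.ne_zero) hd, ?_,
    fun a L ↦ ?_⟩
  · conv_lhs => rw [hN']
    exact Nat.mul_le_mul_right _ (Nat.le_of_dvd hM heM)
  · obtain ⟨a', -, ha'⟩ := exists_mul_modEq hsq.ne_zero hcop (a : ℤ)
    refine ⟨a', ?_⟩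
    have hterm : ∀ t : ℕ, mulJacobi w N (a + M * t) =
        w a * ((J(a | e) : ℂ) * (J(M | N') : ℂ)) * ((J((a' : ℤ) + t | N') : ℝ) : ℂ) := by
      intro t
      have h1 : w (a + M * t) = w a := by rw [← hw, Nat.add_mul_mod_self_left, hw]
      have h2 : J((a + M * t : ℕ) | e) = J(a | e) := by
        refine jacobiSym_congr ?_
        rw [Int.natCast_modEq_iff]
        have : M * t ≡ 0 [MOD e] := (Nat.modEq_zero_iff_dvd).mpr (heM.mul_right t)
        simpa using this.add_left a
      have h3 : J((a + M * t : ℕ) | N') = J(M | N') * J((a' : ℤ) + t | N') := by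
        rw [← jacobiSym.mul_left]
        refine jacobiSym_congr ?_
        push_cast
        rw [mul_add]
        exact (ha'.symm.add_right _)
      rw [mulJacobi_apply, h1]
      conv_lhs => rw [hN', jacobiSym.mul_right, h2, h3]
      push_cast
      ring
    simp_rw [hterm, ← Finset.mul_sum, ← Complex.ofReal_sum]
    rw [norm_mul, Complex.norm_real, Real.norm_eq_abs]
    refine mul_le_of_le_one_left (abs_nonneg _) ?_
    rw [norm_mul, norm_mul, Complex.norm_intCast, Complex.norm_intCast]
    exact mul_le_one₀ (hle a) (by positivity)
      (mul_le_one₀ (abs_jacobiSym_cast_le_one a e) (abs_nonneg _)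
        (abs_jacobiSym_cast_le_one M N'))

lemma norm_sum_range_le_of_progressions {f : ℕ → ℂ} (hf : ∀ n, ‖f n‖ ≤ 1) {M : ℕ} (hM : 0 < M)
    {z : ℕ} {E : ℝ} (hE : ∀ a, ‖∑ t ∈ Finset.range (z / M), f (a + M * t)‖ ≤ E) :
    ‖∑ n ∈ Finset.range z, f n‖ ≤ M * E + M := by
  have hz : z = M * (z / M) + z % M := (Nat.div_add_mod z M).symm
  have h1 : ∀ L, ∑ n ∈ Finset.range (M * L), f n =
      ∑ a ∈ Finset.range M, ∑ t ∈ Finset.range L, f (a + M * t) := by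
    intro L
    rw [Finset.sum_comm]
    induction L with
    | zero => simp
    | succ L ih =>
      rw [mul_add, mul_one, Finset.sum_range_add, Finset.sum_range_succ, ih]
      simp [add_comm]
  conv_lhs => rw [hz]
  rw [Finset.sum_range_add, h1]
  refine (norm_add_le _ _).trans (add_le_add ?_ ?_)
  · refine (norm_sum_le _ _).trans ((Finset.sum_le_sum fun a _ ↦ hE a).trans ?_)
    simp
  · refine (norm_sum_le _ _).trans ((Finset.sum_le_sum fun n _ ↦ hf _).trans ?_)
    simpa using (Nat.mod_lt z hM).le

theorem exists_sum_mulJacobi_le {M : ℕ} (hM : 0 < M) {ε : ℝ} (hε : 0 < ε) :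
    ∃ δ : ℝ, 0 < δ ∧ ∀ᶠ q : ℕ in atTop, ∀ N : ℕ, Squarefree N → Odd N → N ≤ q →
      ∀ w : ℕ →*₀ ℂ, (∀ n, w (n % M) = w n) → (∀ n, ‖w n‖ ≤ 1) →
      (∃ u : ℕ, u.Coprime (M * N) ∧ mulJacobi w N u ≠ 1) →
      ∀ z : ℕ, (q : ℝ) ^ (1 / 4 + ε) ≤ z →
        ‖∑ n ∈ Finset.Ioc 0 z, mulJacobi w N n‖ ≤ z * (q : ℝ) ^ (-δ) := by
  obtain ⟨δ₀, hδ₀, C, hC, hB⟩ := exists_burgess (half_pos hε)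
  set δ := min (δ₀ / 16) (1 / 16) with hδ
  have hδ0 : 0 < δ := lt_min (by positivity) (by norm_num)
  have hlarge : ∀ e : ℝ, 0 < e → ∀ A : ℝ, ∀ᶠ q : ℕ in atTop, A ≤ (q : ℝ) ^ e := fun e he A ↦
    ((tendsto_rpow_atTop he).comp tendsto_natCast_atTop_atTop).eventually_ge_atTop A
  refine ⟨δ, hδ0, ?_⟩
  filter_upwards [eventually_ge_atTop 1, hlarge (1 / 16) (by norm_num) (2 * M),
    hlarge (ε / 2) (by positivity) (2 * M),
    hlarge (δ₀ / 16) (by positivity) (4 * C * (M : ℝ) ^ δ₀)] with q hq hq1 hq2 hq3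
  intro N hN hodd hNq w hw hle hu z hz
  have hq1' : (1 : ℝ) ≤ q := by exact_mod_cast hq
  have hq0 : (0 : ℝ) < q := by linarith
  have hM1 : (1 : ℝ) ≤ M := by exact_mod_cast hM
  have hM0 : (0 : ℝ) < M := by linarith
  have hpow : ∀ e : ℝ, 0 < (q : ℝ) ^ e := fun e ↦ Real.rpow_pos_of_pos hq0 e
  have hmono : ∀ {a b : ℝ}, a ≤ b → (q : ℝ) ^ a ≤ (q : ℝ) ^ b := fun h ↦
    Real.rpow_le_rpow_of_exponent_le hq1' h
  have hz1 : (1 : ℝ) ≤ z := (Real.one_le_rpow hq1' (by linarith)).trans hz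
  have hzδ : (q : ℝ) ^ (3 / 16 : ℝ) ≤ z * (q : ℝ) ^ (-δ) := by
    calc (q : ℝ) ^ (3 / 16 : ℝ) ≤ (q : ℝ) ^ (1 / 4 + ε + -δ) := hmono (by
          have := min_le_right (δ₀ / 16) (1 / 16)
          linarith)
      _ = (q : ℝ) ^ (1 / 4 + ε) * (q : ℝ) ^ (-δ) := Real.rpow_add hq0 _ _
      _ ≤ _ := by gcongr
  have h38 : (q : ℝ) ^ (3 / 16 : ℝ) = (q : ℝ) ^ (1 / 16 : ℝ) * (q : ℝ) ^ (1 / 8 : ℝ) := by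
    rw [← Real.rpow_add hq0]; norm_num
  rw [sum_Ioc_eq_sum_range]
  rcases lt_or_ge (N : ℝ) ((q : ℝ) ^ (1 / 8 : ℝ)) with hNs | hNl
  · obtain ⟨u, hu1, hu2⟩ := hu
    refine (norm_sum_range_le_of_periodic (mul_ne_zero hM.ne' hN.ne_zero) (mulJacobi_mod hw N)
      (norm_mulJacobi_le hle N) hu1 hu2 _).trans (le_trans ?_ hzδ)
    rw [h38]
    push_cast
    exact mul_le_mul (by linarith) hNs.le (Nat.cast_nonneg _) (hpow _).le
  · obtain ⟨N', hsq', hodd', hN'N, hNN', hN'⟩ := exists_norm_sum_progression_le hM hw hle hN hodd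
    set L := (z + 1) / M with hL
    have hML : (M : ℝ) * L ≤ z + 1 := by exact_mod_cast Nat.mul_div_le (z + 1) M
    have hLM : (z : ℝ) + 1 ≤ M * (L + 1) := by
      exact_mod_cast (Nat.lt_mul_div_succ (z + 1) hM).le
    have hN'0 : (0 : ℝ) < N' := by exact_mod_cast Nat.pos_of_ne_zero hsq'.ne_zero
    have hlen : (N' : ℝ) ^ (1 / 4 + ε / 2) ≤ L := by
      have h1 : (N' : ℝ) ^ (1 / 4 + ε / 2) ≤ (q : ℝ) ^ (1 / 4 + ε / 2) :=
        Real.rpow_le_rpow hN'0.le (by exact_mod_cast hN'N.trans hNq) (by linarith)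
      have h2 : (q : ℝ) ^ (1 / 4 + ε) = (q : ℝ) ^ (1 / 4 + ε / 2) * (q : ℝ) ^ (ε / 2) := by
        rw [← Real.rpow_add hq0]; ring_nf
      have h3 : (q : ℝ) ^ (1 / 4 + ε / 2) * (2 * M) ≤ z := by
        refine le_trans ?_ hz
        rw [h2]
        gcongr
      have h4 : 1 ≤ (q : ℝ) ^ (1 / 4 + ε / 2) := Real.one_le_rpow hq1' (by linarith)
      have h5 : (M : ℝ) * (2 * (q : ℝ) ^ (1 / 4 + ε / 2)) ≤ M * (L + 1) := by linarith
      have h6 := le_of_mul_le_mul_left h5 hM0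
      linarith
    have hE : ∀ a, ‖∑ t ∈ Finset.range L, mulJacobi w N (a + M * t)‖ ≤
        C * L * (N' : ℝ) ^ (-δ₀) := fun a ↦ by
      obtain ⟨a', ha'⟩ := hN' a L
      exact ha'.trans (hB N' hsq' hodd' a' L hlen)
    refine (norm_sum_range_le_of_progressions (norm_mulJacobi_le hle N) hM hE).trans ?_
    have hNpow : (N' : ℝ) ^ (-δ₀) ≤ (M : ℝ) ^ δ₀ * (q : ℝ) ^ (-(δ₀ / 8)) := by
      have h1 : (q : ℝ) ^ (1 / 8 : ℝ) / M ≤ N' := by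
        rw [div_le_iff₀' hM0]
        exact hNl.trans (by exact_mod_cast hNN')
      calc (N' : ℝ) ^ (-δ₀) ≤ ((q : ℝ) ^ (1 / 8 : ℝ) / M) ^ (-δ₀) :=
            Real.rpow_le_rpow_of_nonpos (div_pos (hpow _) hM0) h1 (by linarith)
        _ = _ := by
          rw [Real.div_rpow (hpow _).le hM0.le, ← Real.rpow_mul hq0.le, Real.rpow_neg hM0.le,
            div_inv_eq_mul, mul_comm]
          ring_nf
    have hfinal : 4 * C * (M : ℝ) ^ δ₀ * (q : ℝ) ^ (-(δ₀ / 8)) ≤ (q : ℝ) ^ (-δ) := by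
      calc 4 * C * (M : ℝ) ^ δ₀ * (q : ℝ) ^ (-(δ₀ / 8)) ≤
            (q : ℝ) ^ (δ₀ / 16) * (q : ℝ) ^ (-(δ₀ / 8)) := by gcongr
        _ = (q : ℝ) ^ (-(δ₀ / 16)) := by rw [← Real.rpow_add hq0]; ring_nf
        _ ≤ _ := hmono (neg_le_neg (min_le_left _ _))
    have hMz : 2 * (M : ℝ) ≤ z * (q : ℝ) ^ (-δ) := by
      refine le_trans (hq1.trans ?_) hzδ
      exact hmono (by norm_num)
    calc (M : ℝ) * (C * L * (N' : ℝ) ^ (-δ₀)) + M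
        = C * (M * L) * (N' : ℝ) ^ (-δ₀) + M := by ring
      _ ≤ C * (2 * z) * ((M : ℝ) ^ δ₀ * (q : ℝ) ^ (-(δ₀ / 8))) + M := by
        have : (M : ℝ) * L ≤ 2 * z := by linarith
        gcongr
      _ = z / 2 * (4 * C * (M : ℝ) ^ δ₀ * (q : ℝ) ^ (-(δ₀ / 8))) + M := by ring
      _ ≤ z / 2 * (q : ℝ) ^ (-δ) + M := by gcongr
      _ ≤ _ := by linarith

end PeriodicSums

section DirichletConvolution

open ArithmeticFunction

/-- A completely multiplicative function as an arithmetic function. -/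
noncomputable def ofHom (w : ℕ →*₀ ℂ) : ArithmeticFunction ℂ := ⟨w, map_zero w⟩

@[simp]
lemma ofHom_apply (w : ℕ →*₀ ℂ) (n : ℕ) : ofHom w n = w n := rfl

/-- Pointwise multiplication by a completely multiplicative function is an endomorphism of the
ring of arithmetic functions. -/
noncomputable def twist (w : ℕ →*₀ ℂ) : ArithmeticFunction ℂ →+* ArithmeticFunction ℂ where
  toFun f := (ofHom w).pmul f
  map_one' := by
    ext n
    rcases eq_or_ne n 1 with rfl | hn
    · simp
    · simp [one_apply_ne hn]
  map_mul' f g := by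
    ext n
    rw [pmul_apply, mul_apply, mul_apply, Finset.mul_sum]
    refine Finset.sum_congr rfl fun x hx ↦ ?_
    rw [pmul_apply, pmul_apply, ofHom_apply, ofHom_apply, ofHom_apply,
      ← (Nat.mem_divisorsAntidiagonal.mp hx).1, map_mul]
    ring
  map_zero' := by ext; simp
  map_add' f g := by
    ext n
    simp only [pmul_apply, ArithmeticFunction.add_apply, mul_add]

@[simp]
lemma twist_apply (w : ℕ →*₀ ℂ) (f : ArithmeticFunction ℂ) (n : ℕ) : twist w f n = w n * f n := rfl

/-- The derivation on arithmetic functions given by multiplication by the logarithm. -/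
noncomputable def logDer (f : ArithmeticFunction ℂ) : ArithmeticFunction ℂ :=
  ⟨fun n ↦ (Real.log n : ℂ) * f n, by simp⟩

@[simp]
lemma logDer_apply (f : ArithmeticFunction ℂ) (n : ℕ) : logDer f n = (Real.log n : ℂ) * f n := rfl

lemma logDer_mul (f g : ArithmeticFunction ℂ) : logDer (f * g) = logDer f * g + f * logDer g := by
  ext n
  simp only [logDer_apply, mul_apply, ArithmeticFunction.add_apply, Finset.mul_sum, ← Finset.sum_add_distrib]
  refine Finset.sum_congr rfl fun x hx ↦ ?_
  obtain ⟨h, hn⟩ := Nat.mem_divisorsAntidiagonal.mp hx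
  have h1 : (x.1 : ℝ) ≠ 0 := by
    rintro h0
    exact hn (by rw [← h, Nat.cast_eq_zero.mp h0, zero_mul])
  have h2 : (x.2 : ℝ) ≠ 0 := by
    rintro h0
    exact hn (by rw [← h, Nat.cast_eq_zero.mp h0, mul_zero])
  rw [← h]
  push_cast
  rw [Real.log_mul h1 h2]
  push_cast
  ring

lemma sum_norm_div_mul_le (A B : ArithmeticFunction ℂ) (x : ℕ) :
    ∑ n ∈ Finset.Ioc 0 x, ‖(A * B) n‖ / n ≤
      (∑ n ∈ Finset.Ioc 0 x, ‖A n‖ / n) * ∑ n ∈ Finset.Ioc 0 x, ‖B n‖ / n := by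
  let N : ArithmeticFunction ℂ → ArithmeticFunction ℝ := fun F ↦ ⟨fun n ↦ ‖F n‖ / n, by simp⟩
  have hN : ∀ F n, 0 ≤ N F n := fun F n ↦ div_nonneg (norm_nonneg _) (Nat.cast_nonneg _)
  have h1 : ∀ n, ‖(A * B) n‖ / n ≤ (N A * N B) n := by
    intro n
    rw [mul_apply, mul_apply]
    calc ‖∑ x ∈ n.divisorsAntidiagonal, A x.1 * B x.2‖ / n
        ≤ (∑ x ∈ n.divisorsAntidiagonal, ‖A x.1 * B x.2‖) / n := by
          gcongr
          exact norm_sum_le _ _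
      _ = _ := by
        rw [Finset.sum_div]
        refine Finset.sum_congr rfl fun x hx ↦ ?_
        rw [← (Nat.mem_divisorsAntidiagonal.mp hx).1, norm_mul, Nat.cast_mul]
        exact mul_div_mul_comm _ _ _ _
  refine (Finset.sum_le_sum fun n _ ↦ h1 n).trans ?_
  rw [sum_Ioc_mul_eq_sum_sum, Finset.sum_mul]
  refine Finset.sum_le_sum fun n _ ↦ mul_le_mul_of_nonneg_left ?_ (hN A n)
  exact Finset.sum_le_sum_of_subset_of_nonneg
    (Finset.Ioc_subset_Ioc_right (Nat.div_le_self x n)) fun i _ _ ↦ hN B i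

/-- The hyperbola identity. -/
lemma sum_Ioc_mul_eq_hyperbola (A B : ArithmeticFunction ℂ) {U x : ℕ} (hU : 0 < U) (hUx : U ≤ x) :
    ∑ n ∈ Finset.Ioc 0 x, (A * B) n =
      ∑ n ∈ Finset.Ioc 0 U, A n * ∑ k ∈ Finset.Ioc 0 (x / n), B k +
      ∑ k ∈ Finset.Ioc 0 (x / U), B k * ∑ n ∈ Finset.Ioc U (x / k), A n := by
  rw [sum_Ioc_mul_eq_sum_sum, ← Finset.sum_Ioc_consecutive _ (Nat.zero_le U) hUx]
  congr 1
  simp_rw [Finset.mul_sum]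
  rw [Finset.sum_comm' (t' := Finset.Ioc 0 (x / U)) (s' := fun k ↦ Finset.Ioc U (x / k))]
  · exact Finset.sum_congr rfl fun k _ ↦ Finset.sum_congr rfl fun n _ ↦ mul_comm _ _
  · intro n k
    simp only [Finset.mem_Ioc]
    constructor
    · rintro ⟨⟨h1, h2⟩, h3, h4⟩
      have h5 : k * n ≤ x := (Nat.le_div_iff_mul_le (by omega)).mp h4
      refine ⟨⟨h1, (Nat.le_div_iff_mul_le h3).mpr (by rwa [mul_comm])⟩, h3,
        (Nat.le_div_iff_mul_le hU).mpr ((Nat.mul_le_mul_left k h1.le).trans h5)⟩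
    · rintro ⟨⟨h1, h2⟩, h3, h4⟩
      have h5 : n * k ≤ x := (Nat.le_div_iff_mul_le h3).mp h2
      exact ⟨⟨h1, h2.trans (Nat.div_le_self _ _)⟩, h3,
        (Nat.le_div_iff_mul_le (by omega)).mpr (by rwa [mul_comm])⟩

/-- An arithmetic function with logarithmic means bounded by powers of the logarithm, and with small
partial sums from `U` on. -/
structure HasSmallSums (A : ArithmeticFunction ℂ) (U j c : ℕ) (η : ℝ) : Prop where
  sum_norm_div_le : ∀ x : ℕ, ∑ n ∈ Finset.Ioc 0 x, ‖A n‖ / n ≤ (1 + Real.log x) ^ j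
  norm_sum_le : ∀ z : ℕ, U ≤ z → ‖∑ n ∈ Finset.Ioc 0 z, A n‖ ≤ c * η * z * (1 + Real.log z) ^ j

lemma one_add_log_mono {a b : ℕ} (h : a ≤ b) : 1 + Real.log a ≤ 1 + Real.log b := by
  rcases Nat.eq_zero_or_pos a with rfl | ha
  · simpa using Real.log_natCast_nonneg b
  · have : (0 : ℝ) < a := by exact_mod_cast ha
    have h' : (a : ℝ) ≤ b := by exact_mod_cast h
    linarith [Real.log_le_log this h']

lemma one_le_one_add_log (a : ℕ) : 1 ≤ 1 + Real.log a := by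
  linarith [Real.log_natCast_nonneg a]

namespace HasSmallSums

lemma mul {A B : ArithmeticFunction ℂ} {U V i j c d : ℕ} {η : ℝ} (hη : 0 ≤ η) (hU : 0 < U)
    (hV : 0 < V) (hA : HasSmallSums A U i c η) (hB : HasSmallSums B V j d η) :
    HasSmallSums (A * B) (U * V) (i + j) (2 * c + d) η where
  sum_norm_div_le x := by
    rw [pow_add]
    have := one_le_one_add_log x
    exact (sum_norm_div_mul_le A B x).trans (mul_le_mul (hA.sum_norm_div_le x)
      (hB.sum_norm_div_le x) (Finset.sum_nonneg fun _ _ ↦ by positivity) (by positivity))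
  norm_sum_le x hx := by
    have hUx : U ≤ x := (Nat.le_mul_of_pos_right U hV).trans hx
    set ℓ := 1 + Real.log x with hℓ
    have hℓ1 : 1 ≤ ℓ := one_le_one_add_log x
    have hcast : ∀ n : ℕ, ((x / n : ℕ) : ℝ) ≤ x / n := fun n ↦ Nat.cast_div_le
    have hlog : ∀ (a k : ℕ), a ≤ x → (1 + Real.log a) ^ k ≤ ℓ ^ k := fun a k ha ↦
      pow_le_pow_left₀ (zero_le_one.trans (one_le_one_add_log a)) (one_add_log_mono ha) k
    rw [sum_Ioc_mul_eq_hyperbola A B hU hUx]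
    have h1 : ‖∑ n ∈ Finset.Ioc 0 U, A n * ∑ k ∈ Finset.Ioc 0 (x / n), B k‖ ≤
        d * η * x * ℓ ^ (i + j) := by
      calc ‖∑ n ∈ Finset.Ioc 0 U, A n * ∑ k ∈ Finset.Ioc 0 (x / n), B k‖
          ≤ ∑ n ∈ Finset.Ioc 0 U, ‖A n‖ / n * (d * η * x * ℓ ^ j) := by
            refine (_root_.norm_sum_le _ _).trans (Finset.sum_le_sum fun n hn ↦ ?_)
            obtain ⟨hn0, hnU⟩ := Finset.mem_Ioc.mp hn
            have hVn : V ≤ x / n := (Nat.le_div_iff_mul_le hn0).mpr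
              ((Nat.mul_le_mul_left V hnU).trans (by rwa [mul_comm]))
            rw [norm_mul]
            have h3 := hB.norm_sum_le _ hVn
            have h4 : d * η * ((x / n : ℕ) : ℝ) * (1 + Real.log (x / n : ℕ)) ^ j ≤
                d * η * (x / n) * ℓ ^ j := by
              have := hcast n
              have := hlog _ j (Nat.div_le_self x n)
              have := one_le_one_add_log (x / n)
              gcongr
            refine (mul_le_mul_of_nonneg_left (h3.trans h4) (norm_nonneg _)).trans (le_of_eq ?_)
            ring
        _ ≤ (1 + Real.log U) ^ i * (d * η * x * ℓ ^ j) := by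
            rw [← Finset.sum_mul]
            gcongr
            exact hA.sum_norm_div_le U
        _ ≤ ℓ ^ i * (d * η * x * ℓ ^ j) := by
            gcongr ?_ * _
            exact hlog U i hUx
        _ = _ := by ring
    have h2 : ‖∑ k ∈ Finset.Ioc 0 (x / U), B k * ∑ n ∈ Finset.Ioc U (x / k), A n‖ ≤
        2 * c * η * x * ℓ ^ (i + j) := by
      calc ‖∑ k ∈ Finset.Ioc 0 (x / U), B k * ∑ n ∈ Finset.Ioc U (x / k), A n‖
          ≤ ∑ k ∈ Finset.Ioc 0 (x / U), ‖B k‖ / k * (2 * c * η * x * ℓ ^ i) := by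
            refine (_root_.norm_sum_le _ _).trans (Finset.sum_le_sum fun k hk ↦ ?_)
            obtain ⟨hk0, hkU⟩ := Finset.mem_Ioc.mp hk
            have hUk : U ≤ x / k := (Nat.le_div_iff_mul_le hk0).mpr
              (by rw [mul_comm]; exact (Nat.le_div_iff_mul_le hU).mp hkU)
            have hUk' : (U : ℝ) ≤ x / k := (Nat.cast_le.mpr hUk).trans (hcast k)
            have e1 : ∑ n ∈ Finset.Ioc U (x / k), A n =
                ∑ n ∈ Finset.Ioc 0 (x / k), A n - ∑ n ∈ Finset.Ioc 0 U, A n := by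
              rw [← Finset.sum_Ioc_consecutive _ (Nat.zero_le U) hUk]
              ring
            have h3 := hA.norm_sum_le _ hUk
            have h4 := hA.norm_sum_le _ le_rfl
            have h5 : c * η * ((x / k : ℕ) : ℝ) * (1 + Real.log (x / k : ℕ)) ^ i ≤
                c * η * (x / k) * ℓ ^ i := by
              have := hcast k
              have := hlog _ i (Nat.div_le_self x k)
              have := one_le_one_add_log (x / k)
              gcongr
            have h6 : c * η * (U : ℝ) * (1 + Real.log U) ^ i ≤ c * η * (x / k) * ℓ ^ i := by
              have := hlog _ i hUx
              have := one_le_one_add_log U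
              gcongr
            rw [norm_mul, e1]
            have h7 := norm_sub_le (∑ n ∈ Finset.Ioc 0 (x / k), A n) (∑ n ∈ Finset.Ioc 0 U, A n)
            calc ‖B k‖ * ‖∑ n ∈ Finset.Ioc 0 (x / k), A n - ∑ n ∈ Finset.Ioc 0 U, A n‖
                ≤ ‖B k‖ * (c * η * (x / k) * ℓ ^ i + c * η * (x / k) * ℓ ^ i) := by
                  gcongr
                  linarith
              _ = _ := by ring
        _ ≤ (1 + Real.log (x / U : ℕ)) ^ j * (2 * c * η * x * ℓ ^ i) := by
            rw [← Finset.sum_mul]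
            gcongr
            exact hB.sum_norm_div_le _
        _ ≤ ℓ ^ j * (2 * c * η * x * ℓ ^ i) := by
            gcongr ?_ * _
            exact hlog _ j (Nat.div_le_self x U)
        _ = _ := by ring
    refine (norm_add_le _ _).trans ((add_le_add h1 h2).trans (le_of_eq ?_))
    push_cast
    ring

lemma of_norm_le_one {A : ArithmeticFunction ℂ} (hA : ∀ n, ‖A n‖ ≤ 1) {U : ℕ} {η : ℝ} (hη : 0 ≤ η)
    (h : ∀ z : ℕ, U ≤ z → ‖∑ n ∈ Finset.Ioc 0 z, A n‖ ≤ η * z) : HasSmallSums A U 1 1 η where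
  sum_norm_div_le x := by
    rw [pow_one]
    refine le_trans ?_ (harmonic_le_one_add_log x)
    rw [harmonic_eq_sum_Icc]
    push_cast
    refine Finset.sum_le_sum fun n _ ↦ ?_
    rw [div_eq_mul_inv]
    exact mul_le_of_le_one_left (by positivity) (hA n)
  norm_sum_le z hz := by
    rw [Nat.cast_one, one_mul, pow_one]
    exact (h z hz).trans (le_mul_of_one_le_right (by positivity) (one_le_one_add_log z))

lemma prod {ι : Type*} {s : Finset ι} (hs : s.Nonempty) {A : ι → ArithmeticFunction ℂ} {U : ℕ}
    (hU : 0 < U) {η : ℝ} (hη : 0 ≤ η) (hA : ∀ i ∈ s, ∀ n, ‖A i n‖ ≤ 1)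
    (h : ∀ i ∈ s, ∀ z : ℕ, U ≤ z → ‖∑ n ∈ Finset.Ioc 0 z, A i n‖ ≤ η * z) :
    HasSmallSums (∏ i ∈ s, A i) (U ^ s.card) s.card (2 * s.card) η := by
  classical
  induction hs using Finset.Nonempty.cons_induction with
  | singleton a =>
    have := of_norm_le_one (hA a (by simp)) hη (h a (by simp))
    simp only [Finset.prod_singleton, Finset.card_singleton, pow_one]
    refine ⟨this.sum_norm_div_le, fun z hz ↦ (this.norm_sum_le z hz).trans ?_⟩
    have := one_le_one_add_log z
    gcongr
    norm_num
  | cons a s ha hs ih =>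
    have h1 := of_norm_le_one (hA a (by simp)) hη (h a (by simp))
    have h2 := ih (fun i hi ↦ hA i (by simp [hi])) fun i hi ↦ h i (by simp [hi])
    rw [Finset.prod_cons, Finset.card_cons]
    have h3 := h1.mul hη hU (pow_pos hU _) h2
    rwa [← pow_succ', add_comm 1, ← mul_add, add_comm 1] at h3

end HasSmallSums

end DirichletConvolution

section CharacterProduct

open ArithmeticFunction ArithmeticFunction.zeta ArithmeticFunction.Moebius

/-- A Dirichlet character as a completely multiplicative function on the naturals. -/
noncomputable def charHom {m : ℕ} (ψ : DirichletCharacter ℂ m) : ℕ →*₀ ℂ where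
  toFun n := if n = 0 then 0 else ψ n
  map_zero' := if_pos rfl
  map_one' := by simp
  map_mul' a b := by
    by_cases ha : a = 0 <;> by_cases hb : b = 0 <;> simp [ha, hb]

lemma charHom_apply {m : ℕ} (ψ : DirichletCharacter ℂ m) {n : ℕ} (hn : n ≠ 0) :
    charHom ψ n = ψ n := if_neg hn

lemma norm_charHom_le {m : ℕ} (ψ : DirichletCharacter ℂ m) (n : ℕ) : ‖charHom ψ n‖ ≤ 1 := by
  rcases eq_or_ne n 0 with rfl | hn
  · simp
  · rw [charHom_apply ψ hn]
    exact ψ.norm_le_one _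

/-- The von Mangoldt function with complex values. -/
noncomputable def vonMangoldtC : ArithmeticFunction ℂ := ⟨fun n ↦ (vonMangoldt n : ℂ), by simp⟩

@[simp]
lemma vonMangoldtC_apply (n : ℕ) : vonMangoldtC n = (vonMangoldt n : ℂ) := rfl

lemma logDer_zeta : logDer (ζ : ArithmeticFunction ℂ) = (ζ : ArithmeticFunction ℂ) * vonMangoldtC := by
  ext n
  rw [mul_comm, coe_mul_zeta_apply, logDer_apply]
  simp only [vonMangoldtC_apply]
  rw [← Complex.ofReal_sum, vonMangoldt_sum]
  rcases eq_or_ne n 0 with rfl | hn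
  · simp
  · simp [natCoe_apply, zeta_apply_ne hn]

lemma ofHom_eq_twist (w : ℕ →*₀ ℂ) : ofHom w = twist w (ζ : ArithmeticFunction ℂ) := by
  ext n
  rcases eq_or_ne n 0 with rfl | hn
  · simp
  · simp [natCoe_apply, zeta_apply_ne hn]

lemma logDer_twist (w : ℕ →*₀ ℂ) (f : ArithmeticFunction ℂ) :
    logDer (twist w f) = twist w (logDer f) := by
  ext n
  simp only [logDer_apply, twist_apply]
  ring

lemma logDer_one : logDer 1 = 0 := by
  ext n
  rcases eq_or_ne n 1 with rfl | hn
  · simp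
  · simp [one_apply_ne hn]

lemma logDer_prod {ι : Type*} (s : Finset ι) (A L : ι → ArithmeticFunction ℂ)
    (h : ∀ i ∈ s, logDer (A i) = A i * L i) :
    logDer (∏ i ∈ s, A i) = (∏ i ∈ s, A i) * ∑ i ∈ s, L i := by
  classical
  induction s using Finset.induction_on with
  | empty => simp [logDer_one]
  | insert a s ha ih =>
    rw [Finset.prod_insert ha, Finset.sum_insert ha, logDer_mul, h a (by simp),
      ih fun i hi ↦ h i (by simp [hi])]
    ring

variable (m : ℕ)

/-- The Dirichlet convolution of all Dirichlet characters modulo `m`. -/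
noncomputable def charProd : ArithmeticFunction ℂ :=
  ∏ ψ : DirichletCharacter ℂ m, ofHom (charHom ψ)

/-- The Dirichlet inverse of `charProd m`. -/
noncomputable def charProdInv : ArithmeticFunction ℂ :=
  ∏ ψ : DirichletCharacter ℂ m, twist (charHom ψ) (μ : ArithmeticFunction ℂ)

/-- The function `φ(m) Λ(n)` restricted to the residue class of one modulo `m`. -/
noncomputable def charLambda : ArithmeticFunction ℂ :=
  ∑ ψ : DirichletCharacter ℂ m, twist (charHom ψ) vonMangoldtC

lemma logDer_charProd : logDer (charProd m) = charProd m * charLambda m := by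
  refine logDer_prod _ _ _ fun ψ _ ↦ ?_
  rw [ofHom_eq_twist, logDer_twist, logDer_zeta, map_mul]

lemma charProd_mul_inv : charProd m * charProdInv m = 1 := by
  rw [charProd, charProdInv, ← Finset.prod_mul_distrib]
  refine Finset.prod_eq_one fun ψ _ ↦ ?_
  rw [ofHom_eq_twist, ← map_mul, coe_zeta_mul_coe_moebius, map_one]

lemma logDer_charProdInv : logDer (charProdInv m) = -(charProdInv m * charLambda m) := by
  have h := logDer_mul (charProd m) (charProdInv m)
  rw [charProd_mul_inv, logDer_one, logDer_charProd] at h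
  have h' := charProd_mul_inv m
  linear_combination (-charProdInv m) * h -
    (logDer (charProdInv m) + charLambda m * charProdInv m) * h'

lemma isMultiplicative_charProd : (charProd m).IsMultiplicative := by
  have h : ∀ s : Finset (DirichletCharacter ℂ m),
      (∏ ψ ∈ s, ofHom (charHom ψ)).IsMultiplicative := by
    classical
    intro s
    induction s using Finset.induction_on with
    | empty => simp
    | insert a s ha ih =>
      rw [Finset.prod_insert ha]
      exact IsMultiplicative.mul
        ⟨map_one (charHom a), fun _ ↦ map_mul (charHom a) _ _⟩ ih
  exact h _

variable [NeZero m]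

lemma charLambda_apply (n : ℕ) :
    charLambda m n = if n ≡ 1 [MOD m] then ((m.totient * vonMangoldt n : ℝ) : ℂ) else 0 := by
  rcases eq_or_ne n 0 with rfl | hn
  · simp
  have h : charLambda m n =
      (∑ ψ : DirichletCharacter ℂ m, ψ (n : ZMod m)) * (vonMangoldt n : ℂ) := by
    rw [Finset.sum_mul, charLambda]
    have : ∀ s : Finset (DirichletCharacter ℂ m),
        (∑ ψ ∈ s, twist (charHom ψ) vonMangoldtC) n =
          ∑ ψ ∈ s, ψ (n : ZMod m) * (vonMangoldt n : ℂ) := by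
      intro s
      classical
      induction s using Finset.induction_on with
      | empty => simp
      | insert a s ha ih =>
        rw [Finset.sum_insert ha, Finset.sum_insert ha, ArithmeticFunction.add_apply, ih,
          twist_apply, charHom_apply _ hn, vonMangoldtC_apply]
    exact this _
  rw [h, DirichletCharacter.sum_characters_eq]
  have : ((n : ZMod m) = 1) ↔ n ≡ 1 [MOD m] := by
    rw [← ZMod.natCast_eq_natCast_iff, Nat.cast_one]
  simp only [this]
  split_ifs <;> simp

open ComplexOrder in
lemma charProd_nonneg (n : ℕ) : 0 ≤ charProd m n := by
  induction n using Nat.strong_induction_on with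
  | _ n ih =>
    rcases Nat.eq_zero_or_pos n with rfl | hn0
    · simp
    rcases Nat.lt_or_ge 1 n with hn | hn
    · have h := DFunLike.congr_fun (logDer_charProd m) n
      have hlog : 0 < Real.log n := Real.log_pos (by exact_mod_cast hn)
      have h2 : 0 ≤ (charProd m * charLambda m) n := by
        rw [mul_apply]
        refine Finset.sum_nonneg fun x hx ↦ ?_
        obtain ⟨hx1, -⟩ := Nat.mem_divisorsAntidiagonal.mp hx
        rw [charLambda_apply]
        rcases Nat.lt_or_ge x.1 n with h1 | h1
        · refine mul_nonneg (ih _ h1) ?_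
          split_ifs
          · exact Complex.zero_le_real.mpr (mul_nonneg (Nat.cast_nonneg _) vonMangoldt_nonneg)
          · exact le_rfl
        · have : x.2 = 1 := by
            rcases Nat.eq_zero_or_pos x.2 with h0 | h0
            · rw [h0] at hx1; omega
            · by_contra hne
              have : x.1 * 2 ≤ x.1 * x.2 := Nat.mul_le_mul_left _ (by omega)
              omega
          simp [this]
      rw [← h, logDer_apply] at h2
      have h3 : charProd m n = ((Real.log n)⁻¹ : ℝ) * ((Real.log n : ℂ) * charProd m n) := by
        rw [← mul_assoc, ← Complex.ofReal_mul, inv_mul_cancel₀ hlog.ne']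
        simp
      rw [h3]
      exact mul_nonneg (Complex.zero_le_real.mpr (inv_nonneg.mpr hlog.le)) h2
    · obtain rfl : n = 1 := by omega
      rw [(isMultiplicative_charProd m).map_one]
      exact zero_le_one

lemma charProd_prime {p : ℕ} (hp : p.Prime) (hpm : p ≡ 1 [MOD m]) : charProd m p = m.totient := by
  have h := DFunLike.congr_fun (logDer_charProd m) p
  have hlog : 0 < Real.log p := Real.log_pos (by exact_mod_cast hp.one_lt)
  rw [logDer_apply, mul_apply, Nat.sum_divisorsAntidiagonal
    (f := fun a b ↦ charProd m a * charLambda m b), hp.sum_divisors, Nat.div_self hp.pos,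
    Nat.div_one] at h
  simp only [charLambda_apply, (isMultiplicative_charProd m).map_one, hpm, vonMangoldt_apply_prime hp,
    vonMangoldt_apply_one, if_true] at h
  have h' : (Real.log p : ℂ) * charProd m p = (Real.log p : ℂ) * m.totient := by
    rw [h]
    have : ((if (1 : ℕ) ≡ 1 [MOD m] then (((m.totient : ℝ) * 0 : ℝ) : ℂ) else 0)) = 0 := by simp
    rw [this]
    push_cast
    ring
  exact mul_left_cancel₀ (by exact_mod_cast hlog.ne') h'

/-- The real number underlying the value of `charProd`. -/
noncomputable def charProdRe (n : ℕ) : ℝ := (charProd m n).re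

lemma charProdRe_nonneg (n : ℕ) : 0 ≤ charProdRe m n :=
  (Complex.nonneg_iff.mp (charProd_nonneg m n)).1

lemma coe_charProdRe (n : ℕ) : (charProdRe m n : ℂ) = charProd m n :=
  Complex.ext rfl (by simpa using (Complex.nonneg_iff.mp (charProd_nonneg m n)).2)

end CharacterProduct

section PowerMean

open ArithmeticFunction Filter Topology

lemma sum_Ioc_eq_sum_range_succ_sub (g : ℕ → ℂ) (x : ℕ) :
    ∑ n ∈ Finset.Ioc 0 x, g n = ∑ n ∈ Finset.range (x + 1), g n - g 0 := by
  induction x with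
  | zero => simp
  | succ x ih =>
    rw [Finset.sum_Ioc_succ_top (Nat.zero_le x), ih, Finset.sum_range_succ _ (x + 1)]
    ring

lemma exists_sum_Ioc_sub_le_of_periodic {g : ℕ → ℂ} {m : ℕ} (hm : 0 < m)
    (hg : Function.Periodic g m) :
    ∃ α : ℂ, ∃ C : ℝ, ∀ x : ℕ, ‖∑ n ∈ Finset.Ioc 0 x, g n - α * x‖ ≤ C := by
  set S := ∑ n ∈ Finset.range m, g n with hS
  have hshift : ∀ x, ∑ i ∈ Finset.range m, g (x + i) = S := by
    intro x
    induction x with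
    | zero => simp [hS]
    | succ x ih =>
      rw [← ih]
      have h1 := Finset.sum_range_succ (fun i ↦ g (x + i)) m
      have h2 := Finset.sum_range_succ' (fun i ↦ g (x + i)) m
      rw [h1] at h2
      simp only [hg x, add_zero, add_left_inj] at h2
      rw [h2]
      refine Finset.sum_congr rfl fun i _ ↦ ?_
      congr 1
      ring
  have hm' : (m : ℂ) ≠ 0 := by exact_mod_cast hm.ne'
  set E : ℕ → ℂ := fun x ↦ ∑ n ∈ Finset.range x, g n - S / m * x with hE
  have hper : Function.Periodic E m := by
    intro x
    simp only [hE]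
    rw [Finset.sum_range_add, hshift]
    push_cast
    field_simp
    ring
  refine ⟨S / m, ∑ i ∈ Finset.range m, ‖E i‖ + ‖S / m‖ + ‖g 0‖, fun x ↦ ?_⟩
  have h1 : ∑ n ∈ Finset.Ioc 0 x, g n - S / m * x = E (x + 1) + S / m - g 0 := by
    rw [sum_Ioc_eq_sum_range_succ_sub]
    simp only [hE]
    push_cast
    ring
  rw [h1, ← hper.map_mod_nat]
  refine (norm_sub_le _ _).trans (add_le_add_left ((norm_add_le _ _).trans
    (add_le_add_left ?_ _)) _)
  exact Finset.single_le_sum (f := fun i ↦ ‖E i‖) (fun _ _ ↦ norm_nonneg _)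
    (Finset.mem_range.mpr (Nat.mod_lt _ hm))

lemma norm_sum_Ioc_div_le {θ : ℕ → ℂ} {M : ℝ}
    (hθ : ∀ z : ℕ, ‖∑ n ∈ Finset.Ioc 0 z, θ n‖ ≤ M) {U V : ℕ} (hU : 0 < U) (hUV : U ≤ V) :
    ‖∑ n ∈ Finset.Ioc U V, θ n / n‖ ≤ 2 * M / U := by
  have hU0 : (0 : ℝ) < U := by exact_mod_cast hU
  have hD : ∀ V, U ≤ V → ‖∑ n ∈ Finset.Ioc U V, θ n‖ ≤ 2 * M := by
    intro V hV
    have : ∑ n ∈ Finset.Ioc U V, θ n =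
        ∑ n ∈ Finset.Ioc 0 V, θ n - ∑ n ∈ Finset.Ioc 0 U, θ n := by
      rw [← Finset.sum_Ioc_consecutive _ (Nat.zero_le U) hV]
      ring
    rw [this]
    exact (norm_sub_le _ _).trans (by linarith [hθ V, hθ U])
  have key : ‖∑ n ∈ Finset.Ioc U V, θ n / n - (∑ n ∈ Finset.Ioc U V, θ n) / V‖ ≤
      2 * M * (1 / U - 1 / V) := by
    induction V, hUV using Nat.le_induction with
    | base => simp
    | succ V hV ih =>
      have hV0 : (0 : ℝ) < V := hU0.trans_le (by exact_mod_cast hV)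
      have hVc : (V : ℂ) ≠ 0 := by exact_mod_cast hV0.ne'
      have hVc' : (V : ℂ) + 1 ≠ 0 := by exact_mod_cast (Nat.succ_ne_zero V)
      have h1 : ∑ n ∈ Finset.Ioc U (V + 1), θ n / n -
          (∑ n ∈ Finset.Ioc U (V + 1), θ n) / (V + 1 : ℕ) =
          (∑ n ∈ Finset.Ioc U V, θ n / n - (∑ n ∈ Finset.Ioc U V, θ n) / V) +
            (∑ n ∈ Finset.Ioc U V, θ n) * ((1 / V - 1 / (V + 1) : ℝ) : ℂ) := by
        rw [Finset.sum_Ioc_succ_top hV, Finset.sum_Ioc_succ_top hV]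
        push_cast
        field_simp
        ring
      have h2 : (0 : ℝ) ≤ 1 / V - 1 / (V + 1) := by
        rw [sub_nonneg]
        exact one_div_le_one_div_of_le hV0 (by linarith)
      rw [h1]
      refine (norm_add_le _ _).trans ?_
      rw [norm_mul, Complex.norm_of_nonneg h2]
      have := mul_le_mul_of_nonneg_right (hD V hV) h2
      push_cast
      linarith
  have hV0 : (0 : ℝ) < V := hU0.trans_le (by exact_mod_cast hUV)
  have h3 : ‖(∑ n ∈ Finset.Ioc U V, θ n) / (V : ℂ)‖ ≤ 2 * M / V := by
    rw [norm_div, Complex.norm_natCast]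
    exact div_le_div_of_nonneg_right (hD V hUV) hV0.le
  have h4 := norm_add_le (∑ n ∈ Finset.Ioc U V, θ n / n - (∑ n ∈ Finset.Ioc U V, θ n) / V)
    ((∑ n ∈ Finset.Ioc U V, θ n) / (V : ℂ))
  rw [sub_add_cancel] at h4
  have : 2 * M * (1 / U - 1 / V) + 2 * M / V = 2 * M / U := by ring
  linarith

lemma exists_sum_Ioc_div_sub_le {θ : ℕ → ℂ} {M : ℝ}
    (hθ : ∀ z : ℕ, ‖∑ n ∈ Finset.Ioc 0 z, θ n‖ ≤ M) :
    ∃ τ : ℂ, ∀ U : ℕ, 0 < U → ‖∑ n ∈ Finset.Ioc 0 U, θ n / n - τ‖ ≤ 2 * M / U := by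
  set s : ℕ → ℂ := fun U ↦ ∑ n ∈ Finset.Ioc 0 U, θ n / n with hs
  have hdiff : ∀ U V, 0 < U → U ≤ V → dist (s U) (s V) ≤ 2 * M / U := by
    intro U V hU hUV
    rw [dist_comm, dist_eq_norm]
    have : s V - s U = ∑ n ∈ Finset.Ioc U V, θ n / n := by
      simp only [hs]
      rw [← Finset.sum_Ioc_consecutive _ (Nat.zero_le U) hUV]
      ring
    rw [this]
    exact norm_sum_Ioc_div_le hθ hU hUV
  have hc : CauchySeq fun n ↦ s (n + 1) := by
    refine cauchySeq_of_le_tendsto_0' (fun n : ℕ ↦ 2 * M / ((n + 1 : ℕ) : ℝ))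
      (fun n k hnk ↦ hdiff _ _ n.succ_pos (by omega)) ?_
    exact (tendsto_const_div_atTop_nhds_zero_nat (2 * M)).comp (tendsto_add_atTop_nat 1)
  obtain ⟨τ, hτ⟩ := cauchySeq_tendsto_of_complete hc
  rw [tendsto_add_atTop_iff_nat (f := s) 1] at hτ
  refine ⟨τ, fun U hU ↦ ?_⟩
  have h1 : Tendsto (fun V ↦ dist (s U) (s V)) atTop (𝓝 (dist (s U) τ)) := tendsto_const_nhds.dist hτ
  rw [← dist_eq_norm]
  refine le_of_tendsto h1 ?_
  filter_upwards [eventually_ge_atTop U] with V hV using hdiff U V hU hV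

/-- A function which has a mean value with a power saving error term, and logarithmic means of
absolute values bounded by powers of the logarithm. -/
def HasPowerMean (f : ArithmeticFunction ℂ) : Prop :=
  (∃ j : ℕ, ∀ x : ℕ, ∑ n ∈ Finset.Ioc 0 x, ‖f n‖ / n ≤ (1 + Real.log x) ^ j) ∧
  ∃ κ : ℂ, ∃ δ > (0 : ℝ), δ ≤ 1 ∧ ∃ C : ℝ, 0 ≤ C ∧ ∀ x : ℕ, 0 < x →
    ‖∑ n ∈ Finset.Ioc 0 x, f n - κ * x‖ ≤ C * (x : ℝ) ^ (1 - δ)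

lemma sum_one_div_le (x : ℕ) : ∑ n ∈ Finset.Ioc 0 x, (1 : ℝ) / n ≤ 1 + Real.log x := by
  refine le_trans (le_of_eq ?_) (harmonic_le_one_add_log x)
  rw [harmonic_eq_sum_Icc]
  push_cast
  exact Finset.sum_congr rfl fun n _ ↦ one_div _

lemma exists_one_add_log_pow_le (j : ℕ) {δ : ℝ} (hδ : 0 < δ) :
    ∃ K : ℝ, 0 ≤ K ∧ ∀ x : ℕ, 0 < x → (1 + Real.log x) ^ j ≤ K * (x : ℝ) ^ δ := by
  set a := δ / (j + 1 : ℕ) with ha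
  have ha0 : 0 < a := by positivity
  refine ⟨(1 + 1 / a) ^ j, by positivity, fun x hx ↦ ?_⟩
  have hx1 : (1 : ℝ) ≤ x := by exact_mod_cast hx
  have h1 : 1 + Real.log x ≤ (1 + 1 / a) * (x : ℝ) ^ a := by
    have h2 := Real.log_le_rpow_div (by linarith : (0 : ℝ) ≤ x) ha0
    have h3 := Real.one_le_rpow hx1 ha0.le
    calc 1 + Real.log x ≤ (x : ℝ) ^ a + (x : ℝ) ^ a / a := add_le_add h3 h2
      _ = _ := by ring
  refine (pow_le_pow_left₀ (by linarith [one_le_one_add_log x]) h1 j).trans ?_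
  rw [mul_pow, ← Real.rpow_mul_natCast (by linarith)]
  gcongr
  rw [ha, div_mul_eq_mul_div, div_le_iff₀ (by positivity)]
  push_cast
  nlinarith

lemma HasPowerMean.mul {f θ : ArithmeticFunction ℂ} (hf : HasPowerMean f)
    (hle : ∀ n, ‖θ n‖ ≤ 1) {M : ℝ} (hθ : ∀ z : ℕ, ‖∑ n ∈ Finset.Ioc 0 z, θ n‖ ≤ M) :
    HasPowerMean (θ * f) := by
  obtain ⟨⟨j, hj⟩, κ, δ, hδ, hδ1, C, hC, hκ⟩ := hf
  have hM : 0 ≤ M := (norm_nonneg _).trans (hθ 0)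
  have hθj : ∀ x : ℕ, ∑ n ∈ Finset.Ioc 0 x, ‖θ n‖ / n ≤ 1 + Real.log x := fun x ↦
    (Finset.sum_le_sum fun n _ ↦ div_le_div_of_nonneg_right (hle n) (Nat.cast_nonneg _)).trans
      (sum_one_div_le x)
  obtain ⟨τ, hτ⟩ := exists_sum_Ioc_div_sub_le hθ
  obtain ⟨K, hK0, hK⟩ := exists_one_add_log_pow_le (j + 1) (δ := δ / 4) (by positivity)
  refine ⟨⟨j + 1, fun x ↦ ?_⟩, κ * τ, δ / 4, by positivity, by linarith,
    (4 * M + 4 * ‖κ‖ * M + ‖κ‖ + C) * K, by positivity, fun x hx ↦ ?_⟩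
  · rw [pow_succ']
    have := one_le_one_add_log x
    exact (sum_norm_div_mul_le θ f x).trans (mul_le_mul (hθj x) (hj x)
      (Finset.sum_nonneg fun _ _ ↦ by positivity) (by positivity))
  · set U := Nat.sqrt x with hU
    have hU0 : 0 < U := Nat.sqrt_pos.mpr hx
    have hUx : U ≤ x := Nat.sqrt_le_self x
    set ℓ := 1 + Real.log x with hℓ
    have hℓ1 : 1 ≤ ℓ := one_le_one_add_log x
    have hx0 : (0 : ℝ) < x := by exact_mod_cast hx
    have hx1 : (1 : ℝ) ≤ x := by exact_mod_cast hx
    have hU0' : (0 : ℝ) < U := by exact_mod_cast hU0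
    have hUs : (U : ℝ) ≤ (x : ℝ) ^ (1 / 2 : ℝ) := by
      rw [← Real.sqrt_eq_rpow]
      exact Real.nat_sqrt_le_real_sqrt
    have hUs' : (x : ℝ) ^ (1 / 2 : ℝ) ≤ 2 * U := by
      rw [← Real.sqrt_eq_rpow]
      have h1 : √(x : ℝ) ≤ U + 1 := Real.real_sqrt_le_nat_sqrt_succ
      have h2 : (1 : ℝ) ≤ U := by exact_mod_cast hU0
      linarith
    have hxU : (x : ℝ) / U ≤ 2 * (x : ℝ) ^ (1 / 2 : ℝ) := by
      rw [div_le_iff₀ hU0']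
      have h1 : (x : ℝ) = (x : ℝ) ^ (1 / 2 : ℝ) * (x : ℝ) ^ (1 / 2 : ℝ) := by
        rw [← Real.rpow_add hx0]; norm_num
      nlinarith [Real.rpow_nonneg hx0.le (1 / 2 : ℝ)]
    set P := (x : ℝ) ^ (1 - δ / 2) with hP
    have hhalf : (x : ℝ) ^ (1 / 2 : ℝ) ≤ P := Real.rpow_le_rpow_of_exponent_le hx1 (by linarith)
    have hcast : ∀ n : ℕ, ((x / n : ℕ) : ℝ) ≤ x / n := fun n ↦ Nat.cast_div_le
    rw [sum_Ioc_mul_eq_hyperbola θ f hU0 hUx]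
    have h2 : ‖∑ k ∈ Finset.Ioc 0 (x / U), f k * ∑ n ∈ Finset.Ioc U (x / k), θ n‖ ≤
        4 * M * P * ℓ ^ (j + 1) := by
      have hlog : (1 + Real.log (x / U : ℕ)) ^ j ≤ ℓ ^ (j + 1) :=
        (pow_le_pow_left₀ (zero_le_one.trans (one_le_one_add_log _))
          (one_add_log_mono (Nat.div_le_self x U)) j).trans (pow_le_pow_right₀ hℓ1 (by omega))
      calc ‖∑ k ∈ Finset.Ioc 0 (x / U), f k * ∑ n ∈ Finset.Ioc U (x / k), θ n‖
          ≤ ∑ k ∈ Finset.Ioc 0 (x / U), ‖f k‖ / k * (x / U) * (2 * M) := by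
            refine (norm_sum_le _ _).trans (Finset.sum_le_sum fun k hk ↦ ?_)
            obtain ⟨hk0, hkU⟩ := Finset.mem_Ioc.mp hk
            have hk0' : (0 : ℝ) < k := by exact_mod_cast hk0
            have hUk : U ≤ x / k := (Nat.le_div_iff_mul_le hk0).mpr
              (by rw [mul_comm]; exact (Nat.le_div_iff_mul_le hU0).mp hkU)
            have e1 : ∑ n ∈ Finset.Ioc U (x / k), θ n =
                ∑ n ∈ Finset.Ioc 0 (x / k), θ n - ∑ n ∈ Finset.Ioc 0 U, θ n := by
              rw [← Finset.sum_Ioc_consecutive _ (Nat.zero_le U) hUk]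
              ring
            have h7 := norm_sub_le (∑ n ∈ Finset.Ioc 0 (x / k), θ n) (∑ n ∈ Finset.Ioc 0 U, θ n)
            have h8 : (1 : ℝ) ≤ x / U / k := by
              rw [one_le_div hk0']
              exact (Nat.cast_le.mpr hkU).trans (hcast U)
            rw [norm_mul, e1]
            have h9 : ‖f k‖ / k * (x / U) = ‖f k‖ * (x / U / k) := by ring
            rw [h9]
            refine mul_le_mul ?_ (by linarith [hθ (x / k), hθ U]) (norm_nonneg _) (by positivity)
            exact le_mul_of_one_le_right (norm_nonneg _) h8
        _ ≤ ℓ ^ (j + 1) * (2 * P) * (2 * M) := by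
            rw [← Finset.sum_mul, ← Finset.sum_mul]
            gcongr
            · exact (hj _).trans hlog
            · linarith
        _ = _ := by ring
    have h1 : ‖∑ n ∈ Finset.Ioc 0 U, θ n * ∑ k ∈ Finset.Ioc 0 (x / n), f k - κ * τ * x‖ ≤
        (‖κ‖ + C + 4 * ‖κ‖ * M) * P * ℓ ^ (j + 1) := by
      have e1 : ∑ n ∈ Finset.Ioc 0 U, θ n * ∑ k ∈ Finset.Ioc 0 (x / n), f k - κ * τ * x =
          ∑ n ∈ Finset.Ioc 0 U, θ n * (∑ k ∈ Finset.Ioc 0 (x / n), f k - κ * (x / n : ℕ)) +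
          ∑ n ∈ Finset.Ioc 0 U, θ n * (κ * ((x / n : ℕ) - x / n)) +
          κ * x * (∑ n ∈ Finset.Ioc 0 U, θ n / n - τ) := by
        rw [← Finset.sum_add_distrib, mul_sub, Finset.mul_sum, ← add_sub_assoc,
          ← Finset.sum_add_distrib]
        congr 1
        · refine Finset.sum_congr rfl fun n _ ↦ ?_
          ring
        · ring
      have t3 : ‖κ * x * (∑ n ∈ Finset.Ioc 0 U, θ n / n - τ)‖ ≤ 4 * ‖κ‖ * M * P := by
        rw [norm_mul, norm_mul, Complex.norm_natCast]
        calc ‖κ‖ * x * ‖∑ n ∈ Finset.Ioc 0 U, θ n / n - τ‖ ≤ ‖κ‖ * x * (2 * M / U) := by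
              gcongr
              exact hτ U hU0
          _ = 2 * ‖κ‖ * M * (x / U) := by ring
          _ ≤ 2 * ‖κ‖ * M * (2 * P) := by
              gcongr
              linarith
          _ = _ := by ring
      have t2 : ‖∑ n ∈ Finset.Ioc 0 U, θ n * (κ * ((x / n : ℕ) - x / n))‖ ≤ ‖κ‖ * P := by
        refine (norm_sum_le_of_le (f := fun n : ℕ ↦ θ n * (κ * ((x / n : ℕ) - (x : ℂ) / n)))
          (n := fun _ ↦ ‖κ‖) _ fun n hn ↦ ?_).trans ?_
        · have hn0 : 0 < n := (Finset.mem_Ioc.mp hn).1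
          have hb : ‖((x / n : ℕ) : ℂ) - (x : ℂ) / n‖ ≤ 1 := by
            have : ((x / n : ℕ) : ℂ) - (x : ℂ) / n = (((x / n : ℕ) - (x : ℝ) / n : ℝ) : ℂ) := by
              push_cast
              rfl
            rw [this, Complex.norm_real, Real.norm_eq_abs, abs_le]
            constructor
            · have h6 : (x : ℝ) / n < ((x / n : ℕ) : ℝ) + 1 := by
                rw [div_lt_iff₀ (by exact_mod_cast hn0)]
                exact_mod_cast (by rw [mul_comm]; exact Nat.lt_mul_div_succ x hn0)
              linarith
            · linarith [hcast n]
          rw [norm_mul, norm_mul]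
          calc _ ≤ 1 * (‖κ‖ * 1) := by
                gcongr
                exact hle n
            _ = _ := by ring
        · rw [Finset.sum_const, Nat.card_Ioc, nsmul_eq_mul, tsub_zero, mul_comm]
          gcongr
          exact hUs.trans hhalf
      have t1 : ‖∑ n ∈ Finset.Ioc 0 U, θ n *
          (∑ k ∈ Finset.Ioc 0 (x / n), f k - κ * (x / n : ℕ))‖ ≤ C * P * ℓ := by
        calc _ ≤ ∑ n ∈ Finset.Ioc 0 U, (1 : ℝ) / n * (C * P) := by
              refine (norm_sum_le _ _).trans (Finset.sum_le_sum fun n hn ↦ ?_)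
              obtain ⟨hn0, hnU⟩ := Finset.mem_Ioc.mp hn
              have hn0' : (0 : ℝ) < n := by exact_mod_cast hn0
              have h5 := hκ (x / n) (Nat.div_pos (hnU.trans hUx) hn0)
              have h6 : ((x / n : ℕ) : ℝ) ^ (1 - δ) ≤ 1 / n * P := by
                calc ((x / n : ℕ) : ℝ) ^ (1 - δ) ≤ ((x : ℝ) / n) ^ (1 - δ) :=
                      Real.rpow_le_rpow (Nat.cast_nonneg _) (hcast n) (by linarith)
                  _ = 1 / n * ((n : ℝ) ^ δ * (x : ℝ) ^ (1 - δ)) := by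
                      rw [Real.div_rpow hx0.le hn0'.le, Real.rpow_sub hn0', Real.rpow_one]
                      field_simp
                  _ ≤ 1 / n * (((x : ℝ) ^ (1 / 2 : ℝ)) ^ δ * (x : ℝ) ^ (1 - δ)) := by
                      gcongr
                      exact (Nat.cast_le.mpr hnU).trans hUs
                  _ = 1 / n * P := by
                      rw [← Real.rpow_mul hx0.le, ← Real.rpow_add hx0, hP]
                      ring_nf
              rw [norm_mul]
              calc _ ≤ 1 * (C * (1 / n * P)) :=
                    mul_le_mul (hle n) (h5.trans (by gcongr)) (norm_nonneg _) zero_le_one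
                _ = _ := by ring
          _ ≤ ℓ * (C * P) := by
              rw [← Finset.sum_mul]
              gcongr
              exact (sum_one_div_le U).trans (one_add_log_mono hUx)
          _ = _ := by ring
      rw [e1]
      refine (norm_add₃_le).trans ((add_le_add_three t1 t2 t3).trans ?_)
      have hl1 : ℓ ≤ ℓ ^ (j + 1) := le_self_pow₀ hℓ1 (Nat.succ_ne_zero j)
      have hl2 : 1 ≤ ℓ ^ (j + 1) := one_le_pow₀ hℓ1
      calc _ = C * P * ℓ + (‖κ‖ + 4 * ‖κ‖ * M) * P * 1 := by ring
        _ ≤ C * P * ℓ ^ (j + 1) + (‖κ‖ + 4 * ‖κ‖ * M) * P * ℓ ^ (j + 1) := by gcongr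
        _ = _ := by ring
    have h3 : P * ℓ ^ (j + 1) ≤ K * (x : ℝ) ^ (1 - δ / 4) := by
      have e : (x : ℝ) ^ (1 - δ / 4) = P * (x : ℝ) ^ (δ / 4) := by
        rw [hP, ← Real.rpow_add hx0]; ring_nf
      rw [e]
      have := mul_le_mul_of_nonneg_left (hK x hx) (Real.rpow_nonneg hx0.le (1 - δ / 2))
      linarith
    rw [add_sub_right_comm]
    refine (norm_add_le _ _).trans ((add_le_add h1 h2).trans ?_)
    calc _ = (4 * M + 4 * ‖κ‖ * M + ‖κ‖ + C) * (P * ℓ ^ (j + 1)) := by ring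
      _ ≤ _ := by
        rw [mul_assoc _ K]
        exact mul_le_mul_of_nonneg_left h3 (by positivity)

end PowerMean

section CharacterMean

open ArithmeticFunction Filter Topology

lemma charHom_mod {m : ℕ} (hm : m ≠ 1) (ψ : DirichletCharacter ℂ m) (n : ℕ) :
    charHom ψ (n % m) = charHom ψ n := by
  have h0 : ∀ n : ℕ, charHom ψ n = ψ n := by
    intro n
    rcases eq_or_ne n 0 with rfl | hn
    · have : ¬ IsUnit ((0 : ℕ) : ZMod m) := by
        rw [ZMod.isUnit_iff_coprime]
        simpa using hm
      rw [ψ.map_nonunit this, _root_.map_zero]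
    · exact charHom_apply ψ hn
  rw [h0, h0, ZMod.natCast_mod]

lemma exists_norm_sum_charHom_le {m : ℕ} [NeZero m] {ψ : DirichletCharacter ℂ m} (hψ : ψ ≠ 1) :
    ∀ z : ℕ, ‖∑ n ∈ Finset.Ioc 0 z, ofHom (charHom ψ) n‖ ≤ m := by
  have hm : m ≠ 1 := by
    rintro rfl
    exact hψ (DirichletCharacter.level_one _)
  obtain ⟨a, ha⟩ : ∃ a : (ZMod m)ˣ, ψ a ≠ 1 := by
    by_contra! h
    exact hψ (MulChar.ext fun a ↦ by rw [h a, MulChar.one_apply_coe])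
  have hcast : (((a : ZMod m).val : ℕ) : ZMod m) = a := ZMod.natCast_zmod_val _
  have hcop : (a : ZMod m).val.Coprime m := ZMod.val_coe_unit_coprime a
  intro z
  simp only [ofHom_apply]
  rw [sum_Ioc_eq_sum_range]
  refine norm_sum_range_le_of_periodic (NeZero.ne m) (charHom_mod hm ψ) (norm_charHom_le ψ)
    hcop ?_ _
  have h0 : (a : ZMod m).val ≠ 0 := by
    intro h
    rw [h, Nat.coprime_zero_left] at hcop
    exact hm hcop
  rwa [charHom_apply ψ h0, hcast]

lemma hasPowerMean_charHom_one (m : ℕ) [NeZero m] :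
    HasPowerMean (ofHom (charHom (1 : DirichletCharacter ℂ m))) := by
  refine ⟨⟨1, fun x ↦ ?_⟩, ?_⟩
  · rw [pow_one]
    exact (Finset.sum_le_sum fun n _ ↦ div_le_div_of_nonneg_right
      (norm_charHom_le (1 : DirichletCharacter ℂ m) n) (Nat.cast_nonneg n)).trans
      (sum_one_div_le x)
  · obtain ⟨α, C, hC⟩ := exists_sum_Ioc_sub_le_of_periodic (NeZero.pos m)
      (g := fun n : ℕ ↦ (1 : DirichletCharacter ℂ m) n) (fun n ↦ by simp)
    refine ⟨α, 1, one_pos, le_rfl, C, (norm_nonneg _).trans (hC 0), fun x _ ↦ ?_⟩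
    rw [sub_self, Real.rpow_zero, mul_one]
    refine le_trans (le_of_eq ?_) (hC x)
    congr 2
    refine Finset.sum_congr rfl fun n hn ↦ ?_
    rw [ofHom_apply, charHom_apply]
    have := (Finset.mem_Ioc.mp hn).1
    omega

lemma charProd_eq_mul (m : ℕ) [NeZero m] :
    charProd m = (∏ ψ ∈ Finset.univ.erase (1 : DirichletCharacter ℂ m), ofHom (charHom ψ)) *
      ofHom (charHom (1 : DirichletCharacter ℂ m)) :=
  (Finset.prod_erase_mul _ _ (Finset.mem_univ _)).symm

lemma hasPowerMean_charProd (m : ℕ) [NeZero m] : HasPowerMean (charProd m) := by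
  classical
  have h : ∀ s : Finset (DirichletCharacter ℂ m), 1 ∉ s →
      HasPowerMean ((∏ ψ ∈ s, ofHom (charHom ψ)) *
        ofHom (charHom (1 : DirichletCharacter ℂ m))) := by
    intro s
    induction s using Finset.induction_on with
    | empty =>
      intro _
      simpa using hasPowerMean_charHom_one m
    | insert ψ s hψ ih =>
      intro h1
      rw [Finset.prod_insert hψ, mul_assoc]
      rw [Finset.mem_insert, not_or] at h1
      exact (ih h1.2).mul (norm_charHom_le ψ) (exists_norm_sum_charHom_le (Ne.symm h1.1))
  have := h _ (Finset.notMem_erase 1 Finset.univ)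
  rw [charProd_eq_mul]
  convert this

lemma LSeries_prod_charHom (m : ℕ) [NeZero m] (s : Finset (DirichletCharacter ℂ m)) {z : ℂ}
    (hz : 1 < z.re) :
    LSeriesSummable (fun n ↦ (∏ ψ ∈ s, ofHom (charHom ψ)) n) z ∧
      LSeries (fun n ↦ (∏ ψ ∈ s, ofHom (charHom ψ)) n) z =
        ∏ ψ ∈ s, DirichletCharacter.LFunction ψ z := by
  classical
  induction s using Finset.induction_on with
  | empty =>
    rw [Finset.prod_empty, Finset.prod_empty]
    have h : (fun n ↦ (1 : ArithmeticFunction ℂ) n) = LSeries.delta := one_eq_delta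
    rw [h]
    exact ⟨summable_of_ne_finset_zero (s := {1}) fun n hn ↦ by
      rw [LSeries.term_delta, if_neg (by simpa using hn)], by rw [LSeries_delta]; rfl⟩
  | insert ψ s hψ ih =>
    have hc : ∀ {n : ℕ}, n ≠ 0 → ofHom (charHom ψ) n = ψ n := fun hn ↦ charHom_apply ψ hn
    have hs : LSeriesSummable (fun n ↦ ofHom (charHom ψ) n) z :=
      (LSeriesSummable_congr z hc).mpr (ψ.LSeriesSummable_of_one_lt_re hz)
    rw [Finset.prod_insert hψ, Finset.prod_insert hψ]
    refine ⟨LSeriesSummable_mul hs ih.1, ?_⟩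
    rw [LSeries_mul' hs ih.1, ih.2, LSeries_congr hc, DirichletCharacter.LFunction_eq_LSeries ψ hz]

lemma exists_tendsto_sum_charProd (m : ℕ) [NeZero m] :
    ∃ κ : ℝ, 0 < κ ∧
      Tendsto (fun x : ℕ ↦ (∑ n ∈ Finset.Ioc 0 x, charProdRe m n) / x) atTop (𝓝 κ) := by
  obtain ⟨-, κ, δ, hδ, hδ1, C, hC, hκ⟩ := hasPowerMean_charProd m
  have hlim : Tendsto (fun x : ℕ ↦ (∑ n ∈ Finset.Ioc 0 x, charProd m n) / x) atTop (𝓝 κ) := by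
    rw [tendsto_iff_norm_sub_tendsto_zero]
    have h1 : Tendsto (fun x : ℕ ↦ C * (x : ℝ) ^ (-δ)) atTop (𝓝 0) := by
      have := ((tendsto_rpow_neg_atTop hδ).comp tendsto_natCast_atTop_atTop).const_mul C
      simpa using this
    refine squeeze_zero' (Eventually.of_forall fun _ ↦ norm_nonneg _) ?_ h1
    filter_upwards [eventually_gt_atTop 0] with x hx
    have hx0 : (0 : ℝ) < x := by exact_mod_cast hx
    have hxc : (x : ℂ) ≠ 0 := by exact_mod_cast hx.ne'
    have e : (∑ n ∈ Finset.Ioc 0 x, charProd m n) / (x : ℂ) - κ =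
        (∑ n ∈ Finset.Ioc 0 x, charProd m n - κ * x) / x := by
      field_simp
    rw [e, norm_div, Complex.norm_natCast, div_le_iff₀ hx0, mul_assoc]
    have e2 : (x : ℝ) ^ (-δ) * x = (x : ℝ) ^ (1 - δ) := by
      rw [← Real.rpow_add_one hx0.ne']
      ring_nf
    rw [e2]
    exact hκ x hx
  have hre : ∀ x : ℕ, (∑ n ∈ Finset.Ioc 0 x, charProd m n) / (x : ℂ) =
      (((∑ n ∈ Finset.Ioc 0 x, charProdRe m n) / x : ℝ) : ℂ) := by
    intro x
    push_cast
    simp_rw [coe_charProdRe]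
  simp_rw [hre] at hlim
  have hlimre : Tendsto (fun x : ℕ ↦ (∑ n ∈ Finset.Ioc 0 x, charProdRe m n) / (x : ℝ)) atTop
      (𝓝 κ.re) := by
    exact (Complex.continuous_re.tendsto κ).comp hlim
  have hκre : κ = (κ.re : ℂ) := by
    refine tendsto_nhds_unique hlim ?_
    exact (Complex.continuous_ofReal.tendsto _).comp hlimre
  have hnonneg : 0 ≤ κ.re := ge_of_tendsto' hlimre fun x ↦
    div_nonneg (Finset.sum_nonneg fun n _ ↦ charProdRe_nonneg m n) (Nat.cast_nonneg _)
  have hne : κ ≠ 0 := by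
    have h1 := LSeries_tendsto_sub_mul_nhds_one_of_tendsto_sum_div (f := fun n ↦ charProd m n)
      (l := κ) (by simp_rw [← hre] at hlim; exact hlim) fun s hs ↦
        (LSeries_prod_charHom m Finset.univ (by simpa using hs)).1
    have h2 : Tendsto (fun s : ℝ ↦ ((s : ℂ) - 1) * LSeries (fun n ↦ charProd m n) s)
        (𝓝[>] 1) (𝓝 ((∏ ψ ∈ Finset.univ.erase (1 : DirichletCharacter ℂ m),
          DirichletCharacter.LFunction ψ 1) * ∏ p ∈ m.primeFactors, (1 - (p : ℂ)⁻¹))) := by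
      have hto : Tendsto (fun s : ℝ ↦ (s : ℂ)) (𝓝[>] 1) (𝓝[≠] 1) := by
        refine tendsto_nhdsWithin_iff.mpr ⟨?_, ?_⟩
        · exact (Complex.continuous_ofReal.tendsto' 1 1 (by simp)).mono_left nhdsWithin_le_nhds
        · filter_upwards [self_mem_nhdsWithin] with s hs
          simp only [Set.mem_compl_iff, Set.mem_singleton_iff]
          exact_mod_cast (ne_of_gt hs)
      have hA : Tendsto (fun s : ℝ ↦ ∏ ψ ∈ Finset.univ.erase (1 : DirichletCharacter ℂ m),
          DirichletCharacter.LFunction ψ (s : ℂ)) (𝓝[>] 1)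
          (𝓝 (∏ ψ ∈ Finset.univ.erase (1 : DirichletCharacter ℂ m),
            DirichletCharacter.LFunction ψ 1)) := by
        refine tendsto_finsetProd _ fun ψ hψ ↦ ?_
        have := (DirichletCharacter.differentiable_LFunction
          (Finset.ne_of_mem_erase hψ)).continuous.tendsto 1
        exact this.comp (hto.mono_right nhdsWithin_le_nhds)
      refine (hA.mul ((DirichletCharacter.LFunctionTrivChar_residue_one (N := m)).comp hto)).congr' ?_
      filter_upwards [self_mem_nhdsWithin] with s hs
      have h3 := (LSeries_prod_charHom m Finset.univ (z := s) (by simpa using hs)).2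
      rw [← charProd] at h3
      rw [h3, ← Finset.prod_erase_mul _ _ (Finset.mem_univ (1 : DirichletCharacter ℂ m))]
      simp only [Function.comp_apply]
      rw [DirichletCharacter.LFunctionTrivChar]
      ring
    rw [tendsto_nhds_unique h1 h2]
    refine mul_ne_zero (Finset.prod_ne_zero_iff.mpr fun ψ hψ ↦
      DirichletCharacter.LFunction_apply_one_ne_zero (Finset.ne_of_mem_erase hψ))
      (Finset.prod_ne_zero_iff.mpr fun p hp ↦ ?_)
    have hp1 : (p : ℂ) ≠ 1 := by exact_mod_cast (Nat.prime_of_mem_primeFactors hp).ne_one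
    intro h
    rw [sub_eq_zero, eq_comm, inv_eq_one] at h
    exact hp1 h
  refine ⟨κ.re, lt_of_le_of_ne hnonneg fun h ↦ hne ?_, hlimre⟩
  rw [hκre, ← h, Complex.ofReal_zero]

end CharacterMean

section Mertens

open ArithmeticFunction Filter Topology

/-- Over a short logarithmic range `(x ^ (1 / v), x]`. -/
lemma eventually_sum_div_log_le_of_tendsto {a : ℕ → ℝ} (ha : ∀ n, 0 ≤ a n)
    (hM : Tendsto (fun x : ℝ ↦ (∑ d ∈ Finset.Ioc 0 ⌊x⌋₊, a d) / Real.log x) atTop (𝓝 1))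
    {v : ℝ} (hv : 1 < v) {ε : ℝ} (hε : 0 < ε) :
    ∀ᶠ x : ℝ in atTop, ∑ d ∈ Finset.Ioc ⌊x ^ (1 / v)⌋₊ ⌊x⌋₊, a d / Real.log d ≤ v - 1 + ε := by
  have hv0 : 0 < v := by linarith
  have hpow : Tendsto (fun x : ℝ ↦ x ^ (1 / v)) atTop atTop := tendsto_rpow_atTop (by positivity)
  have h1 : Tendsto (fun x : ℝ ↦ v * ((∑ d ∈ Finset.Ioc 0 ⌊x⌋₊, a d) / Real.log x) -
      (∑ d ∈ Finset.Ioc 0 ⌊x ^ (1 / v)⌋₊, a d) / Real.log (x ^ (1 / v))) atTop (𝓝 (v * 1 - 1)) :=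
    (hM.const_mul v).sub (hM.comp hpow)
  filter_upwards [h1.eventually_lt_const (show v * 1 - 1 < v - 1 + ε by linarith),
    hpow.eventually_gt_atTop 1, eventually_gt_atTop 1] with x hx hx1 hx2
  refine le_trans ?_ hx.le
  have hx0 : 0 < x := by linarith
  have hlog : 0 < Real.log (x ^ (1 / v)) := Real.log_pos hx1
  have hlogx : Real.log x = v * Real.log (x ^ (1 / v)) := by
    rw [Real.log_rpow hx0]
    field_simp
  have hle : x ^ (1 / v) ≤ x := by
    conv_rhs => rw [← Real.rpow_one x]
    exact Real.rpow_le_rpow_of_exponent_le hx2.le (by rw [div_le_one hv0]; exact hv.le)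
  have e : v * ((∑ d ∈ Finset.Ioc 0 ⌊x⌋₊, a d) / Real.log x) -
      (∑ d ∈ Finset.Ioc 0 ⌊x ^ (1 / v)⌋₊, a d) / Real.log (x ^ (1 / v)) =
      ∑ d ∈ Finset.Ioc ⌊x ^ (1 / v)⌋₊ ⌊x⌋₊, a d / Real.log (x ^ (1 / v)) := by
    rw [← Finset.sum_div, ← Finset.sum_Ioc_consecutive _ (Nat.zero_le _) (Nat.floor_le_floor hle),
      hlogx]
    field_simp
    ring
  rw [e]
  refine Finset.sum_le_sum fun d hd ↦ div_le_div_of_nonneg_left (ha d) hlog ?_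
  exact Real.log_le_log (by linarith) ((Nat.floor_lt (by linarith)).mp (Finset.mem_Ioc.mp hd).1).le

lemma eventually_sum_div_log_le_mul {a : ℕ → ℝ} (ha : ∀ n, 0 ≤ a n)
    (hM : Tendsto (fun x : ℝ ↦ (∑ d ∈ Finset.Ioc 0 ⌊x⌋₊, a d) / Real.log x) atTop (𝓝 1))
    {v : ℝ} (hv : 1 < v) (n : ℕ) : ∀ {ε : ℝ}, 0 < ε →
    ∀ᶠ x : ℝ in atTop, ∑ d ∈ Finset.Ioc ⌊x ^ (1 / v ^ n)⌋₊ ⌊x⌋₊, a d / Real.log d ≤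
      n * (v - 1) + ε := by
  have hv0 : 0 < v := by linarith
  induction n with
  | zero =>
    intro ε hε
    filter_upwards with x
    simpa using hε.le
  | succ n ih =>
    intro ε hε
    have hpow : Tendsto (fun x : ℝ ↦ x ^ (1 / v ^ n)) atTop atTop :=
      tendsto_rpow_atTop (by positivity)
    filter_upwards [ih (half_pos hε),
      hpow.eventually (eventually_sum_div_log_le_of_tendsto ha hM hv (half_pos hε)),
      eventually_gt_atTop 1] with x h1 h2 hx1
    have hx0 : 0 < x := by linarith
    rw [← Real.rpow_mul hx0.le] at h2
    have e : 1 / v ^ n * (1 / v) = 1 / v ^ (n + 1) := by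
      rw [pow_succ]
      field_simp
    rw [e] at h2
    have hp : 1 ≤ v ^ n := one_le_pow₀ hv.le
    have hp' : v ^ n ≤ v ^ (n + 1) := pow_le_pow_right₀ hv.le (by omega)
    rw [← Finset.sum_Ioc_consecutive _
      (Nat.floor_le_floor (Real.rpow_le_rpow_of_exponent_le hx1.le
        (one_div_le_one_div_of_le (by positivity) hp')) :
        ⌊x ^ (1 / v ^ (n + 1))⌋₊ ≤ ⌊x ^ (1 / v ^ n)⌋₊)
      (Nat.floor_le_floor (by
        conv_rhs => rw [← Real.rpow_one x]
        exact Real.rpow_le_rpow_of_exponent_le hx1.le (by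
          rw [div_le_one (by positivity)]; exact hp)))]
    push_cast
    linarith

/-- If `∑_{d ≤ x} a(d) ∼ log x`, then `∑_{x ^ (1 / u) < d ≤ x} a(d) / log d` is asymptotically at
most `log u`. -/
lemma eventually_sum_div_log_le {a : ℕ → ℝ} (ha : ∀ n, 0 ≤ a n)
    (hM : Tendsto (fun x : ℝ ↦ (∑ d ∈ Finset.Ioc 0 ⌊x⌋₊, a d) / Real.log x) atTop (𝓝 1))
    {u : ℝ} (hu : 1 < u) {ε : ℝ} (hε : 0 < ε) :
    ∀ᶠ x : ℝ in atTop, ∑ d ∈ Finset.Ioc ⌊x ^ (1 / u)⌋₊ ⌊x⌋₊, a d / Real.log d ≤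
      Real.log u + ε := by
  have hl : 0 < Real.log u := Real.log_pos hu
  obtain ⟨n, hn⟩ := exists_nat_gt (max (Real.log u) (2 * Real.log u ^ 2 / ε))
  have hn1 : Real.log u < n := (le_max_left _ _).trans_lt hn
  have hn0 : (0 : ℝ) < n := hl.trans hn1
  have hn2 : 2 * Real.log u ^ 2 < n * ε := by
    rw [← div_lt_iff₀ hε]
    exact (le_max_right _ _).trans_lt hn
  set s := Real.log u / n with hs
  have hs0 : 0 < s := by positivity
  have hs1 : s ≤ 1 := by rw [hs, div_le_one hn0]; exact hn1.le
  have hv : 1 < Real.exp s := Real.one_lt_exp_iff.mpr hs0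
  have hvn : Real.exp s ^ n = u := by
    rw [← Real.exp_nat_mul, hs, mul_div_cancel₀ _ hn0.ne', Real.exp_log (by linarith)]
  have hbound : n * (Real.exp s - 1) ≤ Real.log u + ε / 2 := by
    have h1 := Real.abs_exp_sub_one_sub_id_le (x := s) (by rwa [abs_of_pos hs0])
    have h2 : Real.exp s - 1 ≤ s + s ^ 2 := by linarith [(abs_le.mp h1).2]
    have h3 : n * s = Real.log u := by rw [hs, mul_div_cancel₀ _ hn0.ne']
    have h4 : n * s ^ 2 ≤ ε / 2 := by
      rw [hs, div_pow, mul_div_assoc', div_le_iff₀ (by positivity)]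
      nlinarith
    nlinarith
  filter_upwards [eventually_sum_div_log_le_mul ha hM hv n (half_pos hε)] with x hx
  rw [hvn] at hx
  linarith

end Mertens

section Mertens

open ArithmeticFunction Filter Topology

lemma exists_sum_le_mul_of_tendsto {f : ℕ → ℝ} {κ : ℝ}
    (hF : Tendsto (fun x : ℕ ↦ (∑ n ∈ Finset.Ioc 0 x, f n) / x) atTop (𝓝 κ)) :
    ∃ C : ℝ, 0 ≤ C ∧ ∀ x : ℕ, ∑ n ∈ Finset.Ioc 0 x, f n ≤ C * x := by
  obtain ⟨C, hC⟩ := hF.bddAbove_range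
  refine ⟨max C 0, le_max_right _ _, fun x ↦ ?_⟩
  rcases Nat.eq_zero_or_pos x with rfl | hx
  · simp
  · have hx0 : (0 : ℝ) < x := by exact_mod_cast hx
    rw [← div_le_iff₀ hx0]
    exact (hC ⟨x, rfl⟩).trans (le_max_left _ _)

lemma exists_sum_mem_of_tendsto {f : ℕ → ℝ} {κ : ℝ} (hκ : 0 < κ)
    (hF : Tendsto (fun x : ℕ ↦ (∑ n ∈ Finset.Ioc 0 x, f n) / x) atTop (𝓝 κ))
    {η : ℝ} (hη : 0 < η) : ∀ᶠ x : ℕ in atTop, κ * (1 - η) * x ≤ ∑ n ∈ Finset.Ioc 0 x, f n ∧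
      ∑ n ∈ Finset.Ioc 0 x, f n ≤ κ * (1 + η) * x := by
  filter_upwards [hF.eventually_lt_const (show κ < κ * (1 + η) by nlinarith),
    hF.eventually_const_lt (show κ * (1 - η) < κ by nlinarith), eventually_gt_atTop 0]
    with x h1 h2 hx
  have hx0 : (0 : ℝ) < x := by exact_mod_cast hx
  exact ⟨((lt_div_iff₀ hx0).mp h2).le, ((div_lt_iff₀ hx0).mp h1).le⟩

/-- Suppose `f` is nonnegative with a positive mean value, and `f log = L * f` with `L` nonnegative
and of bounded mean. Then `∑_{d ≤ N} L(d) / d ∼ log N`. -/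
lemma tendsto_sum_div_log {f L : ArithmeticFunction ℝ} (hf : ∀ n, 0 ≤ f n) (hL : ∀ n, 0 ≤ L n)
    (hfL : ∀ n : ℕ, Real.log n * f n = (L * f) n) {κ : ℝ} (hκ : 0 < κ)
    (hF : Tendsto (fun x : ℕ ↦ (∑ n ∈ Finset.Ioc 0 x, f n) / x) atTop (𝓝 κ))
    {A : ℝ} (hA : ∀ x : ℕ, ∑ n ∈ Finset.Ioc 0 x, L n ≤ A * x) :
    Tendsto (fun N : ℕ ↦ (∑ d ∈ Finset.Ioc 0 N, L d / d) / Real.log N) atTop (𝓝 1) := by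
  obtain ⟨C, hC0, hC⟩ := exists_sum_le_mul_of_tendsto hF
  set F : ℕ → ℝ := fun x ↦ ∑ n ∈ Finset.Ioc 0 x, f n with hFdef
  set M : ℕ → ℝ := fun x ↦ ∑ d ∈ Finset.Ioc 0 x, L d / d with hMdef
  have hA0 : 0 ≤ A := by
    have := hA 1
    have h1 : 0 ≤ ∑ n ∈ Finset.Ioc 0 1, L n := Finset.sum_nonneg fun n _ ↦ hL n
    simp only [Nat.cast_one, mul_one] at this
    linarith
  have hS : ∀ N : ℕ, ∑ n ∈ Finset.Ioc 0 N, Real.log n * f n =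
      ∑ d ∈ Finset.Ioc 0 N, L d * F (N / d) := by
    intro N
    simp_rw [hfL]
    exact sum_Ioc_mul_eq_sum_sum L f N
  have hloglim : Tendsto (fun N : ℕ ↦ Real.log N) atTop atTop :=
    Real.tendsto_log_atTop.comp tendsto_natCast_atTop_atTop
  have key : ∀ η : ℝ, 0 < η → η < 1 → ∃ B : ℝ, ∀ᶠ N : ℕ in atTop,
      (1 - η) ^ 2 * M N ≤ (1 + η) * Real.log N + B ∧
      (1 - η - (1 + η) * η) * Real.log N ≤ (1 + η) * M N + B := by
    intro η hη hη1
    obtain ⟨T₀, hT₀⟩ := eventually_atTop.mp (exists_sum_mem_of_tendsto hκ hF hη)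
    obtain ⟨T₁, hT₁⟩ := exists_nat_gt (1 / η)
    set T := max T₀ T₁ with hT
    have hTη : 1 / η ≤ T := hT₁.le.trans (by exact_mod_cast le_max_right _ _)
    have hT0 : (0 : ℝ) < T := (by positivity : (0 : ℝ) < 1 / η).trans_le hTη
    have hT0' : 0 < T := by exact_mod_cast hT0
    have hT1 : 1 ≤ η * T := by rwa [div_le_iff₀ hη, mul_comm] at hTη
    have hFb : ∀ z, T ≤ z → κ * (1 - η) * z ≤ F z ∧ F z ≤ κ * (1 + η) * z := fun z hz ↦
      hT₀ z ((le_max_left _ _).trans hz)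
    refine ⟨max ((1 + η) * Real.log T) (C * T * A / κ), ?_⟩
    filter_upwards [eventually_ge_atTop T, eventually_gt_atTop 0] with N hNT hN
    have hN0 : (0 : ℝ) < N := by exact_mod_cast hN
    have hdle : ∀ d ∈ Finset.Ioc 0 N, T ≤ N * T / d := by
      intro d hd
      obtain ⟨hd0, hdN⟩ := Finset.mem_Ioc.mp hd
      rw [Nat.le_div_iff_mul_le hd0, mul_comm]
      exact Nat.mul_le_mul_right T hdN
    have hNNT : N ≤ N * T := Nat.le_mul_of_pos_right N hT0'
    have hcast : ∀ d : ℕ, ((N * T / d : ℕ) : ℝ) ≤ N * T / d := fun d ↦ by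
      have := Nat.cast_div_le (α := ℝ) (m := N * T) (n := d)
      push_cast at this
      exact this
    have hsplit := hS (N * T)
    rw [← Finset.sum_Ioc_consecutive (fun d ↦ L d * F (N * T / d)) (Nat.zero_le N) hNNT] at hsplit
    have hF0 : ∀ z, 0 ≤ F z := fun z ↦ Finset.sum_nonneg fun n _ ↦ hf n
    have hlogNT : Real.log ((N * T : ℕ) : ℝ) = Real.log N + Real.log T := by
      push_cast
      exact Real.log_mul hN0.ne' hT0.ne'
    constructor
    · have h1 : κ * (N * T) * ((1 - η) ^ 2 * M N) ≤
          ∑ d ∈ Finset.Ioc 0 N, L d * F (N * T / d) := by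
        simp only [hMdef, Finset.mul_sum]
        refine Finset.sum_le_sum fun d hd ↦ ?_
        obtain ⟨hd0, hdN⟩ := Finset.mem_Ioc.mp hd
        have hd0' : (0 : ℝ) < d := by exact_mod_cast hd0
        have h2 := (hFb _ (hdle d hd)).1
        have h3 : (N * T : ℝ) / d - 1 ≤ ((N * T / d : ℕ) : ℝ) := by
          rw [sub_le_iff_le_add, div_le_iff₀ hd0']
          have := (Nat.lt_mul_div_succ (N * T) hd0).le
          rw [mul_comm d] at this
          exact_mod_cast this
        have h4 : 1 ≤ η * (N * T / d) := by
          have : (T : ℝ) ≤ N * T / d := by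
            rw [le_div_iff₀ hd0', mul_comm]
            gcongr
          nlinarith
        have h5 : (1 - η) * (N * T / d) ≤ ((N * T / d : ℕ) : ℝ) := by linarith
        calc κ * (N * T) * ((1 - η) ^ 2 * (L d / d))
            = L d * (κ * (1 - η) * ((1 - η) * (N * T / d))) := by
              field_simp
          _ ≤ L d * F (N * T / d) := by
              have hη' : 0 ≤ 1 - η := by linarith
              refine mul_le_mul_of_nonneg_left (le_trans ?_ h2) (hL d)
              gcongr
      have h6 : 0 ≤ ∑ d ∈ Finset.Ioc N (N * T), L d * F (N * T / d) :=
        Finset.sum_nonneg fun d _ ↦ mul_nonneg (hL d) (hF0 _)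
      have h7 : ∑ n ∈ Finset.Ioc 0 (N * T), Real.log n * f n ≤
          Real.log ((N * T : ℕ) : ℝ) * F (N * T) := by
        simp only [hFdef, Finset.mul_sum]
        refine Finset.sum_le_sum fun n hn ↦ mul_le_mul_of_nonneg_right ?_ (hf n)
        obtain ⟨hn0, hnN⟩ := Finset.mem_Ioc.mp hn
        exact Real.log_le_log (by exact_mod_cast hn0) (by exact_mod_cast hnN)
      have h8 := (hFb (N * T) (Nat.le_mul_of_pos_left T hN)).2
      have h9 : Real.log ((N * T : ℕ) : ℝ) * F (N * T) ≤
          Real.log ((N * T : ℕ) : ℝ) * (κ * (1 + η) * (N * T : ℕ)) :=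
        mul_le_mul_of_nonneg_left h8 (Real.log_natCast_nonneg _)
      rw [hlogNT] at h7 h9
      have h10 : κ * (N * T) * ((1 - η) ^ 2 * M N) ≤
          κ * (N * T) * ((1 + η) * (Real.log N + Real.log T)) := by
        push_cast at h9
        linarith
      have h11 := le_of_mul_le_mul_left h10 (by positivity)
      have := le_max_left ((1 + η) * Real.log T) (C * T * A / κ)
      linarith
    · have h1 : ∑ d ∈ Finset.Ioc 0 N, L d * F (N * T / d) ≤
          κ * (N * T) * ((1 + η) * M N) := by
        simp only [hMdef, Finset.mul_sum]
        refine Finset.sum_le_sum fun d hd ↦ ?_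
        have h2 := (hFb _ (hdle d hd)).2
        calc L d * F (N * T / d) ≤ L d * (κ * (1 + η) * (N * T / d)) := by
              refine mul_le_mul_of_nonneg_left (h2.trans ?_) (hL d)
              gcongr
              exact hcast d
          _ = _ := by ring
      have h3 : ∑ d ∈ Finset.Ioc N (N * T), L d * F (N * T / d) ≤ C * T * (A * (N * T)) := by
        calc ∑ d ∈ Finset.Ioc N (N * T), L d * F (N * T / d)
            ≤ ∑ d ∈ Finset.Ioc N (N * T), L d * (C * T) := by
              refine Finset.sum_le_sum fun d hd ↦ mul_le_mul_of_nonneg_left ?_ (hL d)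
              refine (hC _).trans (mul_le_mul_of_nonneg_left ?_ hC0)
              have hdN := (Finset.mem_Ioc.mp hd).1
              exact_mod_cast Nat.div_le_of_le_mul (Nat.mul_le_mul_right T hdN.le)
          _ ≤ (∑ d ∈ Finset.Ioc 0 (N * T), L d) * (C * T) := by
              rw [← Finset.sum_mul]
              refine mul_le_mul_of_nonneg_right ?_ (by positivity)
              exact Finset.sum_le_sum_of_subset_of_nonneg
                (Finset.Ioc_subset_Ioc_left (Nat.zero_le N)) fun n _ _ ↦ hL n
          _ ≤ A * (N * T : ℕ) * (C * T) := by
              gcongr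
              exact hA _
          _ = _ := by push_cast; ring
      have h4 : Real.log N * (F (N * T) - F N) ≤
          ∑ n ∈ Finset.Ioc 0 (N * T), Real.log n * f n := by
        have e : F (N * T) - F N = ∑ n ∈ Finset.Ioc N (N * T), f n := by
          simp only [hFdef]
          rw [← Finset.sum_Ioc_consecutive _ (Nat.zero_le N) hNNT]
          ring
        rw [e, Finset.mul_sum, ← Finset.sum_Ioc_consecutive _ (Nat.zero_le N) hNNT]
        have h5 : 0 ≤ ∑ n ∈ Finset.Ioc 0 N, Real.log n * f n :=
          Finset.sum_nonneg fun n _ ↦ mul_nonneg (Real.log_natCast_nonneg n) (hf n)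
        have h6 : ∑ n ∈ Finset.Ioc N (N * T), Real.log N * f n ≤
            ∑ n ∈ Finset.Ioc N (N * T), Real.log n * f n := by
          refine Finset.sum_le_sum fun n hn ↦ mul_le_mul_of_nonneg_right ?_ (hf n)
          exact Real.log_le_log hN0 (by exact_mod_cast (Finset.mem_Ioc.mp hn).1.le)
        linarith
      have h7 := (hFb (N * T) (Nat.le_mul_of_pos_left T hN)).1
      have h8 := (hFb N hNT).2
      have hlogN := Real.log_natCast_nonneg N
      push_cast at h7
      have h9 : κ * (N * T) * (1 - η - (1 + η) * η) ≤ F (N * T) - F N := by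
        have : κ * (1 + η) * N * 1 ≤ κ * (1 + η) * N * (η * T) := by gcongr
        linarith
      have h10 : κ * (N * T) * ((1 - η - (1 + η) * η) * Real.log N) ≤
          κ * (N * T) * ((1 + η) * M N + C * T * A / κ) := by
        have h11 := mul_le_mul_of_nonneg_left h9 hlogN
        have h12 : κ * (N * T) * (C * T * A / κ) = C * T * (A * (N * T)) := by
          field_simp
        rw [mul_add, h12]
        linarith
      have h11 := le_of_mul_le_mul_left h10 (by positivity)
      have := le_max_right ((1 + η) * Real.log T) (C * T * A / κ)
      linarith
  rw [tendsto_order]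
  constructor
  · intro a ha
    have hcont : ContinuousAt (fun η : ℝ ↦ (1 - η - (1 + η) * η) - (1 + η) * a - η) 0 := by fun_prop
    have hev : ∀ᶠ η : ℝ in 𝓝 0, 0 < (1 - η - (1 + η) * η) - (1 + η) * a - η ∧ η < 1 :=
      (hcont.eventually_const_lt (by simpa using ha)).and (eventually_lt_nhds one_pos)
    obtain ⟨η, ⟨h1, h2⟩, h3⟩ := ((hev.filter_mono nhdsWithin_le_nhds).and
      (self_mem_nhdsWithin : ∀ᶠ η : ℝ in 𝓝[>] 0, η ∈ Set.Ioi 0)).exists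
    obtain ⟨B, hB⟩ := key η h3 h2
    have hη0 : 0 < η := h3
    filter_upwards [hB, hloglim.eventually_gt_atTop (max 0 (B / η))] with N hN hlog
    have hl0 : 0 < Real.log N := (le_max_left _ _).trans_lt hlog
    have hl1 : B < Real.log N * η := (div_lt_iff₀ hη0).mp ((le_max_right _ _).trans_lt hlog)
    rw [lt_div_iff₀ hl0]
    have h4 := mul_lt_mul_of_pos_right (sub_pos.mp (by linarith : 0 <
      (1 - η - (1 + η) * η) - ((1 + η) * a + η))) hl0
    have h5 : (1 + η) * (a * Real.log N) < (1 + η) * M N := by linarith [hN.2]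
    exact lt_of_mul_lt_mul_left h5 (by linarith)
  · intro a ha
    have hcont : ContinuousAt (fun η : ℝ ↦ (1 - η) ^ 2 * a - (1 + η) - η) 0 := by fun_prop
    have hev : ∀ᶠ η : ℝ in 𝓝 0, 0 < (1 - η) ^ 2 * a - (1 + η) - η ∧ η < 1 :=
      (hcont.eventually_const_lt (by simpa using ha)).and (eventually_lt_nhds one_pos)
    obtain ⟨η, ⟨h1, h2⟩, h3⟩ := ((hev.filter_mono nhdsWithin_le_nhds).and
      (self_mem_nhdsWithin : ∀ᶠ η : ℝ in 𝓝[>] 0, η ∈ Set.Ioi 0)).exists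
    obtain ⟨B, hB⟩ := key η h3 h2
    have hη0 : 0 < η := h3
    filter_upwards [hB, hloglim.eventually_gt_atTop (max 0 (B / η))] with N hN hlog
    have hl0 : 0 < Real.log N := (le_max_left _ _).trans_lt hlog
    have hl1 : B < Real.log N * η := (div_lt_iff₀ hη0).mp ((le_max_right _ _).trans_lt hlog)
    rw [div_lt_iff₀ hl0]
    have h4 := mul_lt_mul_of_pos_right (sub_pos.mp (by linarith : 0 <
      (1 - η) ^ 2 * a - ((1 + η) + η))) hl0
    have h5 : (1 - η) ^ 2 * M N < (1 - η) ^ 2 * (a * Real.log N) := by linarith [hN.1]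
    exact lt_of_mul_lt_mul_left h5 (sq_nonneg _)

end Mertens

section Mertens

open ArithmeticFunction Filter Topology

lemma tendsto_log_floor_div_log :
    Tendsto (fun x : ℝ ↦ Real.log ⌊x⌋₊ / Real.log x) atTop (𝓝 1) := by
  have h1 : Tendsto (fun x : ℝ ↦ Real.log ((⌊x⌋₊ : ℝ) / x)) atTop (𝓝 0) := by
    have := (Real.continuousAt_log (one_ne_zero)).tendsto.comp
      (tendsto_nat_floor_div_atTop (R := ℝ))
    rwa [Real.log_one] at this
  have h2 : Tendsto (fun x : ℝ ↦ 1 + Real.log ((⌊x⌋₊ : ℝ) / x) / Real.log x) atTop (𝓝 (1 + 0)) :=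
    tendsto_const_nhds.add (h1.div_atTop Real.tendsto_log_atTop)
  rw [add_zero] at h2
  refine h2.congr' ?_
  filter_upwards [eventually_gt_atTop 1] with x hx
  have hl := Real.log_pos hx
  have hf : (⌊x⌋₊ : ℝ) ≠ 0 := by
    have := Nat.floor_pos.mpr hx.le
    exact_mod_cast this.ne'
  rw [Real.log_div hf (by linarith)]
  field_simp
  ring

lemma tendsto_sum_floor_div_log {a : ℕ → ℝ}
    (h : Tendsto (fun N : ℕ ↦ (∑ d ∈ Finset.Ioc 0 N, a d) / Real.log N) atTop (𝓝 1)) :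
    Tendsto (fun x : ℝ ↦ (∑ d ∈ Finset.Ioc 0 ⌊x⌋₊, a d) / Real.log x) atTop (𝓝 1) := by
  have h1 := (h.comp (tendsto_nat_floor_atTop (α := ℝ))).mul tendsto_log_floor_div_log
  rw [mul_one] at h1
  refine h1.congr' ?_
  filter_upwards [eventually_ge_atTop 2] with x hx
  have hl : 0 < Real.log ⌊x⌋₊ := Real.log_pos (by
    have : 2 ≤ ⌊x⌋₊ := Nat.le_floor (by exact_mod_cast hx)
    exact_mod_cast this)
  simp only [Function.comp_apply]
  field_simp

lemma eventually_floor_rpow_le_div {v : ℝ} (hv : 1 < v) {T : ℕ} (hT : 0 < T) :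
    ∀ᶠ N : ℕ in atTop, ⌊(N : ℝ) ^ (1 / v)⌋₊ ≤ N / T := by
  have hv0 : 0 < v := by linarith
  have h1 : Tendsto (fun N : ℕ ↦ (N : ℝ) ^ (1 - 1 / v)) atTop atTop :=
    (tendsto_rpow_atTop (by rw [sub_pos, div_lt_one hv0]; exact hv)).comp tendsto_natCast_atTop_atTop
  filter_upwards [h1.eventually_ge_atTop (T : ℝ), eventually_gt_atTop 0] with N hN hN0
  have hN0' : (0 : ℝ) < N := by exact_mod_cast hN0
  rw [Nat.le_div_iff_mul_le hT]
  have h2 : (⌊(N : ℝ) ^ (1 / v)⌋₊ : ℝ) * T ≤ N := by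
    calc (⌊(N : ℝ) ^ (1 / v)⌋₊ : ℝ) * T ≤ (N : ℝ) ^ (1 / v) * (N : ℝ) ^ (1 - 1 / v) := by
          gcongr
          exact Nat.floor_le (by positivity)
      _ = N := by
          rw [← Real.rpow_add hN0']
          simp
  exact_mod_cast h2

/-- In the situation of `tendsto_sum_div_log`, an asymptotic upper bound for
`∑_{N ^ (1 / u) < d ≤ N} (L(d) / log d) F(N / d)` with `F` the summatory function of `f`. -/
lemma eventually_sum_div_log_mul_le {f L : ArithmeticFunction ℝ} (hf : ∀ n, 0 ≤ f n)
    (hL : ∀ n, 0 ≤ L n) (hfL : ∀ n : ℕ, Real.log n * f n = (L * f) n) {κ : ℝ} (hκ : 0 < κ)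
    (hF : Tendsto (fun x : ℕ ↦ (∑ n ∈ Finset.Ioc 0 x, f n) / x) atTop (𝓝 κ))
    {A : ℝ} (hA : ∀ x : ℕ, ∑ n ∈ Finset.Ioc 0 x, L n ≤ A * x) {u : ℝ} (hu : 1 < u)
    {ε : ℝ} (hε : 0 < ε) :
    ∀ᶠ N : ℕ in atTop, ∑ d ∈ Finset.Ioc ⌊(N : ℝ) ^ (1 / u)⌋₊ N,
      L d / Real.log d * ∑ n ∈ Finset.Ioc 0 (N / d), f n ≤ (κ * Real.log u + ε) * N := by
  obtain ⟨C, hC0, hC⟩ := exists_sum_le_mul_of_tendsto hF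
  set a : ℕ → ℝ := fun d ↦ L d / d with ha
  have ha0 : ∀ d, 0 ≤ a d := fun d ↦ div_nonneg (hL d) (Nat.cast_nonneg d)
  have hM := tendsto_sum_floor_div_log (a := a) (tendsto_sum_div_log hf hL hfL hκ hF hA)
  obtain ⟨η, h1, hη⟩ : ∃ η : ℝ, κ * (1 + η) * (Real.log u + η) + C * (η + η) <
      κ * Real.log u + ε ∧ 0 < η := by
    have hcont : ContinuousAt (fun η : ℝ ↦ κ * (1 + η) * (Real.log u + η) + C * (η + η)) 0 := by
      fun_prop
    have hev := hcont.eventually_lt_const (u := κ * Real.log u + ε) (by simpa using hε)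
    exact ((hev.filter_mono nhdsWithin_le_nhds).and
      (self_mem_nhdsWithin : ∀ᶠ η : ℝ in 𝓝[>] 0, η ∈ Set.Ioi 0)).exists
  obtain ⟨T₀, hT₀⟩ := eventually_atTop.mp (exists_sum_mem_of_tendsto hκ hF hη)
  set T := max T₀ 1 with hT
  have hT0 : 0 < T := lt_of_lt_of_le one_pos (le_max_right _ _)
  have hv : 1 < Real.exp η := Real.one_lt_exp_iff.mpr hη
  filter_upwards [tendsto_natCast_atTop_atTop.eventually (eventually_sum_div_log_le ha0 hM hu hη),
    tendsto_natCast_atTop_atTop.eventually (eventually_sum_div_log_le ha0 hM hv hη),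
    eventually_floor_rpow_le_div hu hT0, eventually_floor_rpow_le_div hv hT0]
    with N h2 h3 h4 h5
  rw [Nat.floor_natCast] at h2 h3
  rw [Real.log_exp] at h3
  have hterm : ∀ d : ℕ, 0 ≤ a d / Real.log d := fun d ↦
    div_nonneg (ha0 d) (Real.log_natCast_nonneg d)
  have hlarge : ∀ {B : ℝ} {d : ℕ}, 0 ≤ B → 0 < d →
      ∑ n ∈ Finset.Ioc 0 (N / d), f n ≤ B * (N / d : ℕ) →
      L d / Real.log d * ∑ n ∈ Finset.Ioc 0 (N / d), f n ≤ a d / Real.log d * (B * N) := by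
    intro B d hB hd h
    calc L d / Real.log d * ∑ n ∈ Finset.Ioc 0 (N / d), f n
        ≤ L d / Real.log d * (B * (N / d)) := by
          refine mul_le_mul_of_nonneg_left (h.trans ?_)
            (div_nonneg (hL d) (Real.log_natCast_nonneg d))
          gcongr
          exact Nat.cast_div_le
      _ = _ := by
          simp only [ha]
          ring
  have hs1 : ∑ d ∈ Finset.Ioc ⌊(N : ℝ) ^ (1 / u)⌋₊ (N / T),
      L d / Real.log d * ∑ n ∈ Finset.Ioc 0 (N / d), f n ≤ (Real.log u + η) * (κ * (1 + η) * N) := by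
    calc _ ≤ ∑ d ∈ Finset.Ioc ⌊(N : ℝ) ^ (1 / u)⌋₊ (N / T),
          a d / Real.log d * (κ * (1 + η) * N) := by
          refine Finset.sum_le_sum fun d hd ↦ ?_
          obtain ⟨hd1, hd2⟩ := Finset.mem_Ioc.mp hd
          have hd0 : 0 < d := by omega
          have hTd : T ≤ N / d := by
            rw [Nat.le_div_iff_mul_le hd0, mul_comm]
            exact (Nat.le_div_iff_mul_le hT0).mp hd2
          exact hlarge (by positivity) hd0 (hT₀ _ ((le_max_left T₀ 1).trans hTd)).2
      _ ≤ _ := by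
          rw [← Finset.sum_mul]
          refine mul_le_mul_of_nonneg_right (le_trans ?_ h2) (by positivity)
          exact Finset.sum_le_sum_of_subset_of_nonneg
            (Finset.Ioc_subset_Ioc_right (Nat.div_le_self N T)) fun d _ _ ↦ hterm d
  have hs2 : ∑ d ∈ Finset.Ioc (N / T) N,
      L d / Real.log d * ∑ n ∈ Finset.Ioc 0 (N / d), f n ≤ (η + η) * (C * N) := by
    calc _ ≤ ∑ d ∈ Finset.Ioc (N / T) N, a d / Real.log d * (C * N) := by
          refine Finset.sum_le_sum fun d hd ↦ hlarge hC0 ?_ (hC _)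
          have := (Finset.mem_Ioc.mp hd).1
          omega
      _ ≤ _ := by
          rw [← Finset.sum_mul]
          refine mul_le_mul_of_nonneg_right (le_trans ?_ h3) (by positivity)
          exact Finset.sum_le_sum_of_subset_of_nonneg
            (Finset.Ioc_subset_Ioc_left h5) fun d _ _ ↦ hterm d
  rw [← Finset.sum_Ioc_consecutive _ h4 (Nat.div_le_self N T)]
  have h6 := mul_le_mul_of_nonneg_right h1.le (Nat.cast_nonneg N : (0 : ℝ) ≤ N)
  linarith

end Mertens

section Vinogradov

open ArithmeticFunction Filter Topology

variable (m : ℕ)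

/-- `charProdRe m` as an arithmetic function. -/
noncomputable def charProdReal : ArithmeticFunction ℝ := ⟨charProdRe m, by simp [charProdRe]⟩

/-- The real form of `charLambda m`. -/
noncomputable def charLambdaReal : ArithmeticFunction ℝ :=
  ⟨fun n ↦ if n ≡ 1 [MOD m] then m.totient * vonMangoldt n else 0, by simp⟩

lemma charProdReal_apply (n : ℕ) : charProdReal m n = charProdRe m n := rfl

lemma charLambdaReal_apply (n : ℕ) :
    charLambdaReal m n = if n ≡ 1 [MOD m] then m.totient * vonMangoldt n else 0 := rfl

lemma charLambdaReal_nonneg (n : ℕ) : 0 ≤ charLambdaReal m n := by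
  rw [charLambdaReal_apply]
  split_ifs
  · exact mul_nonneg (Nat.cast_nonneg _) vonMangoldt_nonneg
  · exact le_rfl

lemma charLambdaReal_le (n : ℕ) : charLambdaReal m n ≤ m.totient * vonMangoldt n := by
  rw [charLambdaReal_apply]
  split_ifs
  · exact le_rfl
  · exact mul_nonneg (Nat.cast_nonneg _) vonMangoldt_nonneg

lemma sum_charLambdaReal_le (x : ℕ) :
    ∑ n ∈ Finset.Ioc 0 x, charLambdaReal m n ≤ m.totient * (Real.log 4 + 4) * x := by
  refine (Finset.sum_le_sum fun n _ ↦ charLambdaReal_le m n).trans ?_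
  rw [← Finset.mul_sum, mul_assoc]
  refine mul_le_mul_of_nonneg_left ?_ (Nat.cast_nonneg _)
  simpa [Chebyshev.psi] using Chebyshev.psi_le_const_mul_self (x := x) (Nat.cast_nonneg x)

variable [NeZero m]

lemma coe_charLambdaReal (n : ℕ) : (charLambdaReal m n : ℂ) = charLambda m n := by
  rw [charLambda_apply, charLambdaReal_apply]
  split_ifs <;> simp

lemma log_mul_charProdReal (n : ℕ) :
    Real.log n * charProdReal m n = (charLambdaReal m * charProdReal m) n := by
  have h := DFunLike.congr_fun (logDer_charProd m) n
  rw [mul_comm (charProd m), logDer_apply, mul_apply] at h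
  apply Complex.ofReal_injective
  rw [mul_apply]
  rw [Complex.ofReal_mul, Complex.ofReal_sum]
  simp only [Complex.ofReal_mul, charProdReal_apply, coe_charLambdaReal, coe_charProdRe]
  exact h

lemma charProdRe_prime_mul {p n : ℕ} (hp : p.Prime) (hpm : p ≡ 1 [MOD m]) (hpn : ¬ p ∣ n) :
    charProdRe m (p * n) = charLambdaReal m p / Real.log p * charProdRe m n := by
  have hlog : Real.log p ≠ 0 := (Real.log_pos (by exact_mod_cast hp.one_lt)).ne'
  apply Complex.ofReal_injective
  rw [coe_charProdRe, (isMultiplicative_charProd m).map_mul_of_coprime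
    ((Nat.Prime.coprime_iff_not_dvd hp).mpr hpn), charProd_prime m hp hpm, charLambdaReal_apply,
    if_pos hpm, vonMangoldt_apply_prime hp, mul_div_assoc, div_self hlog, mul_one]
  push_cast
  rw [coe_charProdRe]

lemma exists_prime_dvd_of_map_ne_one {w : ℕ →*₀ ℂ} {n : ℕ} (hn : n ≠ 0) (hw : w n ≠ 1) :
    ∃ p : ℕ, p.Prime ∧ p ∣ n ∧ w p ≠ 1 := by
  induction n using Nat.recOnMul with
  | zero => exact absurd rfl hn
  | one => exact absurd (map_one w) hw
  | prime p hp => exact ⟨p, hp, dvd_rfl, hw⟩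
  | mul a b iha ihb =>
    by_cases ha : w a = 1
    · have hb : w b ≠ 1 := fun hb ↦ hw (by rw [map_mul, ha, hb, one_mul])
      obtain ⟨p, h1, h2, h3⟩ := ihb (right_ne_zero_of_mul hn) hb
      exact ⟨p, h1, h2.mul_left a, h3⟩
    · obtain ⟨p, h1, h2, h3⟩ := iha (left_ne_zero_of_mul hn) ha
      exact ⟨p, h1, h2.mul_right b, h3⟩

lemma sum_biUnion_le_sum_of_nonneg {ι α : Type*} [DecidableEq α] {f : α → ℝ} (hf : ∀ a, 0 ≤ f a)
    (s : Finset ι) (t : ι → Finset α) :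
    ∑ a ∈ s.biUnion t, f a ≤ ∑ i ∈ s, ∑ a ∈ t i, f a := by
  classical
  induction s using Finset.induction_on with
  | empty => simp
  | insert i s hi ih =>
    rw [Finset.biUnion_insert, Finset.sum_insert hi]
    have := Finset.sum_union_inter (s₁ := t i) (s₂ := s.biUnion t) (f := f)
    have := Finset.sum_nonneg fun a (_ : a ∈ t i ∩ s.biUnion t) ↦ hf a
    linarith

/-- The terms on which a completely multiplicative function differs from `1`, when the function is
`1` at all small primes. -/
lemma sum_filter_ne_one_le {w : ℕ →*₀ ℂ} {y N : ℕ} (hy : N < (y + 1) ^ 2)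
    (hw : ∀ p : ℕ, p.Prime → p ≤ N → w p ≠ 1 → y < p ∧ p ≡ 1 [MOD m]) :
    ∑ n ∈ Finset.Ioc 0 N with w n ≠ 1, charProdRe m n ≤
      ∑ d ∈ Finset.Ioc y N, charLambdaReal m d / Real.log d *
        ∑ n ∈ Finset.Ioc 0 (N / d), charProdReal m n := by
  classical
  set P := (Finset.Ioc y N).filter fun p ↦ p.Prime ∧ p ≡ 1 [MOD m] with hP
  have hsub : (Finset.Ioc 0 N).filter (fun n ↦ w n ≠ 1) ⊆
      P.biUnion fun p ↦ (Finset.Ioc 0 (N / p)).image (p * ·) := by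
    intro n hn
    obtain ⟨hn1, hn2⟩ := Finset.mem_filter.mp hn
    obtain ⟨hn0, hnN⟩ := Finset.mem_Ioc.mp hn1
    obtain ⟨p, hp, ⟨l, rfl⟩, hwp⟩ := exists_prime_dvd_of_map_ne_one hn0.ne' hn2
    have hl : 0 < l := Nat.pos_of_mul_pos_left hn0
    have hpN : p ≤ N := (Nat.le_mul_of_pos_right p hl).trans hnN
    obtain ⟨h1, h2⟩ := hw p hp hpN hwp
    refine Finset.mem_biUnion.mpr ⟨p, by simp [hP, h1, hpN, hp, h2],
      Finset.mem_image.mpr ⟨l, Finset.mem_Ioc.mpr ⟨hl, ?_⟩, rfl⟩⟩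
    rwa [Nat.le_div_iff_mul_le hp.pos, mul_comm]
  have hnn := charProdRe_nonneg m
  calc _ ≤ ∑ n ∈ P.biUnion fun p ↦ (Finset.Ioc 0 (N / p)).image (p * ·), charProdRe m n :=
        Finset.sum_le_sum_of_subset_of_nonneg hsub fun _ _ _ ↦ hnn _
    _ ≤ ∑ p ∈ P, ∑ n ∈ (Finset.Ioc 0 (N / p)).image (p * ·), charProdRe m n :=
        sum_biUnion_le_sum_of_nonneg hnn _ _
    _ = ∑ p ∈ P, charLambdaReal m p / Real.log p *
          ∑ n ∈ Finset.Ioc 0 (N / p), charProdReal m n := by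
        refine Finset.sum_congr rfl fun p hpP ↦ ?_
        simp only [hP, Finset.mem_filter, Finset.mem_Ioc] at hpP
        obtain ⟨⟨hyp, hpN⟩, hp, hpm⟩ := hpP
        rw [Finset.sum_image fun a _ b _ h ↦ Nat.eq_of_mul_eq_mul_left hp.pos h, Finset.mul_sum]
        refine Finset.sum_congr rfl fun n hn ↦ charProdRe_prime_mul m hp hpm ?_
        obtain ⟨hn0, hnN⟩ := Finset.mem_Ioc.mp hn
        intro hdvd
        have h1 : p ≤ N / p := (Nat.le_of_dvd hn0 hdvd).trans hnN
        have h2 : p * p ≤ N := (Nat.le_div_iff_mul_le hp.pos).mp h1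
        nlinarith
    _ ≤ _ := by
        refine Finset.sum_le_sum_of_subset_of_nonneg (Finset.filter_subset _ _) fun d _ _ ↦ ?_
        exact mul_nonneg (div_nonneg (charLambdaReal_nonneg m d) (Real.log_natCast_nonneg d))
          (Finset.sum_nonneg fun n _ ↦ hnn n)

/-- Vinogradov's lower bound. -/
theorem exists_mul_le_norm_sum_charProd {u : ℝ} (hu : 1 < u) (hu' : u < √(Real.exp 1)) :
    ∃ c : ℝ, 0 < c ∧ ∀ᶠ N : ℕ in atTop, ∀ w : ℕ →*₀ ℂ, (∀ n, ‖w n‖ ≤ 1) →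
      (∀ p : ℕ, p.Prime → p ≤ N → w p ≠ 1 → (N : ℝ) ^ (1 / u) < p ∧ p ≡ 1 [MOD m]) →
      c * N ≤ ‖∑ n ∈ Finset.Ioc 0 N, charProd m n * w n‖ := by
  obtain ⟨κ, hκ, hF⟩ := exists_tendsto_sum_charProd m
  have hlu : Real.log u < 1 / 2 := by
    have := Real.log_lt_log (by linarith) hu'
    rwa [Real.log_sqrt (Real.exp_pos _).le, Real.log_exp] at this
  have hu2 : u < 2 := by
    refine hu'.trans_le (Real.sqrt_le_iff.mpr ⟨by norm_num, ?_⟩)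
    linarith [Real.exp_one_lt_d9]
  set ε : ℝ := κ * (1 / 2 - Real.log u) / 4 with hε
  have hε0 : 0 < ε := by
    have := sub_pos.mpr hlu
    positivity
  set η : ℝ := (1 / 2 - Real.log u) / 2 with hη
  have hη0 : 0 < η := by
    have := sub_pos.mpr hlu
    positivity
  refine ⟨κ * (1 / 2 - Real.log u), mul_pos hκ (sub_pos.mpr hlu), ?_⟩
  filter_upwards [eventually_sum_div_log_mul_le (f := charProdReal m) (charProdRe_nonneg m)
    (charLambdaReal_nonneg m) (log_mul_charProdReal m) hκ hF (sum_charLambdaReal_le m) hu hε0,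
    exists_sum_mem_of_tendsto hκ hF hη0, eventually_gt_atTop 1] with N h1 h2 hN w hw hwp
  have hN1 : (1 : ℝ) < N := by exact_mod_cast hN
  have hsq : N < (⌊(N : ℝ) ^ (1 / u)⌋₊ + 1) ^ 2 := by
    have h3 := Nat.lt_floor_add_one ((N : ℝ) ^ (1 / u))
    have h4 : (N : ℝ) ≤ ((N : ℝ) ^ (1 / u)) ^ 2 := by
      rw [← Real.rpow_natCast, ← Real.rpow_mul (by linarith)]
      refine Real.self_le_rpow_of_one_le hN1.le ?_
      rw [div_mul_eq_mul_div, one_mul, le_div_iff₀ (by linarith)]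
      push_cast
      linarith
    have h5 : (N : ℝ) < (⌊(N : ℝ) ^ (1 / u)⌋₊ + 1) ^ 2 :=
      h4.trans_lt (pow_lt_pow_left₀ h3 (by positivity) two_ne_zero)
    exact_mod_cast h5
  have h3 := sum_filter_ne_one_le m hsq (w := w) fun p hp hpN hwp' ↦ by
    obtain ⟨h4, h5⟩ := hwp p hp hpN hwp'
    exact ⟨(Nat.floor_lt (by positivity)).mpr h4, h5⟩
  have h4 : ‖∑ n ∈ Finset.Ioc 0 N, charProd m n * (1 - w n)‖ ≤
      2 * ∑ n ∈ Finset.Ioc 0 N with w n ≠ 1, charProdRe m n := by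
    rw [Finset.mul_sum, Finset.sum_filter]
    refine (norm_sum_le _ _).trans (Finset.sum_le_sum fun n _ ↦ ?_)
    split_ifs with h
    · rw [norm_mul, ← coe_charProdRe, Complex.norm_real, Real.norm_of_nonneg (charProdRe_nonneg m n),
        mul_comm]
      refine mul_le_mul_of_nonneg_right ?_ (charProdRe_nonneg m n)
      refine (norm_sub_le _ _).trans ?_
      have := hw n
      simp only [norm_one]
      linarith
    · rw [not_not.mp h]
      simp
  have h5 : ∑ n ∈ Finset.Ioc 0 N, charProd m n * w n =
      ((∑ n ∈ Finset.Ioc 0 N, charProdRe m n : ℝ) : ℂ) -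
        ∑ n ∈ Finset.Ioc 0 N, charProd m n * (1 - w n) := by
    push_cast
    rw [← Finset.sum_sub_distrib]
    refine Finset.sum_congr rfl fun n _ ↦ ?_
    rw [coe_charProdRe]
    ring
  have h6 := norm_sub_norm_le ((∑ n ∈ Finset.Ioc 0 N, charProdRe m n : ℝ) : ℂ)
    (∑ n ∈ Finset.Ioc 0 N, charProd m n * (1 - w n))
  rw [← h5, Complex.norm_real,
    Real.norm_of_nonneg (Finset.sum_nonneg fun n _ ↦ charProdRe_nonneg m n)] at h6
  have h7 : κ * (1 - η) * N ≤ ∑ n ∈ Finset.Ioc 0 N, charProdRe m n := h2.1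
  have h8 : κ * (1 / 2 - Real.log u) * N = κ * (1 - η) * N - 2 * ((κ * Real.log u + ε) * N) := by
    rw [hε, hη]
    ring
  linarith

end Vinogradov

section Transfer

open ArithmeticFunction Filter Topology

lemma exists_sum_mul_rpow_le {a : ℕ → ℝ} (ha : ∀ n, 0 ≤ a n) {c : ℝ}
    (h : ∀ N : ℕ, ∑ n ∈ Finset.Ioc 0 N, a n ≤ c * √N) :
    ∃ C : ℝ, ∀ x : ℕ, ∑ n ∈ Finset.Ioc 0 x, a n * (n : ℝ) ^ (-(3 / 4) : ℝ) ≤ C := by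
  have hc : 0 ≤ c := by
    have := (Finset.sum_nonneg fun n _ ↦ ha n).trans (h 1)
    simpa using this
  set r : ℝ := (4 : ℝ) ^ (-(1 / 4) : ℝ) with hr
  have hr0 : 0 < r := by positivity
  have hr1 : r < 1 := Real.rpow_lt_one_of_one_lt_of_neg (by norm_num) (by norm_num)
  have hblock : ∀ J : ℕ, ∑ n ∈ Finset.Ioc (4 ^ J) (4 ^ (J + 1)), a n * (n : ℝ) ^ (-(3 / 4) : ℝ) ≤
      2 * c * r ^ J := by
    intro J
    calc _ ≤ ∑ n ∈ Finset.Ioc (4 ^ J) (4 ^ (J + 1)), a n * ((4 : ℝ) ^ J) ^ (-(3 / 4) : ℝ) := by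
          refine Finset.sum_le_sum fun n hn ↦ mul_le_mul_of_nonneg_left ?_ (ha n)
          refine Real.rpow_le_rpow_of_nonpos (by positivity) ?_ (by norm_num)
          exact_mod_cast (Finset.mem_Ioc.mp hn).1.le
      _ ≤ (c * √(4 ^ (J + 1) : ℕ)) * ((4 : ℝ) ^ J) ^ (-(3 / 4) : ℝ) := by
          rw [← Finset.sum_mul]
          refine mul_le_mul_of_nonneg_right (le_trans ?_ (h _)) (by positivity)
          exact Finset.sum_le_sum_of_subset_of_nonneg
            (Finset.Ioc_subset_Ioc_left (Nat.zero_le _)) fun n _ _ ↦ ha n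
      _ = _ := by
          have h1 : √((4 ^ (J + 1) : ℕ) : ℝ) = 2 * ((4 : ℝ) ^ J) ^ (1 / 2 : ℝ) := by
            rw [pow_succ, mul_comm]
            push_cast
            rw [Real.sqrt_mul (by norm_num), Real.sqrt_eq_rpow ((4 : ℝ) ^ J),
              show (4 : ℝ) = 2 ^ 2 by norm_num, Real.sqrt_sq (by norm_num)]
          rw [h1, hr, ← Real.rpow_natCast, ← Real.rpow_natCast, ← Real.rpow_mul (by norm_num),
            ← Real.rpow_mul (by norm_num), ← Real.rpow_mul (by norm_num)]
          rw [show c * (2 * (4 : ℝ) ^ ((J : ℝ) * (1 / 2))) * (4 : ℝ) ^ ((J : ℝ) * -(3 / 4)) =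
            2 * c * ((4 : ℝ) ^ ((J : ℝ) * (1 / 2)) * (4 : ℝ) ^ ((J : ℝ) * -(3 / 4))) by ring,
            ← Real.rpow_add (by norm_num)]
          congr 2
          ring
  have hdyadic : ∀ J : ℕ, ∑ n ∈ Finset.Ioc 0 (4 ^ J), a n * (n : ℝ) ^ (-(3 / 4) : ℝ) ≤
      a 1 + ∑ i ∈ Finset.range J, 2 * c * r ^ i := by
    intro J
    induction J with
    | zero =>
      rw [pow_zero, show Finset.Ioc 0 1 = {1} from rfl]
      simp
    | succ J ih =>
      rw [← Finset.sum_Ioc_consecutive _ (Nat.zero_le (4 ^ J))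
        (Nat.pow_le_pow_right (by norm_num) (Nat.le_succ J)), Finset.sum_range_succ]
      linarith [hblock J]
  refine ⟨a 1 + 2 * c * (1 - r)⁻¹, fun x ↦ ?_⟩
  have hx : x ≤ 4 ^ x := (Nat.lt_pow_self (by norm_num)).le
  calc _ ≤ ∑ n ∈ Finset.Ioc 0 (4 ^ x), a n * (n : ℝ) ^ (-(3 / 4) : ℝ) :=
        Finset.sum_le_sum_of_subset_of_nonneg (Finset.Ioc_subset_Ioc_right hx) fun n _ _ ↦
          mul_nonneg (ha n) (by positivity)
    _ ≤ _ := hdyadic x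
    _ ≤ _ := by
        rw [← Finset.mul_sum, ← tsum_geometric_of_lt_one hr0.le hr1]
        gcongr
        exact (summable_geometric_of_lt_one hr0.le hr1).sum_le_tsum _ fun _ _ ↦ by positivity

lemma exists_sum_vonMangoldt_mul_rpow_le {ε : ℝ} (hε : 0 < ε) : ∃ C : ℝ, ∀ Q : ℕ, Q ≠ 0 → ∀ x : ℕ,
    ∑ n ∈ Finset.Ioc 0 x with ¬ (n.Prime ∧ ¬ n ∣ Q), vonMangoldt n * (n : ℝ) ^ (-(3 / 4) : ℝ) ≤
      ε * Real.log Q + C := by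
  obtain ⟨c, hc⟩ := Chebyshev.psi_sub_theta_le_mul_sqrt
  obtain ⟨C, hC⟩ := exists_sum_mul_rpow_le (a := fun n ↦ if n.Prime then 0 else vonMangoldt n)
    (c := c) (fun n ↦ by split_ifs; exacts [le_rfl, vonMangoldt_nonneg]) fun N ↦ by
      refine le_trans (le_of_eq ?_) (hc N)
      rw [Chebyshev.psi, Chebyshev.theta, Nat.floor_natCast, Finset.sum_filter,
        ← Finset.sum_sub_distrib]
      refine Finset.sum_congr rfl fun n _ ↦ ?_
      split_ifs with hn
      · rw [vonMangoldt_apply_prime hn, sub_self]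
      · rw [sub_zero]
  obtain ⟨P, hP⟩ : ∃ P : ℕ, ∀ n : ℕ, P ≤ n → (n : ℝ) ^ (-(3 / 4) : ℝ) ≤ ε := by
    have := (tendsto_rpow_neg_atTop (y := (3 / 4 : ℝ)) (by norm_num)).comp
      (tendsto_natCast_atTop_atTop (R := ℝ))
    exact eventually_atTop.mp (this.eventually_le_const hε)
  refine ⟨∑ n ∈ Finset.range P, vonMangoldt n * (n : ℝ) ^ (-(3 / 4) : ℝ) + C, fun Q hQ x ↦ ?_⟩
  have hnn : ∀ n : ℕ, 0 ≤ vonMangoldt n * (n : ℝ) ^ (-(3 / 4) : ℝ) := fun n ↦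
    mul_nonneg vonMangoldt_nonneg (by positivity)
  have hdiv : ∑ n ∈ Q.divisors, vonMangoldt n * (n : ℝ) ^ (-(3 / 4) : ℝ) ≤
      ε * Real.log Q + ∑ n ∈ Finset.range P, vonMangoldt n * (n : ℝ) ^ (-(3 / 4) : ℝ) := by
    rw [← vonMangoldt_sum, Finset.mul_sum,
      ← Finset.sum_filter_add_sum_filter_not Q.divisors (P ≤ ·)]
    refine add_le_add ?_ ?_
    · calc _ ≤ ∑ n ∈ Q.divisors with P ≤ n, ε * vonMangoldt n := by
            refine Finset.sum_le_sum fun n hn ↦ ?_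
            rw [mul_comm]
            exact mul_le_mul_of_nonneg_right (hP n (Finset.mem_filter.mp hn).2) vonMangoldt_nonneg
        _ ≤ _ := Finset.sum_le_sum_of_subset_of_nonneg (Finset.filter_subset _ _) fun n _ _ ↦
            mul_nonneg hε.le vonMangoldt_nonneg
    · refine Finset.sum_le_sum_of_subset_of_nonneg (fun n hn ↦ ?_) fun n _ _ ↦ hnn n
      simpa using (Finset.mem_filter.mp hn).2
  have hsplit : ∑ n ∈ Finset.Ioc 0 x with ¬ (n.Prime ∧ ¬ n ∣ Q),
      vonMangoldt n * (n : ℝ) ^ (-(3 / 4) : ℝ) ≤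
      ∑ n ∈ Finset.Ioc 0 x, (if n.Prime then 0 else vonMangoldt n) * (n : ℝ) ^ (-(3 / 4) : ℝ) +
      ∑ n ∈ Q.divisors, vonMangoldt n * (n : ℝ) ^ (-(3 / 4) : ℝ) := by
    rw [← Finset.sum_filter_add_sum_filter_not _ Nat.Prime, add_comm]
    refine add_le_add ?_ ?_
    · rw [Finset.filter_filter, Finset.sum_filter]
      refine Finset.sum_le_sum fun n _ ↦ ?_
      split_ifs with h1 h2
      · exact absurd h2 h1.2
      · exact le_rfl
      · simp
      · exact hnn n
    · refine Finset.sum_le_sum_of_subset_of_nonneg (fun n hn ↦ ?_) fun n _ _ ↦ hnn n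
      simp only [Finset.mem_filter, not_and, not_not] at hn
      exact Nat.mem_divisors.mpr ⟨hn.1.2 hn.2, hQ⟩
  linarith [hC x]

lemma sum_norm_mul_rpow_le {h L : ArithmeticFunction ℂ} (hL : logDer h = h * L) {j : ℕ}
    (h1 : ∀ x : ℕ, ∑ n ∈ Finset.Ioc 0 x, ‖h n‖ / n ≤ (1 + Real.log x) ^ j) {K : ℝ} (hK : 0 < K)
    (hLK : ∀ x : ℕ, ∑ n ∈ Finset.Ioc 0 x, ‖L n‖ * (n : ℝ) ^ (-(3 / 4) : ℝ) ≤ K) (x : ℕ) :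
    ∑ n ∈ Finset.Ioc 0 x, ‖h n‖ * (n : ℝ) ^ (-(3 / 4) : ℝ) ≤
      2 * (Real.exp (K / 2) * (1 + 2 * K) ^ j) := by
  let N : ArithmeticFunction ℂ → ArithmeticFunction ℝ := fun F ↦
    ⟨fun n ↦ ‖F n‖ * (n : ℝ) ^ (-(3 / 4) : ℝ), by simp⟩
  have hN : ∀ F n, 0 ≤ N F n := fun F n ↦ mul_nonneg (norm_nonneg _) (by positivity)
  set W := ∑ n ∈ Finset.Ioc 0 x, N h n with hW
  have hW0 : 0 ≤ W := Finset.sum_nonneg fun n _ ↦ hN h n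
  have hlog : ∑ n ∈ Finset.Ioc 0 x, Real.log n * N h n ≤ W * K := by
    calc _ ≤ ∑ n ∈ Finset.Ioc 0 x, (N h * N L) n := by
          refine Finset.sum_le_sum fun n _ ↦ ?_
          have e : Real.log n * N h n = ‖(h * L) n‖ * (n : ℝ) ^ (-(3 / 4) : ℝ) := by
            rw [← hL, logDer_apply, norm_mul, Complex.norm_real,
              Real.norm_of_nonneg (Real.log_natCast_nonneg n), mul_assoc]
            rfl
          rw [e, mul_apply, mul_apply]
          calc _ ≤ (∑ y ∈ n.divisorsAntidiagonal, ‖h y.1 * L y.2‖) * (n : ℝ) ^ (-(3 / 4) : ℝ) := by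
                gcongr
                exact norm_sum_le _ _
            _ = _ := by
              rw [Finset.sum_mul]
              refine Finset.sum_congr rfl fun y hy ↦ ?_
              rw [← (Nat.mem_divisorsAntidiagonal.mp hy).1, norm_mul, Nat.cast_mul,
                Real.mul_rpow (Nat.cast_nonneg _) (Nat.cast_nonneg _)]
              exact mul_mul_mul_comm _ _ _ _
      _ ≤ _ := by
          rw [sum_Ioc_mul_eq_sum_sum, hW, Finset.sum_mul]
          exact Finset.sum_le_sum fun n _ ↦ mul_le_mul_of_nonneg_left (hLK _) (hN h n)
  set Y := ⌊Real.exp (2 * K)⌋₊ with hY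
  have hY0 : 0 < Y := Nat.floor_pos.mpr (Real.one_le_exp (by positivity))
  have hYle : (Y : ℝ) ≤ Real.exp (2 * K) := Nat.floor_le (Real.exp_pos _).le
  have hsmall : ∑ n ∈ Finset.Ioc 0 Y, N h n ≤ Real.exp (K / 2) * (1 + 2 * K) ^ j := by
    calc _ ≤ ∑ n ∈ Finset.Ioc 0 Y, ‖h n‖ / n * Real.exp (K / 2) := by
          refine Finset.sum_le_sum fun n hn ↦ ?_
          obtain ⟨hn0, hnY⟩ := Finset.mem_Ioc.mp hn
          have hn0' : (0 : ℝ) < n := by exact_mod_cast hn0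
          have hnY' : (n : ℝ) ≤ Real.exp (2 * K) := (Nat.cast_le.mpr hnY).trans hYle
          have e : (n : ℝ) ^ (-(3 / 4) : ℝ) = (n : ℝ) ^ (1 / 4 : ℝ) / n := by
            rw [← Real.rpow_sub_one hn0'.ne']
            norm_num
          have e2 : (n : ℝ) ^ (1 / 4 : ℝ) ≤ Real.exp (K / 2) := by
            calc _ ≤ Real.exp (2 * K) ^ (1 / 4 : ℝ) :=
                  Real.rpow_le_rpow hn0'.le hnY' (by norm_num)
              _ = _ := by
                  rw [← Real.exp_mul]
                  congr 1
                  ring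
          change ‖h n‖ * (n : ℝ) ^ (-(3 / 4) : ℝ) ≤ _
          rw [e, mul_div_assoc', div_mul_eq_mul_div]
          gcongr
      _ ≤ (1 + Real.log Y) ^ j * Real.exp (K / 2) := by
          rw [← Finset.sum_mul]
          gcongr
          exact h1 Y
      _ ≤ _ := by
          rw [mul_comm]
          have h2 : Real.log Y ≤ 2 * K := by
            rw [← Real.log_exp (2 * K)]
            exact Real.log_le_log (by exact_mod_cast hY0) hYle
          have := Real.log_natCast_nonneg Y
          gcongr
  have hsplit : W ≤ ∑ n ∈ Finset.Ioc 0 Y, N h n +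
      (∑ n ∈ Finset.Ioc 0 x, Real.log n * N h n) / (2 * K) := by
    rw [hW, ← Finset.sum_filter_add_sum_filter_not _ (· ≤ Y), Finset.sum_div]
    refine add_le_add ?_ ?_
    · refine Finset.sum_le_sum_of_subset_of_nonneg (fun n hn ↦ ?_) fun n _ _ ↦ hN h n
      simp only [Finset.mem_filter, Finset.mem_Ioc] at hn ⊢
      exact ⟨hn.1.1, hn.2⟩
    · rw [Finset.sum_filter]
      refine Finset.sum_le_sum fun n _ ↦ ?_
      split_ifs with h3
      · exact div_nonneg (mul_nonneg (Real.log_natCast_nonneg n) (hN h n)) (by positivity)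
      · rw [le_div_iff₀ (by positivity), mul_comm]
        refine mul_le_mul_of_nonneg_right ?_ (hN h n)
        have h4 : Real.exp (2 * K) < n := (Nat.floor_lt (Real.exp_pos _).le).mp (not_le.mp h3)
        rw [← Real.log_exp (2 * K)]
        exact Real.log_le_log (Real.exp_pos _) h4.le
  have h5 : (∑ n ∈ Finset.Ioc 0 x, Real.log n * N h n) / (2 * K) ≤ W / 2 := by
    rw [div_le_iff₀ (by positivity)]
    linarith
  change W ≤ _
  linarith

end Transfer

section Transfer

open ArithmeticFunction Filter Topology

lemma norm_sum_mul_le_of_hasSmallSums {h G : ArithmeticFunction ℂ} {V j c : ℕ} {η : ℝ} (hη : 0 ≤ η)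
    (hG : HasSmallSums G V j c η) {W : ℝ} {x : ℕ} (hx : 0 < x)
    (hW : ∑ n ∈ Finset.Ioc 0 x, ‖h n‖ * (n : ℝ) ^ (-(3 / 4) : ℝ) ≤ W) :
    ‖∑ n ∈ Finset.Ioc 0 x, (h * G) n‖ ≤
      W * (x * (1 + Real.log x) ^ j * (c * η + ((V : ℝ) / x) ^ (1 / 4 : ℝ))) := by
  have hx0 : (0 : ℝ) < x := by exact_mod_cast hx
  have hlx := one_le_one_add_log x
  have htriv : ∀ z : ℕ, ‖∑ n ∈ Finset.Ioc 0 z, G n‖ ≤ z * (1 + Real.log z) ^ j := by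
    intro z
    calc _ ≤ ∑ n ∈ Finset.Ioc 0 z, z * (‖G n‖ / n) := by
          refine (norm_sum_le _ _).trans (Finset.sum_le_sum fun n hn ↦ ?_)
          obtain ⟨hn0, hnz⟩ := Finset.mem_Ioc.mp hn
          have hn0' : (0 : ℝ) < n := by exact_mod_cast hn0
          have hnz' : (n : ℝ) ≤ z := by exact_mod_cast hnz
          rw [mul_div_assoc', le_div_iff₀ hn0', mul_comm]
          gcongr
      _ ≤ _ := by
          rw [← Finset.mul_sum]
          exact mul_le_mul_of_nonneg_left (hG.sum_norm_div_le z) (Nat.cast_nonneg z)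
  have hterm : ∀ d ∈ Finset.Ioc 0 x, ‖h d * ∑ n ∈ Finset.Ioc 0 (x / d), G n‖ ≤
      ‖h d‖ * (d : ℝ) ^ (-(3 / 4) : ℝ) *
        (x * (1 + Real.log x) ^ j * (c * η + ((V : ℝ) / x) ^ (1 / 4 : ℝ))) := by
    intro d hd
    obtain ⟨hd0, hdx⟩ := Finset.mem_Ioc.mp hd
    have hd0' : (0 : ℝ) < d := by exact_mod_cast hd0
    have hd1 : (1 : ℝ) ≤ d := by exact_mod_cast hd0
    have hcast : ((x / d : ℕ) : ℝ) ≤ x / d := Nat.cast_div_le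
    have hlog : (1 + Real.log (x / d : ℕ)) ^ j ≤ (1 + Real.log x) ^ j :=
      pow_le_pow_left₀ (zero_le_one.trans (one_le_one_add_log _))
        (one_add_log_mono (Nat.div_le_self x d)) j
    have hlog0 : 0 ≤ (1 + Real.log (x / d : ℕ)) ^ j :=
      pow_nonneg (zero_le_one.trans (one_le_one_add_log _)) j
    have hinv : (d : ℝ)⁻¹ = (d : ℝ) ^ (-(3 / 4) : ℝ) * (d : ℝ) ^ (-(1 / 4) : ℝ) := by
      rw [← Real.rpow_add hd0', ← Real.rpow_neg_one]
      norm_num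
    have hd4 : (d : ℝ) ^ (-(1 / 4) : ℝ) ≤ 1 := Real.rpow_le_one_of_one_le_of_nonpos hd1 (by norm_num)
    rw [norm_mul, mul_assoc]
    refine mul_le_mul_of_nonneg_left ?_ (norm_nonneg _)
    have hV : 0 ≤ ((V : ℝ) / x) ^ (1 / 4 : ℝ) := by positivity
    rcases le_or_gt V (x / d) with hVd | hVd
    · calc _ ≤ c * η * (x / d : ℕ) * (1 + Real.log (x / d : ℕ)) ^ j := hG.norm_sum_le _ hVd
        _ ≤ c * η * (x / d) * (1 + Real.log x) ^ j := by gcongr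
        _ = (d : ℝ) ^ (-(3 / 4) : ℝ) *
            (x * (1 + Real.log x) ^ j * (c * η * (d : ℝ) ^ (-(1 / 4) : ℝ))) := by
          rw [div_eq_mul_inv, hinv]
          ring
        _ ≤ _ := by
          gcongr
          have : c * η * (d : ℝ) ^ (-(1 / 4) : ℝ) ≤ c * η * 1 := by gcongr
          linarith
    · calc _ ≤ (x / d : ℕ) * (1 + Real.log (x / d : ℕ)) ^ j := htriv _
        _ ≤ x / d * (1 + Real.log x) ^ j := by gcongr
        _ = (d : ℝ) ^ (-(3 / 4) : ℝ) * (x * (1 + Real.log x) ^ j * (d : ℝ) ^ (-(1 / 4) : ℝ)) := by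
          rw [div_eq_mul_inv, hinv]
          ring
        _ ≤ _ := by
          gcongr
          have hV0 : (0 : ℝ) < V := by exact_mod_cast (Nat.zero_le _).trans_lt hVd
          have h1 : (x : ℝ) / V ≤ d := by
            rw [div_le_iff₀ hV0, mul_comm]
            exact_mod_cast ((Nat.div_lt_iff_lt_mul hd0).mp hVd).le
          have h2 : (d : ℝ) ^ (-(1 / 4) : ℝ) ≤ ((x : ℝ) / V) ^ (-(1 / 4) : ℝ) :=
            Real.rpow_le_rpow_of_nonpos (by positivity) h1 (by norm_num)
          have h3 : ((x : ℝ) / V) ^ (-(1 / 4) : ℝ) = ((V : ℝ) / x) ^ (1 / 4 : ℝ) := by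
            rw [Real.rpow_neg (by positivity), ← Real.inv_rpow (by positivity), inv_div]
          have : 0 ≤ c * η := by positivity
          linarith
  rw [sum_Ioc_mul_eq_sum_sum]
  refine (norm_sum_le _ _).trans ((Finset.sum_le_sum hterm).trans ?_)
  rw [← Finset.sum_mul]
  exact mul_le_mul_of_nonneg_right hW (by positivity)

lemma exists_exp_mul_pow_le (j : ℕ) : ∃ A : ℝ, 0 < A ∧ ∀ K : ℝ, 0 ≤ K →
    Real.exp (K / 2) * (1 + 2 * K) ^ j ≤ A * Real.exp K := by
  refine ⟨(1 + 4 * (j + 1)) ^ j, by positivity, fun K hK ↦ ?_⟩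
  set E := Real.exp (K / (2 * (j + 1))) with hE
  have hE1 : 1 ≤ E := Real.one_le_exp (by positivity)
  have h1 : K / (2 * (j + 1)) ≤ E := by linarith [Real.add_one_le_exp (K / (2 * (j + 1)))]
  have h2 : 1 + 2 * K ≤ (1 + 4 * (j + 1)) * E := by
    rw [div_le_iff₀ (by positivity)] at h1
    nlinarith
  have h3 : E ^ j ≤ Real.exp (K / 2) := by
    rw [hE, ← Real.exp_nat_mul]
    refine Real.exp_le_exp.mpr ?_
    rw [mul_div_assoc', div_le_div_iff₀ (by positivity) (by positivity)]
    nlinarith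
  calc _ ≤ Real.exp (K / 2) * ((1 + 4 * (j + 1)) * E) ^ j := by gcongr
    _ = (1 + 4 * (j + 1)) ^ j * (Real.exp (K / 2) * E ^ j) := by
      rw [mul_pow]
      ring
    _ ≤ (1 + 4 * (j + 1)) ^ j * (Real.exp (K / 2) * Real.exp (K / 2)) := by gcongr
    _ = _ := by
      rw [← Real.exp_add]
      congr 2
      ring

lemma twist_prod {ι : Type*} (v : ℕ →*₀ ℂ) (s : Finset ι) (A : ι → ArithmeticFunction ℂ) :
    twist v (∏ i ∈ s, A i) = ∏ i ∈ s, twist v (A i) := map_prod _ _ _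

lemma sum_norm_prod_div_le {ι : Type*} {s : Finset ι} (hs : s.Nonempty)
    {A : ι → ArithmeticFunction ℂ} (hA : ∀ i ∈ s, ∀ n, ‖A i n‖ ≤ 1) (x : ℕ) :
    ∑ n ∈ Finset.Ioc 0 x, ‖(∏ i ∈ s, A i) n‖ / n ≤ (1 + Real.log x) ^ s.card := by
  refine (HasSmallSums.prod hs one_pos zero_le_one hA fun i hi z _ ↦ ?_).sum_norm_div_le x
  refine (norm_sum_le _ _).trans ((Finset.sum_le_sum fun n _ ↦ hA i hi n).trans ?_)
  simp

variable (m : ℕ)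

/-- The ratio of two twists of `charProd m`. -/
noncomputable def charRatio (w v : ℕ →*₀ ℂ) : ArithmeticFunction ℂ :=
  twist w (charProd m) * twist v (charProdInv m)

lemma charRatio_mul (w v : ℕ →*₀ ℂ) :
    charRatio m w v * twist v (charProd m) = twist w (charProd m) := by
  rw [charRatio, mul_assoc, ← map_mul, mul_comm (charProdInv m), charProd_mul_inv, map_one, mul_one]

lemma logDer_charRatio (w v : ℕ →*₀ ℂ) : logDer (charRatio m w v) =
    charRatio m w v * (twist w (charLambda m) - twist v (charLambda m)) := by
  rw [charRatio, logDer_mul, logDer_twist, logDer_twist, logDer_charProd, logDer_charProdInv,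
    map_mul, map_neg, map_mul]
  ring

variable [NeZero m]

lemma card_dirichletCharacter :
    (Finset.univ : Finset (DirichletCharacter ℂ m)).card = m.totient := by
  rw [Finset.card_univ, ← Nat.card_eq_fintype_card,
    DirichletCharacter.card_eq_totient_of_hasEnoughRootsOfUnity]

lemma sum_norm_charRatio_div_le {w v : ℕ →*₀ ℂ} (hw : ∀ n, ‖w n‖ ≤ 1) (hv : ∀ n, ‖v n‖ ≤ 1)
    (x : ℕ) : ∑ n ∈ Finset.Ioc 0 x, ‖charRatio m w v n‖ / n ≤
      (1 + Real.log x) ^ (m.totient + m.totient) := by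
  have := one_le_one_add_log x
  have h : ∀ A : DirichletCharacter ℂ m → ArithmeticFunction ℂ, (∀ ψ n, ‖A ψ n‖ ≤ 1) →
      ∀ u : ℕ →*₀ ℂ, (∀ n, ‖u n‖ ≤ 1) → ∑ n ∈ Finset.Ioc 0 x, ‖twist u (∏ ψ, A ψ) n‖ / n ≤
        (1 + Real.log x) ^ m.totient := by
    intro A hA u hu
    rw [twist_prod, ← card_dirichletCharacter m]
    refine sum_norm_prod_div_le Finset.univ_nonempty (fun ψ _ n ↦ ?_) x
    rw [twist_apply, norm_mul]
    exact mul_le_one₀ (hu n) (norm_nonneg _) (hA ψ n)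
  rw [charRatio, pow_add]
  refine (sum_norm_div_mul_le _ _ x).trans (mul_le_mul (h _ (fun ψ n ↦ ?_) w hw)
    (h _ (fun ψ n ↦ ?_) v hv) (Finset.sum_nonneg fun _ _ ↦ by positivity) (by positivity))
  · exact norm_charHom_le ψ n
  · rw [twist_apply, norm_mul]
    refine mul_le_one₀ (norm_charHom_le ψ n) (norm_nonneg _) ?_
    rw [intCoe_apply, Complex.norm_intCast]
    exact_mod_cast abs_moebius_le_one

lemma exists_sum_norm_charRatio_le {ε : ℝ} (hε : 0 < ε) : ∃ C : ℝ, 0 < C ∧ ∀ Q : ℕ, Q ≠ 0 →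
    ∀ w v : ℕ →*₀ ℂ, (∀ n, ‖w n‖ ≤ 1) → (∀ n, ‖v n‖ ≤ 1) →
    (∀ p : ℕ, p.Prime → p ≡ 1 [MOD m] → ¬ p ∣ Q → w p = v p) → ∀ x : ℕ,
    ∑ n ∈ Finset.Ioc 0 x, ‖charRatio m w v n‖ * (n : ℝ) ^ (-(3 / 4) : ℝ) ≤ C * (Q : ℝ) ^ ε := by
  set k := m.totient with hk
  have hk0 : (0 : ℝ) < k := by exact_mod_cast Nat.totient_pos.mpr (NeZero.pos m)
  obtain ⟨C₀, hC₀⟩ := exists_sum_vonMangoldt_mul_rpow_le (ε := ε / (2 * k)) (by positivity)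
  obtain ⟨A, hA0, hA⟩ := exists_exp_mul_pow_le (k + k)
  set C₁ : ℝ := 2 * k * |C₀| + 1 with hC₁
  refine ⟨2 * (A * Real.exp C₁), by positivity, fun Q hQ w v hw hv hwv x ↦ ?_⟩
  have hQ0 : (0 : ℝ) < Q := by exact_mod_cast Nat.pos_of_ne_zero hQ
  have hlogQ := Real.log_natCast_nonneg Q
  set K : ℝ := ε * Real.log Q + C₁ with hK
  have hK0 : 0 < K := by positivity
  have hL : ∀ n, ‖(twist w (charLambda m) - twist v (charLambda m)) n‖ ≤
      if ¬ (n.Prime ∧ ¬ n ∣ Q) then 2 * k * vonMangoldt n else 0 := by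
    intro n
    have e : (twist w (charLambda m) - twist v (charLambda m)) n =
        (w n - v n) * charLambda m n := by
      rw [sub_eq_add_neg, ArithmeticFunction.add_apply, ArithmeticFunction.neg_apply, twist_apply, twist_apply]
      ring
    rw [e, ← coe_charLambdaReal, norm_mul, Complex.norm_real,
      Real.norm_of_nonneg (charLambdaReal_nonneg m n)]
    split_ifs with h
    · obtain ⟨h1, h2⟩ := h
      by_cases h3 : n ≡ 1 [MOD m]
      · simp [hwv n h1 h3 h2]
      · simp [charLambdaReal_apply, h3]
    · rw [mul_assoc]
      refine mul_le_mul ((norm_sub_le _ _).trans ?_) (charLambdaReal_le m n)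
        (charLambdaReal_nonneg m n) zero_le_two
      linarith [hw n, hv n]
  have hsum : ∀ x : ℕ, ∑ n ∈ Finset.Ioc 0 x,
      ‖(twist w (charLambda m) - twist v (charLambda m)) n‖ * (n : ℝ) ^ (-(3 / 4) : ℝ) ≤ K := by
    intro x
    calc _ ≤ ∑ n ∈ Finset.Ioc 0 x, 2 * k * (if ¬ (n.Prime ∧ ¬ n ∣ Q) then
            vonMangoldt n * (n : ℝ) ^ (-(3 / 4) : ℝ) else 0) := by
          refine Finset.sum_le_sum fun n _ ↦ ?_
          refine (mul_le_mul_of_nonneg_right (hL n) (by positivity)).trans (le_of_eq ?_)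
          split_ifs <;> ring
      _ ≤ 2 * k * (ε / (2 * k) * Real.log Q + C₀) := by
          rw [← Finset.mul_sum, ← Finset.sum_filter]
          exact mul_le_mul_of_nonneg_left (hC₀ Q hQ x) (by positivity)
      _ = ε * Real.log Q + 2 * k * C₀ := by field_simp
      _ ≤ _ := by
          rw [hK, hC₁]
          have : 2 * k * C₀ ≤ 2 * k * |C₀| := by
            gcongr
            exact le_abs_self _
          linarith
  refine (sum_norm_mul_rpow_le (logDer_charRatio m w v) (sum_norm_charRatio_div_le m hw hv) hK0
    hsum x).trans ?_
  have h1 := hA K hK0.le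
  have h2 : Real.exp K = Real.exp C₁ * (Q : ℝ) ^ ε := by
    rw [hK, Real.exp_add, Real.rpow_def_of_pos hQ0, mul_comm (Real.log Q)]
    ring
  rw [h2] at h1
  linarith

end Transfer

section CompletelyMultiplicative

/-- The completely multiplicative function with given values at the primes. -/
noncomputable def homOfPrimes (g : ℕ → ℂ) : ℕ →*₀ ℂ where
  toFun n := if n = 0 then 0 else n.factorization.prod fun p e ↦ g p ^ e
  map_zero' := by simp
  map_one' := by simp
  map_mul' a b := by
    rcases eq_or_ne a 0 with rfl | ha
    · simp
    rcases eq_or_ne b 0 with rfl | hb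
    · simp
    rw [if_neg (mul_ne_zero ha hb), if_neg ha, if_neg hb, Nat.factorization_mul ha hb,
      Finsupp.prod_add_index' (fun p ↦ pow_zero _) fun p ↦ pow_add _]

lemma homOfPrimes_prime (g : ℕ → ℂ) {p : ℕ} (hp : p.Prime) : homOfPrimes g p = g p := by
  change (if p = 0 then 0 else p.factorization.prod fun p e ↦ g p ^ e) = _
  rw [if_neg hp.ne_zero, hp.factorization,
    Finsupp.prod_single_index (h := fun p e ↦ g p ^ e) (pow_zero _), pow_one]

lemma norm_homOfPrimes_le {g : ℕ → ℂ} (hg : ∀ n, ‖g n‖ ≤ 1) (n : ℕ) : ‖homOfPrimes g n‖ ≤ 1 := by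
  change ‖if n = 0 then 0 else n.factorization.prod fun p e ↦ g p ^ e‖ ≤ 1
  split_ifs
  · simp
  · rw [Finsupp.prod, norm_prod]
    refine Finset.prod_le_one (fun _ _ ↦ norm_nonneg _) fun p _ ↦ ?_
    rw [norm_pow]
    exact pow_le_one₀ (norm_nonneg _) (hg p)

end CompletelyMultiplicative

section TwistedSums

open Filter Topology

variable {m : ℕ}

lemma charHom_mul_mod (ψ : DirichletCharacter ℂ m) {w : ℕ →*₀ ℂ} (hw : ∀ n, w (n % 8) = w n)
    (n : ℕ) : (charHom ψ * w) (n % (8 * m)) = (charHom ψ * w) n := by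
  have hmod : w (n % (8 * m)) = w n := by
    rw [← hw (n % (8 * m)), Nat.mod_mod_of_dvd _ (dvd_mul_right 8 m), hw]
  change charHom ψ (n % (8 * m)) * w (n % (8 * m)) = charHom ψ n * w n
  rw [hmod]
  rcases eq_or_ne n 0 with rfl | hn
  · simp
  rcases eq_or_ne (n % (8 * m)) 0 with h0 | h0
  · rw [h0, map_zero] at hmod
    rw [← hmod, mul_zero, mul_zero]
  · rw [charHom_apply ψ hn, charHom_apply ψ h0]
    congr 2
    rw [ZMod.natCast_eq_natCast_iff]
    exact (Nat.mod_modEq n (8 * m)).of_mul_left 8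

lemma twist_ofHom_charHom (ψ : DirichletCharacter ℂ m) (w : ℕ →*₀ ℂ) (N : ℕ) :
    twist (mulJacobi w N) (ofHom (charHom ψ)) = ofHom (mulJacobi (charHom ψ * w) N) := by
  ext n
  rw [twist_apply, ofHom_apply, ofHom_apply, mulJacobi_apply, mulJacobi_apply]
  change _ = charHom ψ n * w n * _
  ring

/-- Cancellation in the partial sums of the twist of `charProd m` by a quadratic character. -/
theorem exists_hasSmallSums_twist_charProd (hm : 0 < m) {ε : ℝ} (hε : 0 < ε) :
    ∃ δ : ℝ, 0 < δ ∧ ∀ᶠ q : ℕ in atTop, ∀ χ : DirichletCharacter ℂ q, χ ^ 2 = 1 →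
      ¬ χ.conductor ∣ m → ∃ v : ℕ →*₀ ℂ, (∀ n, ‖v n‖ ≤ 1) ∧
      (∀ n : ℕ, n.Coprime (2 * q) → χ n = v n) ∧
      HasSmallSums (twist v (charProd m)) (⌈(q : ℝ) ^ (1 / 4 + ε)⌉₊ ^ m.totient) m.totient
        (2 * m.totient) ((q : ℝ) ^ (-δ)) := by
  have : NeZero m := ⟨hm.ne'⟩
  obtain ⟨δ, hδ, h⟩ := exists_sum_mulJacobi_le (M := 8 * m) (by omega) hε
  refine ⟨δ, hδ, ?_⟩
  filter_upwards [h, eventually_gt_atTop 0] with q hq hq0 χ hχ hcond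
  obtain ⟨N, hNs, hNo, hNq, w, hw8, hws, hχN⟩ := exists_eq_mulJacobi hq0.ne' hχ
  have hv : ∀ n, ‖mulJacobi w N n‖ ≤ 1 := norm_mulJacobi_le hws.norm_le N
  refine ⟨mulJacobi w N, hv, hχN, ?_⟩
  obtain ⟨p, hpB, hp, hpm, hχp⟩ :=
    exists_prime_gt_char_eq_neg_one hq0.ne' hm.ne' hχ hcond (8 * m * (2 * q))
  have hcop : ∀ n : ℕ, 0 < n → n ≤ 8 * m * (2 * q) → p.Coprime n := fun n hn hnB ↦
    (Nat.Prime.coprime_iff_not_dvd hp).mpr fun hd ↦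
      absurd (Nat.le_of_dvd hn hd) (by omega)
  have hNle : N ≤ q := Nat.le_of_dvd hq0 hNq
  have hvp : mulJacobi w N p = -1 := by
    rw [← hχN p (hcop _ (by omega) (Nat.le_mul_of_pos_left _ (by omega))), hχp]
  rw [charProd, twist_prod, ← card_dirichletCharacter m]
  refine HasSmallSums.prod Finset.univ_nonempty (Nat.ceil_pos.mpr (by positivity)) (by positivity)
    (fun ψ _ n ↦ ?_) fun ψ _ z hz ↦ ?_
  · rw [twist_apply, norm_mul]
    exact mul_le_one₀ (hv n) (norm_nonneg _) (norm_charHom_le ψ n)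
  · simp only [twist_ofHom_charHom, ofHom_apply]
    rw [mul_comm]
    refine hq N hNs hNo hNle _ (charHom_mul_mod ψ hw8) (fun n ↦ ?_)
      ⟨p, hcop _ (by positivity [hNo.pos]) ?_, ?_⟩ z (Nat.ceil_le.mp hz)
    · change ‖charHom ψ n * w n‖ ≤ 1
      rw [norm_mul]
      exact mul_le_one₀ (norm_charHom_le ψ n) (norm_nonneg _) (hws.norm_le n)
    · gcongr
      omega
    · have hψp : charHom ψ p = 1 := by
        have : (p : ZMod m) = 1 := by
          rw [← Nat.cast_one, ZMod.natCast_eq_natCast_iff]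
          exact hpm
        rw [charHom_apply ψ hp.ne_zero, this, map_one]
      have : mulJacobi (charHom ψ * w) N p = charHom ψ p * mulJacobi w N p := by
        rw [mulJacobi_apply, mulJacobi_apply]
        exact mul_assoc _ _ _
      rw [this, hψp, hvp]
      norm_num

end TwistedSums

section LeastPrime

open Filter Topology

variable {m : ℕ}

lemma tendsto_floor_rpow_atTop {a : ℝ} (ha : 0 < a) :
    Tendsto (fun q : ℕ ↦ ⌊(q : ℝ) ^ a⌋₊) atTop atTop :=
  tendsto_nat_floor_atTop.comp ((tendsto_rpow_atTop ha).comp tendsto_natCast_atTop_atTop)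

lemma eventually_const_mul_rpow_neg_lt (A : ℝ) {δ c : ℝ} (hδ : 0 < δ) (hc : 0 < c) :
    ∀ᶠ q : ℕ in atTop, A * (q : ℝ) ^ (-δ) < c := by
  have h := ((tendsto_rpow_neg_atTop hδ).comp
    (tendsto_natCast_atTop_atTop (R := ℝ))).const_mul A
  rw [mul_zero] at h
  exact h.eventually_lt_const hc

/-- Partial sums of `charProd m` twisted by a completely multiplicative function agreeing with a
quadratic character at the primes `p ≡ 1 [MOD m]`. -/
lemma exists_norm_sum_charProd_le (hm : 0 < m) {a ε : ℝ} (hε : 0 < ε)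
    (ha : a = m.totient * (1 / 4 + ε) + ε) :
    ∃ A δ : ℝ, 0 < δ ∧ ∀ᶠ q : ℕ in atTop, ∀ χ : DirichletCharacter ℂ q, χ ^ 2 = 1 →
      ¬ χ.conductor ∣ m → ∃ w : ℕ →*₀ ℂ, (∀ n, ‖w n‖ ≤ 1) ∧
      (∀ p : ℕ, p.Prime → w p ≠ 1 → p ≡ 1 [MOD m] ∧ χ p = -1) ∧
      ‖∑ n ∈ Finset.Ioc 0 ⌊(q : ℝ) ^ a⌋₊, charProd m n * w n‖ ≤
        A * (q : ℝ) ^ (-δ) * ⌊(q : ℝ) ^ a⌋₊ := by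
  have : NeZero m := ⟨hm.ne'⟩
  set k := m.totient with hk
  have ha0 : 0 < a := by
    rw [ha]
    positivity
  obtain ⟨δ₀, hδ₀, h₀⟩ := exists_hasSmallSums_twist_charProd hm hε
  set δ := min δ₀ (ε / 4) with hδ
  have hδ0 : 0 < δ := lt_min hδ₀ (by positivity)
  obtain ⟨C, hC0, hC⟩ := exists_sum_norm_charRatio_le m (ε := δ / 4) (by positivity)
  obtain ⟨K, hK0, hK⟩ := exists_one_add_log_pow_le k (δ := δ / (4 * a)) (by positivity)
  refine ⟨C * 2 ^ (δ / 4) * (K * (2 * k + 2 ^ (k + 1))), δ / 2, by positivity, ?_⟩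
  filter_upwards [h₀, eventually_gt_atTop 0] with q hq hq0 χ hχ hcond
  obtain ⟨v, hv, hχv, hG⟩ := hq χ hχ hcond
  set g : ℕ → ℂ := fun p ↦ if p ≡ 1 [MOD m] ∧ ¬ p ∣ 2 * q then v p else 1 with hg
  have hw : ∀ n, ‖homOfPrimes g n‖ ≤ 1 := norm_homOfPrimes_le fun n ↦ by
    simp only [hg]
    split_ifs
    · exact hv n
    · simp
  refine ⟨homOfPrimes g, hw, fun p hp hwp ↦ ?_, ?_⟩
  · rw [homOfPrimes_prime g hp] at hwp
    simp only [hg] at hwp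
    split_ifs at hwp with h
    · obtain ⟨h1, h2⟩ := h
      have h3 : p.Coprime (2 * q) := (Nat.Prime.coprime_iff_not_dvd hp).mpr h2
      rw [← hχv p h3] at hwp
      exact ⟨h1, (dirichletCharacter_eq_one_or_neg_one hχ
        (Nat.Coprime.coprime_mul_left_right h3)).resolve_left hwp⟩
    · exact absurd rfl hwp
  have hq1 : (1 : ℝ) ≤ q := by exact_mod_cast hq0
  have hqpos : (0 : ℝ) < q := by linarith
  set x := ⌊(q : ℝ) ^ a⌋₊ with hx
  have hqa : 1 ≤ (q : ℝ) ^ a := Real.one_le_rpow hq1 ha0.le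
  have hx0 : 0 < x := Nat.floor_pos.mpr hqa
  have hxpos : (0 : ℝ) < x := by exact_mod_cast hx0
  have hxle : (x : ℝ) ≤ (q : ℝ) ^ a := Nat.floor_le (by positivity)
  have hxge : (q : ℝ) ^ a ≤ 2 * x := by
    have h1 := Nat.lt_floor_add_one ((q : ℝ) ^ a)
    have h2 : (1 : ℝ) ≤ x := by exact_mod_cast hx0
    linarith
  have hW := hC (2 * q) (by omega) (homOfPrimes g) v hw hv (fun p hp h1 h2 ↦ by
    rw [homOfPrimes_prime g hp]
    simp only [hg]
    rw [if_pos ⟨h1, h2⟩]) x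
  have hmain := norm_sum_mul_le_of_hasSmallSums (by positivity) hG hx0 hW
  rw [charRatio_mul] at hmain
  have hlog : (1 + Real.log x) ^ k ≤ K * (q : ℝ) ^ (δ / 4) := by
    refine (hK x hx0).trans (mul_le_mul_of_nonneg_left ?_ hK0)
    calc (x : ℝ) ^ (δ / (4 * a)) ≤ ((q : ℝ) ^ a) ^ (δ / (4 * a)) := by gcongr
      _ = _ := by
        rw [← Real.rpow_mul hqpos.le]
        congr 1
        field_simp
  have hη : (q : ℝ) ^ (-δ₀) ≤ (q : ℝ) ^ (-δ) :=
    Real.rpow_le_rpow_of_exponent_le hq1 (neg_le_neg (min_le_left _ _))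
  have hV : (((⌈(q : ℝ) ^ (1 / 4 + ε)⌉₊ ^ k : ℕ) : ℝ) / x) ^ (1 / 4 : ℝ) ≤
      2 ^ (k + 1) * (q : ℝ) ^ (-δ) := by
    have h1 : (⌈(q : ℝ) ^ (1 / 4 + ε)⌉₊ : ℝ) ≤ 2 * (q : ℝ) ^ (1 / 4 + ε) := by
      have h2 := (Nat.ceil_lt_add_one (a := (q : ℝ) ^ (1 / 4 + ε)) (by positivity)).le
      have h3 : 1 ≤ (q : ℝ) ^ (1 / 4 + ε) := Real.one_le_rpow hq1 (by positivity)
      linarith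
    have h4 : ((⌈(q : ℝ) ^ (1 / 4 + ε)⌉₊ ^ k : ℕ) : ℝ) / x ≤ 2 ^ (k + 1) * (q : ℝ) ^ (-ε) := by
      rw [div_le_iff₀ hxpos]
      calc _ ≤ (2 * (q : ℝ) ^ (1 / 4 + ε)) ^ k := by
            push_cast
            gcongr
        _ = 2 ^ k * ((q : ℝ) ^ (-ε) * (q : ℝ) ^ a) := by
            rw [mul_pow, ← Real.rpow_natCast ((q : ℝ) ^ (1 / 4 + ε)), ← Real.rpow_mul hqpos.le,
              ← Real.rpow_add hqpos, ha]
            congr 2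
            ring
        _ ≤ 2 ^ k * ((q : ℝ) ^ (-ε) * (2 * x)) := by gcongr
        _ = _ := by ring
    calc _ ≤ (2 ^ (k + 1) * (q : ℝ) ^ (-ε)) ^ (1 / 4 : ℝ) := by gcongr
      _ = ((2 : ℝ) ^ (k + 1)) ^ (1 / 4 : ℝ) * (q : ℝ) ^ (-(ε / 4)) := by
          rw [Real.mul_rpow (by positivity) (by positivity), ← Real.rpow_mul hqpos.le]
          congr 2
          ring
      _ ≤ _ := by
          refine mul_le_mul ?_ (Real.rpow_le_rpow_of_exponent_le hq1
            (neg_le_neg (min_le_right _ _))) (by positivity) (by positivity)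
          exact Real.rpow_le_self_of_one_le (one_le_pow₀ one_le_two) (by norm_num)
  have hcomm : ∑ n ∈ Finset.Ioc 0 x, charProd m n * homOfPrimes g n =
      ∑ n ∈ Finset.Ioc 0 x, twist (homOfPrimes g) (charProd m) n :=
    Finset.sum_congr rfl fun n _ ↦ mul_comm _ _
  rw [hcomm]
  refine hmain.trans ?_
  push_cast at hV ⊢
  have hl0 := one_le_one_add_log x
  calc _ ≤ C * (2 * (q : ℝ)) ^ (δ / 4) * (x * (K * (q : ℝ) ^ (δ / 4)) *
        (2 * k * (q : ℝ) ^ (-δ) + 2 ^ (k + 1) * (q : ℝ) ^ (-δ))) := by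
        gcongr
    _ = C * 2 ^ (δ / 4) * (K * (2 * k + 2 ^ (k + 1))) *
          ((q : ℝ) ^ (δ / 4) * (q : ℝ) ^ (δ / 4) * (q : ℝ) ^ (-δ)) * x := by
        rw [Real.mul_rpow zero_le_two hqpos.le]
        ring
    _ = _ := by
        rw [← Real.rpow_add hqpos, ← Real.rpow_add hqpos]
        congr 3
        ring

/-- The theorem for all sufficiently large moduli. -/
theorem eventually_exists_prime_char_eq_neg_one (hm : 0 < m) {ε : ℝ} (hε : 0 < ε) :
    ∀ᶠ q : ℕ in atTop, ∀ χ : DirichletCharacter ℂ q, χ ^ 2 = 1 → ¬ χ.conductor ∣ m →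
      ∃ p : ℕ, p.Prime ∧ p ≡ 1 [MOD m] ∧ χ p = -1 ∧
        (p : ℝ) ≤ (q : ℝ) ^ (m.totient / (4 * √(Real.exp 1)) + ε) := by
  have : NeZero m := ⟨hm.ne'⟩
  set b : ℝ := m.totient / (4 * √(Real.exp 1)) + ε with hb
  have hs0 : 0 < √(Real.exp 1) := Real.sqrt_pos.mpr (Real.exp_pos 1)
  have hs1 : 1 < √(Real.exp 1) := by
    rw [Real.lt_sqrt zero_le_one, one_pow]
    exact Real.one_lt_exp_iff.mpr one_pos
  have hb0 : 0 < b := by positivity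
  obtain ⟨u, hub, hu1, hu2⟩ : ∃ u : ℝ, (m.totient : ℝ) / 4 < u * b ∧ 1 < u ∧ u < √(Real.exp 1) := by
    have h1 : (m.totient : ℝ) / 4 < √(Real.exp 1) * b := by
      have : √(Real.exp 1) * b = m.totient / 4 + √(Real.exp 1) * ε := by
        rw [hb]
        field_simp
      have := mul_pos hs0 hε
      linarith
    have hcont : ContinuousAt (fun u : ℝ ↦ u * b) (√(Real.exp 1)) := by fun_prop
    exact (((hcont.eventually_const_lt h1).and (eventually_gt_nhds hs1)).filter_mono
      nhdsWithin_le_nhds |>.and (self_mem_nhdsWithin :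
        ∀ᶠ u in 𝓝[<] (√(Real.exp 1)), u ∈ Set.Iio (√(Real.exp 1)))).exists.imp
      fun u h ↦ ⟨h.1.1, h.1.2, h.2⟩
  have hu0 : 0 < u := by linarith
  set ε' : ℝ := (u * b - m.totient / 4) / (m.totient + 1) with hε'
  have hε'0 : 0 < ε' := div_pos (sub_pos.mpr hub) (by positivity)
  have hab : u * b = m.totient * (1 / 4 + ε') + ε' := by
    rw [hε']
    field_simp
    ring
  obtain ⟨A, δ, hδ, hA⟩ := exists_norm_sum_charProd_le hm hε'0 hab
  obtain ⟨c, hc, hV⟩ := exists_mul_le_norm_sum_charProd m hu1 hu2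
  filter_upwards [hA, (tendsto_floor_rpow_atTop (mul_pos hu0 hb0)).eventually hV,
    eventually_const_mul_rpow_neg_lt A hδ hc, eventually_gt_atTop 0] with q h1 h2 h3 hq0 χ hχ hcond
  have hq1 : (1 : ℝ) ≤ q := by exact_mod_cast hq0
  obtain ⟨w, hw, hwp, hsum⟩ := h1 χ hχ hcond
  by_contra! hno
  have hN0 : (0 : ℝ) < (⌊(q : ℝ) ^ (u * b)⌋₊ : ℝ) := by
    exact_mod_cast Nat.floor_pos.mpr (Real.one_le_rpow hq1 (by positivity))
  have hNu : (⌊(q : ℝ) ^ (u * b)⌋₊ : ℝ) ^ (1 / u) ≤ (q : ℝ) ^ b := by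
    calc _ ≤ ((q : ℝ) ^ (u * b)) ^ (1 / u) := by
          gcongr
          exact Nat.floor_le (by positivity)
      _ = _ := by
          rw [← Real.rpow_mul (by linarith)]
          congr 1
          field_simp
  have h4 := h2 w hw fun p hp _ hwp1 ↦ by
    obtain ⟨h5, h6⟩ := hwp p hp hwp1
    exact ⟨hNu.trans_lt (hno p hp h5 h6), h5⟩
  have h7 := le_of_mul_le_mul_right (h4.trans hsum) hN0
  linarith

lemma exists_bound_prime_char_eq_neg_one (hm : 0 < m) {q : ℕ} (hq : 0 < q) :
    ∃ B : ℕ, ∀ χ : DirichletCharacter ℂ q, χ ^ 2 = 1 → ¬ χ.conductor ∣ m →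
      ∃ p : ℕ, p.Prime ∧ p ≡ 1 [MOD m] ∧ χ p = -1 ∧ p ≤ B := by
  have : NeZero q := ⟨hq.ne'⟩
  have h : ∀ χ : DirichletCharacter ℂ q, ∃ p₀ : ℕ, χ ^ 2 = 1 → ¬ χ.conductor ∣ m →
      ∃ p : ℕ, p.Prime ∧ p ≡ 1 [MOD m] ∧ χ p = -1 ∧ p ≤ p₀ := by
    intro χ
    by_cases hχ : χ ^ 2 = 1 ∧ ¬ χ.conductor ∣ m
    · obtain ⟨p, -, hp, h1, h2⟩ := exists_prime_gt_char_eq_neg_one hq.ne' hm.ne' hχ.1 hχ.2 0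
      exact ⟨p, fun _ _ ↦ ⟨p, hp, h1, h2, le_rfl⟩⟩
    · exact ⟨0, fun h1 h2 ↦ absurd ⟨h1, h2⟩ hχ⟩
  choose P hP using h
  refine ⟨∑ χ, P χ, fun χ h1 h2 ↦ ?_⟩
  obtain ⟨p, hp, h3, h4, h5⟩ := hP χ h1 h2
  exact ⟨p, hp, h3, h4, h5.trans (Finset.single_le_sum (fun _ _ ↦ Nat.zero_le _)
    (Finset.mem_univ χ))⟩

end LeastPrime

/-- For any quadratic Dirichlet character `χ` mod `q` whose conductor does not divide `m`,
there is a prime `p ≡ 1 (mod m)` with `χ(p) = −1` and `p ≤ C(m,ε) q^{φ(m)/(4√e)+ε}`. -/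
theorem exists_prime_char_neg_one (m : ℕ) (hm : 0 < m) (ε : ℝ) (hε : 0 < ε) :
    ∃ C : ℝ, 0 < C ∧
      ∀ (q : ℕ), 0 < q → ∀ (χ : DirichletCharacter ℂ q), χ ^ 2 = 1 → ¬ χ.conductor ∣ m →
        ∃ p : ℕ, p.Prime ∧ p ≡ 1 [MOD m] ∧ χ (p : ZMod q) = -1 ∧
          (p : ℝ) ≤ C * (q : ℝ) ^ ((Nat.totient m : ℝ) / (4 * Real.sqrt (Real.exp 1)) + ε) := by
  obtain ⟨q₀, hq₀⟩ := Filter.eventually_atTop.mp (eventually_exists_prime_char_eq_neg_one hm hε)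
  have h : ∀ q : ℕ, ∃ B : ℕ, 0 < q → ∀ χ : DirichletCharacter ℂ q, χ ^ 2 = 1 →
      ¬ χ.conductor ∣ m → ∃ p : ℕ, p.Prime ∧ p ≡ 1 [MOD m] ∧ χ p = -1 ∧ p ≤ B := by
    intro q
    rcases Nat.eq_zero_or_pos q with rfl | hq
    · exact ⟨0, fun h ↦ absurd h (lt_irrefl 0)⟩
    · obtain ⟨B, hB⟩ := exists_bound_prime_char_eq_neg_one hm hq
      exact ⟨B, fun _ ↦ hB⟩
  choose B hB using h
  refine ⟨1 + ∑ q ∈ Finset.range q₀, (B q : ℝ), by positivity, fun q hq χ hχ hcond ↦ ?_⟩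
  have hsum : (0 : ℝ) ≤ ∑ q ∈ Finset.range q₀, (B q : ℝ) := by positivity
  rcases le_or_gt q₀ q with hqq | hqq
  · obtain ⟨p, hp, h1, h2, h3⟩ := hq₀ q hqq χ hχ hcond
    refine ⟨p, hp, h1, h2, h3.trans (le_mul_of_one_le_left (by positivity) ?_)⟩
    linarith
  · obtain ⟨p, hp, h1, h2, h3⟩ := hB q hq χ hχ hcond
    refine ⟨p, hp, h1, h2, ?_⟩
    have h4 : (B q : ℝ) ≤ ∑ q ∈ Finset.range q₀, (B q : ℝ) :=
      Finset.single_le_sum (f := fun q ↦ (B q : ℝ)) (fun _ _ ↦ Nat.cast_nonneg _)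
        (Finset.mem_range.mpr hqq)
    have h5 : (p : ℝ) ≤ B q := by exact_mod_cast h3
    have h6 : 1 ≤ (q : ℝ) ^ ((Nat.totient m : ℝ) / (4 * Real.sqrt (Real.exp 1)) + ε) :=
      Real.one_le_rpow (by exact_mod_cast hq) (by positivity)
    calc (p : ℝ) ≤ 1 + ∑ q ∈ Finset.range q₀, (B q : ℝ) := by linarith
      _ ≤ _ := le_mul_of_one_le_right (by positivity) h6
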